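/- There are exactly six directed edged embeddings of K_{3,3} into the torus up to equivalence. That is, the quotient of the set of all pairs (φ, (u,v)) — where φ is an embedding of K_{3,3} into T² and (u,v) is an ordered pair of adjacent vertices of K_{3,3} — by the equivalence relation of directed edged equivalence has exactly six elements. -/

import Mathlib

/-- The torus `T² = (ℝ/ℤ) × (ℝ/ℤ)`. -/
abbrev Torus := UnitAddCircle × UnitAddCircle

/-- An embedding of a simple graph `G` into the torus: an injective map `vert` on vertices
together with, for each edge `e = {u,v}`, an injective continuous path from `vert u` to
`vert v` meeting the vertex images only at its endpoints, such that the paths of two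
distinct edges meet only in images of common endpoints of the two edges. -/
structure TorusEmbedding {V : Type} (G : SimpleGraph V) where
  vert : V → Torus
  vert_inj : Function.Injective vert
  edge : G.edgeSet → C(unitInterval, Torus)
  edge_ends : ∀ e : G.edgeSet, ∃ u v : V, (e : Sym2 V) = s(u, v) ∧
    edge e 0 = vert u ∧ edge e 1 = vert v
  edge_inj : ∀ e : G.edgeSet, Function.Injective (edge e)
  edge_meets_verts : ∀ (e : G.edgeSet) (t : unitInterval),
    edge e t ∈ Set.range vert → t = 0 ∨ t = 1
  edge_disjoint : ∀ e e' : G.edgeSet, e ≠ e' → ∀ t t' : unitInterval,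
    edge e t = edge e' t' →
      ∃ w : V, w ∈ (e : Sym2 V) ∧ w ∈ (e' : Sym2 V) ∧ edge e t = vert w

/-- The image of an embedding: the union of the images of all edge paths. -/
def TorusEmbedding.image {V : Type} {G : SimpleGraph V} (E : TorusEmbedding G) : Set Torus :=
  ⋃ e : G.edgeSet, Set.range (E.edge e)

/-- The complete bipartite graph `K_{3,3}`. -/
abbrev K33 : SimpleGraph (Fin 3 ⊕ Fin 3) := completeBipartiteGraph (Fin 3) (Fin 3)

/-- A directed edged embedding of `K_{3,3}` into the torus: an embedding together with an
ordered pair `(u, v)` of adjacent vertices. -/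
structure DirEdgedEmbedding where
  emb : TorusEmbedding K33
  u : Fin 3 ⊕ Fin 3
  v : Fin 3 ⊕ Fin 3
  adj : K33.Adj u v

/-- The image of the path of the highlighted edge of a directed edged embedding. -/
def DirEdgedEmbedding.edgeImage (D : DirEdgedEmbedding) : Set Torus :=
  Set.range (D.emb.edge ⟨s(D.u, D.v), (SimpleGraph.mem_edgeSet K33).mpr D.adj⟩)

/-- Equivalence of directed edged embeddings: a homeomorphism of the torus carrying the
image of one embedding onto the image of the other, the highlighted edge path onto the
highlighted edge path, and respecting the start and end vertices of the directed edge. -/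
def DirEdgedEquiv (D₁ D₂ : DirEdgedEmbedding) : Prop :=
  ∃ h : Torus ≃ₜ Torus,
    h '' D₂.emb.image = D₁.emb.image ∧
    h '' D₂.edgeImage = D₁.edgeImage ∧
    h (D₂.emb.vert D₂.u) = D₁.emb.vert D₁.u ∧
    h (D₂.emb.vert D₂.v) = D₁.emb.vert D₁.v

section
open Set Filter Topology

section Arcs
variable {X Y : Type*} [TopologicalSpace X] [TopologicalSpace Y]

def IsArc (A : Set X) (a b : X) : Prop :=
  ∃ γ : ℝ → X, ContinuousOn γ (Icc 0 1) ∧ InjOn γ (Icc 0 1) ∧ γ 0 = a ∧ γ 1 = b ∧ γ '' Icc 0 1 = A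

def Split (C : Set X) (a b : X) (A B : Set X) : Prop :=
  IsArc A a b ∧ IsArc B a b ∧ A ∩ B = {a, b} ∧ A ∪ B = C

def IsJor (C : Set X) : Prop := ∃ a b A B, Split C a b A B

theorem isArc_of_Icc {γ : ℝ → X} {s t : ℝ} (h : s < t) (hc : ContinuousOn γ (Icc s t))
    (hi : InjOn γ (Icc s t)) : IsArc (γ '' Icc s t) (γ s) (γ t) := by
  have hm : (fun x : ℝ => (t - s) * x + s) '' Icc 0 1 = Icc s t := by
    rw [Set.image_affine_Icc' (by linarith)]; simp
  have hmt : MapsTo (fun x : ℝ => (t - s) * x + s) (Icc 0 1) (Icc s t) := by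
    rw [← hm]; exact mapsTo_image _ _
  refine ⟨γ ∘ (fun x => (t - s) * x + s), hc.comp (by fun_prop) hmt, hi.comp ?_ hmt, by simp,
    by simp, by rw [image_comp, hm]⟩
  intro x _ y _ hxy
  have : t - s ≠ 0 := by linarith
  simpa [this] using hxy

theorem IsArc.symm {A : Set X} {a b : X} (h : IsArc A a b) : IsArc A b a := by
  obtain ⟨γ, hc, hi, h0, h1, hA⟩ := h
  have hm : (fun x : ℝ => 1 - x) '' Icc 0 1 = Icc 0 1 := by
    rw [Set.image_const_sub_Icc]; simp
  have hmt : MapsTo (fun x : ℝ => 1 - x) (Icc 0 1) (Icc 0 1) := by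
    conv_rhs => rw [← hm]
    exact mapsTo_image _ _
  refine ⟨γ ∘ (fun x => 1 - x), hc.comp (by fun_prop) hmt, hi.comp ?_ hmt, by simpa,
    by simpa, by rw [image_comp, hm, hA]⟩
  intro x _ y _ hxy; simpa using hxy

theorem IsArc.left_mem {A : Set X} {a b : X} (h : IsArc A a b) : a ∈ A := by
  obtain ⟨γ, hc, hi, rfl, h1, rfl⟩ := h; exact mem_image_of_mem _ (by simp)
theorem IsArc.right_mem {A : Set X} {a b : X} (h : IsArc A a b) : b ∈ A := h.symm.left_mem
theorem IsArc.ne {A : Set X} {a b : X} (h : IsArc A a b) : a ≠ b := by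
  obtain ⟨γ, hc, hi, rfl, rfl, rfl⟩ := h
  intro h; have := hi (by simp) (by simp) h; norm_num at this
theorem IsArc.compact {A : Set X} {a b : X} (h : IsArc A a b) : IsCompact A := by
  obtain ⟨γ, hc, hi, rfl, rfl, rfl⟩ := h; exact isCompact_Icc.image_of_continuousOn hc
theorem IsArc.closed [T2Space X] {A : Set X} {a b : X} (h : IsArc A a b) : IsClosed A :=
  h.compact.isClosed
theorem IsArc.conn {A : Set X} {a b : X} (h : IsArc A a b) : IsPreconnected A := by
  obtain ⟨γ, hc, hi, rfl, rfl, rfl⟩ := h; exact isPreconnected_Icc.image _ hc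

theorem IsArc.image {A : Set X} {a b : X} (h : IsArc A a b) {f : X → Y} (hf : ContinuousOn f A)
    (hi : InjOn f A) : IsArc (f '' A) (f a) (f b) := by
  obtain ⟨γ, hc, hi', rfl, rfl, rfl⟩ := h
  exact ⟨f ∘ γ, hf.comp hc (mapsTo_image _ _), hi.comp hi' (mapsTo_image _ _), rfl, rfl,
    image_comp _ _ _⟩

/-- interior of an arc: image of the open interval -/
theorem IsArc.diff_eq {A : Set X} {a b : X} (h : IsArc A a b) :
    IsPreconnected (A \ {a, b}) ∧ A ⊆ closure (A \ {a, b}) ∧ (A \ {a, b}).Nonempty := by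
  obtain ⟨γ, hc, hi, rfl, rfl, rfl⟩ := h
  have : γ '' Icc 0 1 \ {γ 0, γ 1} = γ '' Ioo 0 1 := by
    rw [← Icc_sdiff_both, hi.image_sdiff_subset (by intro x; aesop), image_pair]
  rw [this]
  refine ⟨isPreconnected_Ioo.image _ (hc.mono Ioo_subset_Icc_self), ?_, ?_⟩
  · have h1 : closure (Ioo (0:ℝ) 1) = Icc 0 1 := closure_Ioo (by norm_num)
    have := (hc.mono (by rw [h1])).image_closure (s := Ioo (0:ℝ) 1)
    rwa [h1] at this
  · exact ⟨γ (1/2), mem_image_of_mem _ (by norm_num)⟩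

theorem IsArc.split {A : Set X} {a b c : X} (h : IsArc A a b) (hc : c ∈ A) (ha : c ≠ a)
    (hb : c ≠ b) : ∃ A1 A2, IsArc A1 a c ∧ IsArc A2 c b ∧ A1 ∪ A2 = A ∧ A1 ∩ A2 = {c} := by
  obtain ⟨γ, hγ, hi, rfl, rfl, rfl⟩ := h
  obtain ⟨t, ht, rfl⟩ := hc
  have h0 : 0 < t := lt_of_le_of_ne ht.1 (by rintro rfl; exact ha rfl)
  have h1 : t < 1 := lt_of_le_of_ne ht.2 (by rintro rfl; exact hb rfl)
  have s1 : Icc 0 t ⊆ Icc 0 1 := Icc_subset_Icc_right h1.le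
  have s2 : Icc t 1 ⊆ Icc 0 1 := Icc_subset_Icc_left h0.le
  refine ⟨_, _, isArc_of_Icc h0 (hγ.mono s1) (hi.mono s1),
    isArc_of_Icc h1 (hγ.mono s2) (hi.mono s2), ?_, ?_⟩
  · rw [← image_union, Icc_union_Icc_eq_Icc h0.le h1.le]
  · rw [← hi.image_inter s1 s2, Icc_inter_Icc_eq_singleton h0.le h1.le, image_singleton]

theorem IsArc.trans {A B : Set X} {a b c : X} (h : IsArc A a b) (h' : IsArc B b c)
    (hAB : A ∩ B ⊆ {b}) : IsArc (A ∪ B) a c := by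
  obtain ⟨γ, hγ, hi, rfl, rfl, rfl⟩ := h
  obtain ⟨δ, hδ, hj, h0, rfl, rfl⟩ := h'
  have hm : (fun x : ℝ => x - 1) '' Icc 1 2 = Icc 0 1 := by
    rw [Set.image_sub_const_Icc]; norm_num
  have hmt : MapsTo (fun x : ℝ => x - 1) (Icc 1 2) (Icc 0 1) := by
    rw [← hm]; exact mapsTo_image _ _
  let η : ℝ → X := fun t => if t ≤ 1 then γ t else δ (t - 1)
  have e1 : EqOn η γ (Icc 0 1) := fun t ht => if_pos ht.2
  have e2 : EqOn η (δ ∘ fun x => x - 1) (Icc 1 2) := fun t ht => by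
    rcases eq_or_lt_of_le ht.1 with rfl | h
    · simp [η, h0]
    · simp [η, h]
  have hu : Icc (0:ℝ) 2 = Icc 0 1 ∪ Icc 1 2 :=
    (Icc_union_Icc_eq_Icc (by norm_num) (by norm_num)).symm
  have c2 : ContinuousOn (δ ∘ fun x => x - 1) (Icc 1 2) := hδ.comp (by fun_prop) hmt
  have i2 : InjOn (δ ∘ fun x => x - 1) (Icc 1 2) :=
    hj.comp (fun x _ y _ hxy => by simpa using hxy) hmt
  have hcont : ContinuousOn η (Icc 0 2) := by
    rw [hu]
    exact (hγ.congr e1).union_of_isClosed (c2.congr e2) isClosed_Icc isClosed_Icc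
  have key : ∀ x ∈ Icc (0:ℝ) 1, ∀ y ∈ Icc (1:ℝ) 2, η x = η y → x = y := by
    intro x hx y hy hxy
    rw [e1 hx, e2 hy] at hxy
    have : γ x ∈ γ '' Icc 0 1 ∩ δ '' Icc 0 1 :=
      ⟨mem_image_of_mem _ hx, hxy ▸ mem_image_of_mem _ (hmt hy)⟩
    have hx1 : γ x = γ 1 := hAB this
    have hx2 := hi hx (by simp) hx1
    have : (fun x : ℝ => x - 1) y = 0 :=
      hj (hmt hy) (by simp) (show δ (y - 1) = δ 0 by rw [h0, ← hx1, hxy]; rfl)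
    simp only at this; linarith
  have hinj : InjOn η (Icc 0 2) := by
    intro x hx y hy hxy
    rw [hu] at hx hy
    rcases hx with hx | hx <;> rcases hy with hy | hy
    · exact hi hx hy (by rwa [e1 hx, e1 hy] at hxy)
    · exact key x hx y hy hxy
    · exact (key y hy x hx hxy.symm).symm
    · exact i2 hx hy (by rwa [e2 hx, e2 hy] at hxy)
  have := isArc_of_Icc (by norm_num) hcont hinj
  rw [e1 (by simp), e2 (by norm_num), hu, image_union, e1.image_eq, e2.image_eq, image_comp,
    hm] at this
  convert this using 1
  norm_num

theorem IsArc.firstHit [T2Space X] {A K : Set X} {a b : X} (h : IsArc A a b) (hK : IsClosed K)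
    (ha : a ∉ K) (hne : (A ∩ K).Nonempty) :
    ∃ c A1, c ∈ K ∧ A1 ⊆ A ∧ IsArc A1 a c ∧ A1 ∩ K = {c} ∧ (b ∈ A1 → c = b) := by
  obtain ⟨γ, hγ, hi, rfl, rfl, rfl⟩ := h
  have hcl : IsClosed (Icc (0:ℝ) 1 ∩ γ ⁻¹' K) := hγ.preimage_isClosed_of_isClosed isClosed_Icc hK
  have hcp : IsCompact (Icc (0:ℝ) 1 ∩ γ ⁻¹' K) := isCompact_Icc.of_isClosed_subset hcl inter_subset_left
  obtain ⟨_, ⟨x, hx, rfl⟩, hxK⟩ := hne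
  obtain ⟨t, ⟨ht, htK⟩, hmin⟩ := hcp.exists_isLeast ⟨x, hx, hxK⟩
  have h0 : 0 < t := lt_of_le_of_ne ht.1 (by rintro rfl; exact ha htK)
  have s1 : Icc 0 t ⊆ Icc 0 1 := Icc_subset_Icc_right ht.2
  refine ⟨γ t, γ '' Icc 0 t, htK, image_mono s1, isArc_of_Icc h0 (hγ.mono s1) (hi.mono s1), ?_, ?_⟩
  · apply Subset.antisymm
    · rintro _ ⟨⟨y, hy, rfl⟩, hyK⟩
      have := hmin ⟨s1 hy, hyK⟩
      rw [mem_singleton_iff, le_antisymm hy.2 this]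
    · rintro _ rfl; exact ⟨mem_image_of_mem _ ⟨h0.le, le_rfl⟩, htK⟩
  · rintro ⟨y, hy, hy1⟩
    have := hi (s1 hy) (by simp) hy1
    subst this
    rw [le_antisymm ht.2 hy.2]

theorem exists_inv [T2Space Y] [Nonempty X] {G : Set X} (hG : IsCompact G) {f : X → Y} (hf : ContinuousOn f G)
    (hi : InjOn f G) : ∃ g : Y → X, ContinuousOn g (f '' G) ∧ LeftInvOn g f G := by
  refine ⟨Function.invFunOn f G, ?_, hi.leftInvOn_invFunOn⟩
  rw [continuousOn_iff_isClosed]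
  intro t ht
  refine ⟨f '' (G ∩ t), ((hG.inter_right ht).image_of_continuousOn (hf.mono inter_subset_left)).isClosed, ?_⟩
  ext y; constructor
  · rintro ⟨hy, x, hx, rfl⟩
    exact ⟨⟨x, ⟨hx, by rwa [mem_preimage, hi.leftInvOn_invFunOn hx] at hy⟩, rfl⟩, x, hx, rfl⟩
  · rintro ⟨⟨x, ⟨hx, hxt⟩, rfl⟩, h⟩
    exact ⟨by rwa [mem_preimage, hi.leftInvOn_invFunOn hx], h⟩

theorem Split.comm {C A B : Set X} {a b : X} (h : Split C a b A B) : Split C a b B A :=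
  ⟨h.2.1, h.1, by rw [inter_comm, h.2.2.1], by rw [union_comm, h.2.2.2]⟩
theorem Split.symm {C A B : Set X} {a b : X} (h : Split C a b A B) : Split C b a A B :=
  ⟨h.1.symm, h.2.1.symm, by rw [h.2.2.1, pair_comm], h.2.2.2⟩
theorem Split.jordan {C A B : Set X} {a b : X} (h : Split C a b A B) : IsJor C := ⟨a, b, A, B, h⟩

theorem Split.refine1 {C A B : Set X} {a b c : X} (h : Split C a b A B) (hc : c ∈ A) (ha : c ≠ a)
    (hb : c ≠ b) : ∃ A1 A2, IsArc A1 a c ∧ IsArc A2 c b ∧ A1 ∪ A2 = A ∧ A1 ∩ A2 = {c} ∧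
      Split C a c A1 (B ∪ A2) ∧ b ∉ A1 ∧ a ∉ A2 := by
  obtain ⟨A1, A2, h1, h2, hu, hi⟩ := h.1.split hc ha hb
  obtain ⟨hA, hB, hAB, rfl⟩ := h
  have hb1 : b ∉ A1 := fun hb1 => hb (by have : b ∈ A1 ∩ A2 := ⟨hb1, h2.right_mem⟩; rw [hi] at this; exact this.symm)
  have ha1 : a ∉ A2 := fun ha1 => ha (by have : a ∈ A1 ∩ A2 := ⟨h1.left_mem, ha1⟩; rw [hi] at this; exact this.symm)
  refine ⟨A1, A2, h1, h2, hu, hi, ⟨h1, hB.trans h2.symm ?_, ?_, ?_⟩, hb1, ha1⟩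
  · rintro x ⟨hx, hx2⟩
    have : x ∈ A ∩ B := ⟨hu ▸ Or.inr hx2, hx⟩
    rw [hAB] at this
    rcases this with rfl | h
    · exact absurd hx2 ha1
    · exact h
  · rw [inter_union_distrib_left, hi]
    apply Subset.antisymm
    · rintro x (⟨hx1, hx⟩ | h)
      · have : x ∈ A ∩ B := ⟨hu ▸ Or.inl hx1, hx⟩
        rw [hAB] at this
        rcases this with rfl | rfl
        · simp
        · exact absurd hx1 hb1
      · exact Or.inr h
    · rintro x (rfl | h)
      · exact Or.inl ⟨h1.left_mem, hB.left_mem⟩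
      · exact Or.inr h
  · rw [← hu]; ext x; simp only [mem_union]; tauto

theorem IsJor.split {C : Set X} (h : IsJor C) {s t : X} (hs : s ∈ C) (ht : t ∈ C)
    (hst : s ≠ t) : ∃ A B, Split C s t A B := by
  have key : ∀ {a b A B}, Split C a b A B → ∀ {c}, c ∈ C → c ≠ a → ∃ A B, Split C a c A B := by
    intro a b A B h c hc hca
    by_cases hcb : c = b
    · subst hcb; exact ⟨A, B, h⟩
    rw [← h.2.2.2] at hc
    rcases hc with hc | hc
    · obtain ⟨A1, A2, -, -, -, -, h, -⟩ := h.refine1 hc hca hcb; exact ⟨_, _, h⟩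
    · obtain ⟨A1, A2, -, -, -, -, h, -⟩ := h.comm.refine1 hc hca hcb; exact ⟨_, _, h⟩
  obtain ⟨a, b, A, B, h⟩ := h
  by_cases hsa : s = a
  · subst hsa; exact key h ht hst.symm
  · obtain ⟨A, B, h⟩ := key h hs hsa
    exact key h.symm ht hst.symm

theorem Split.compact {C A B : Set X} {a b : X} (h : Split C a b A B) : IsCompact C :=
  h.2.2.2 ▸ h.1.compact.union h.2.1.compact
theorem IsJor.compact {C : Set X} (h : IsJor C) : IsCompact C := by
  obtain ⟨a, b, A, B, h⟩ := h; exact h.compact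
theorem IsJor.closed [T2Space X] {C : Set X} (h : IsJor C) : IsClosed C := h.compact.isClosed

theorem Split.image {C A B : Set X} {a b : X} (h : Split C a b A B) {f : X → Y}
    (hf : ContinuousOn f C) (hi : InjOn f C) : Split (f '' C) (f a) (f b) (f '' A) (f '' B) := by
  obtain ⟨hA, hB, hAB, rfl⟩ := h
  refine ⟨hA.image (hf.mono subset_union_left) (hi.mono subset_union_left),
    hB.image (hf.mono subset_union_right) (hi.mono subset_union_right), ?_, (image_union _ _ _).symm⟩
  rw [← hi.image_inter subset_union_left subset_union_right, hAB, image_pair]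
theorem IsJor.image {C : Set X} (h : IsJor C) {f : X → Y}
    (hf : ContinuousOn f C) (hi : InjOn f C) : IsJor (f '' C) := by
  obtain ⟨a, b, A, B, h⟩ := h; exact (h.image hf hi).jordan

end Arcs

theorem isArc_segment {E : Type*} [AddCommGroup E] [Module ℝ E] [TopologicalSpace E]
    [IsTopologicalAddGroup E] [ContinuousSMul ℝ E] {a b : E} (h : a ≠ b) :
    IsArc (segment ℝ a b) a b := by
  refine ⟨fun t => AffineMap.lineMap a b t, ?_, (AffineMap.lineMap_injective ℝ h).injOn, by simp, by simp, (segment_eq_image_lineMap ℝ a b).symm⟩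
  apply Continuous.continuousOn
  exact AffineMap.lineMap_continuous

/-- Around a point of a Jordan curve there is a small arc whose complement is an arc avoiding the point. -/
theorem IsJor.small {X : Type*} [MetricSpace X] {C : Set X} (h : IsJor C) {z : X} (hz : z ∈ C)
    {ε : ℝ} (hε : 0 < ε) : ∃ s t A B, Split C s t A B ∧ z ∈ A ∧ z ∉ B ∧ A ⊆ Metric.ball z ε := by
  -- an initial subarc of an arc starting at z is small
  have key : ∀ {A : Set X} {b : X}, IsArc A z b → ∃ c A1 A2, IsArc A1 z c ∧ IsArc A2 c b ∧
      A1 ∪ A2 = A ∧ A1 ∩ A2 = {c} ∧ A1 ⊆ Metric.ball z ε ∧ b ∉ A1 := by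
    rintro A b ⟨γ, hγ, hi, rfl, rfl, rfl⟩
    have := hγ 0 (by simp)
    rw [Metric.continuousWithinAt_iff] at this
    obtain ⟨δ, hδ, H⟩ := this ε hε
    set t := min (δ / 2) (1 / 2)
    have h0 : 0 < t := by positivity
    have h1 : t < 1 := lt_of_le_of_lt (min_le_right _ _) (by norm_num)
    have htδ : t < δ := lt_of_le_of_lt (min_le_left _ _) (by linarith)
    have s1 : Icc 0 t ⊆ Icc 0 1 := Icc_subset_Icc_right h1.le
    have s2 : Icc t 1 ⊆ Icc 0 1 := Icc_subset_Icc_left h0.le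
    refine ⟨γ t, _, _, isArc_of_Icc h0 (hγ.mono s1) (hi.mono s1),
      isArc_of_Icc h1 (hγ.mono s2) (hi.mono s2), ?_, ?_, ?_, ?_⟩
    · rw [← image_union, Icc_union_Icc_eq_Icc h0.le h1.le]
    · rw [← hi.image_inter s1 s2, Icc_inter_Icc_eq_singleton h0.le h1.le, image_singleton]
    · rintro _ ⟨x, hx, rfl⟩
      refine H (s1 hx) ?_
      rw [Real.dist_eq, sub_zero, abs_of_nonneg hx.1]; linarith [hx.2]
    · rintro ⟨x, hx, hx1⟩
      have := hi (s1 hx) (by simp) hx1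
      linarith [hx.2]
  obtain ⟨a, b, A, B, h0⟩ := h
  obtain ⟨b, hb, hbz⟩ : ∃ b ∈ C, z ≠ b := by
    by_cases h : z = a
    · exact ⟨b, h0.2.2.2 ▸ Or.inl h0.1.right_mem, h ▸ h0.1.ne⟩
    · exact ⟨a, h0.2.2.2 ▸ Or.inl h0.1.left_mem, h⟩
  obtain ⟨A, B, hA, hB, hAB, rfl⟩ := h0.jordan.split hz hb hbz
  obtain ⟨s, A1, A2, a1, a2, ua, ia, sa, na⟩ := key hA
  obtain ⟨t, B1, B2, b1, b2, ub, ib, sb, nb⟩ := key hB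
  have m1 : ∀ x, x ∈ A ↔ x ∈ A1 ∨ x ∈ A2 := fun x => by rw [← ua]; rfl
  have m2 : ∀ x, x ∈ B ↔ x ∈ B1 ∨ x ∈ B2 := fun x => by rw [← ub]; rfl
  have m3 : ∀ x, x ∈ A → x ∈ B → x = z ∨ x = b := fun x h h' => by
    have : x ∈ A ∩ B := ⟨h, h'⟩
    rw [hAB] at this; exact this
  have i1 : ∀ x, x ∈ A1 → x ∈ A2 → x = s := fun x h h' => by
    have : x ∈ A1 ∩ A2 := ⟨h, h'⟩
    rw [ia] at this; exact this
  have i2 : ∀ x, x ∈ B1 → x ∈ B2 → x = t := fun x h h' => by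
    have : x ∈ B1 ∩ B2 := ⟨h, h'⟩
    rw [ib] at this; exact this
  have za : z ∉ A2 := fun h => a1.ne (i1 z a1.left_mem h)
  have zb : z ∉ B2 := fun h => b1.ne (i2 z b1.left_mem h)
  refine ⟨s, t, A1 ∪ B1, A2 ∪ B2, ⟨a1.symm.trans b1 ?_, a2.trans b2.symm ?_, ?_, ?_⟩, Or.inl a1.left_mem, ?_, union_subset sa sb⟩
  · rintro x ⟨h, h'⟩
    rcases m3 x ((m1 x).2 (Or.inl h)) ((m2 x).2 (Or.inl h')) with rfl | rfl
    · rfl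
    · exact absurd h na
  · rintro x ⟨h, h'⟩
    rcases m3 x ((m1 x).2 (Or.inr h)) ((m2 x).2 (Or.inr h')) with rfl | rfl
    · exact absurd h za
    · rfl
  · ext x; constructor
    · rintro ⟨h | h, h' | h'⟩
      · exact Or.inl (i1 x h h')
      · rcases m3 x ((m1 x).2 (Or.inl h)) ((m2 x).2 (Or.inr h')) with rfl | rfl
        · exact absurd h' zb
        · exact absurd h na
      · rcases m3 x ((m1 x).2 (Or.inr h')) ((m2 x).2 (Or.inl h)) with rfl | rfl
        · exact absurd h' za
        · exact absurd h nb
      · exact Or.inr (i2 x h h')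
    · rintro (rfl | rfl)
      · exact ⟨Or.inl a1.right_mem, Or.inl a2.left_mem⟩
      · exact ⟨Or.inr b1.right_mem, Or.inr b2.left_mem⟩
  · ext x; simp only [mem_union, m1, m2]; tauto
  · rintro (h | h); exacts [za h, zb h]
end

section
open Set Filter Topology

section Logs
variable {X : Type*} [TopologicalSpace X]

def HasLog (f : X → ℂ) (K : Set X) : Prop :=
  ∃ g : X → ℂ, ContinuousOn g K ∧ ∀ z ∈ K, Complex.exp (g z) = f z

theorem log_unique {S : Set X} (hS : IsPreconnected S) {g1 g2 : X → ℂ} (h1 : ContinuousOn g1 S)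
    (h2 : ContinuousOn g2 S) (h : ∀ z ∈ S, Complex.exp (g1 z) = Complex.exp (g2 z)) :
    ∃ n : ℤ, ∀ z ∈ S, g1 z = g2 z + n * (2 * Real.pi * Complex.I) := by
  rcases S.eq_empty_or_nonempty with rfl | ⟨z0, hz0⟩
  · exact ⟨0, by simp⟩
  obtain ⟨n, hn⟩ := Complex.exp_eq_exp_iff_exists_int.1 (h z0 hz0)
  refine ⟨n, ?_⟩
  have := (Complex.isCoveringMap_exp.isSeparatedMap).eqOn_of_comp_eqOn
    (Complex.isCoveringMap_exp.isLocalHomeomorph.isLocallyInjective) hS h1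
    (g₂ := fun z => g2 z + n * (2 * Real.pi * Complex.I)) (h2.add continuousOn_const) ?_ hz0 hn
  · exact this
  · intro z hz
    simp only [Function.comp, Subtype.mk.injEq]
    rw [h z hz]
    exact (Complex.exp_eq_exp_iff_exists_int.2 ⟨-n, by push_cast; ring⟩)

theorem HasLog.mono {f : X → ℂ} {K L : Set X} (h : HasLog f K) (hl : L ⊆ K) : HasLog f L := by
  obtain ⟨g, hg, h⟩ := h; exact ⟨g, hg.mono hl, fun z hz => h z (hl hz)⟩
theorem HasLog.congr {f f' : X → ℂ} {K : Set X} (h : HasLog f K) (hl : ∀ z ∈ K, f' z = f z) :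
    HasLog f' K := by
  obtain ⟨g, hg, h⟩ := h; exact ⟨g, hg, fun z hz => by rw [h z hz, hl z hz]⟩
theorem HasLog.mul {f f' : X → ℂ} {K : Set X} (h : HasLog f K) (h' : HasLog f' K) :
    HasLog (fun z => f z * f' z) K := by
  obtain ⟨g, hg, h⟩ := h; obtain ⟨g', hg', h'⟩ := h'
  exact ⟨fun z => g z + g' z, hg.add hg', fun z hz => by rw [Complex.exp_add, h z hz, h' z hz]⟩
theorem HasLog.zpow {f : X → ℂ} {K : Set X} (h : HasLog f K) (n : ℤ) :
    HasLog (fun z => f z ^ n) K := by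
  obtain ⟨g, hg, h⟩ := h
  exact ⟨fun z => n * g z, continuousOn_const.mul hg, fun z hz => by rw [Complex.exp_int_mul, h z hz]⟩
theorem HasLog.inv {f : X → ℂ} {K : Set X} (h : HasLog f K) : HasLog (fun z => (f z)⁻¹) K :=
  (h.zpow (-1)).congr fun z _ => by simp

open Classical in
theorem HasLog.glue {f : X → ℂ} {K L : Set X} (hc : (IsClosed K ∧ IsClosed L) ∨ (IsOpen K ∧ IsOpen L))
    (hKL : IsPreconnected (K ∩ L)) (h : HasLog f K) (h' : HasLog f L) : HasLog f (K ∪ L) := by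
  obtain ⟨g, hg, h⟩ := h; obtain ⟨g', hg', h'⟩ := h'
  obtain ⟨n, hn⟩ := log_unique hKL (hg.mono inter_subset_left) (hg'.mono inter_subset_right)
    (fun z hz => by rw [h z hz.1, h' z hz.2])
  let G : X → ℂ := fun z => if z ∈ K then g z else g' z + n * (2 * Real.pi * Complex.I)
  have e1 : EqOn G g K := fun z hz => if_pos hz
  have e2 : EqOn G (fun z => g' z + n * (2 * Real.pi * Complex.I)) L := fun z hz => by
    by_cases hk : z ∈ K
    · rw [e1 hk]; exact hn z ⟨hk, hz⟩
    · exact if_neg hk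
  have c2 : ContinuousOn (fun z => g' z + n * (2 * Real.pi * Complex.I)) L := hg'.add continuousOn_const
  refine ⟨G, ?_, ?_⟩
  · rcases hc with hc | hc
    · exact (hg.congr e1).union_of_isClosed (c2.congr e2) hc.1 hc.2
    · exact (hg.congr e1).union_of_isOpen (c2.congr e2) hc.1 hc.2
  · rintro z (hz | hz)
    · rw [e1 hz, h z hz]
    · rw [e2 hz, ← h' z hz]; exact Complex.exp_eq_exp_iff_exists_int.2 ⟨n, rfl⟩

theorem hasLog_of_sc [SimplyConnectedSpace X] [LocallyPathConnectedSpace X] {f : X → ℂ}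
    (hf : Continuous f) (h0 : ∀ x, f x ≠ 0) : HasLog f univ := by
  obtain ⟨x0⟩ : Nonempty X := inferInstance
  obtain ⟨F, ⟨-, hF⟩, -⟩ := Complex.isCoveringMapOn_exp.existsUnique_continuousMap_lifts ⟨f, hf⟩
    (a₀ := x0) (e₀ := Complex.log (f x0)) (Complex.exp_log (h0 x0)) h0
  exact ⟨F, F.continuous.continuousOn, fun z _ => congrFun hF z⟩

theorem hasLog_Icc {f : ℝ → ℂ} (hf : ContinuousOn f (Icc 0 1)) (h0 : ∀ x ∈ Icc (0:ℝ) 1, f x ≠ 0) :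
    HasLog f (Icc 0 1) := by
  have hc : Continuous (IccExtend (zero_le_one' ℝ) ((Icc 0 1).domRestrict f)) :=
    (continuousOn_iff_continuous_domRestrict.1 hf).Icc_extend'
  refine ((hasLog_of_sc hc fun x => h0 _ (Subtype.prop _)).mono (subset_univ _)).congr fun z hz => ?_
  rw [IccExtend_of_mem _ _ hz, domRestrict_apply]

theorem HasLog.arc [T2Space X] {A : Set X} {a b : X} (hA : IsArc A a b) {f : X → ℂ}
    (hf : ContinuousOn f A) (h0 : ∀ x ∈ A, f x ≠ 0) : HasLog f A := by
  obtain ⟨γ, hγ, hi, rfl, rfl, rfl⟩ := hA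
  obtain ⟨g, hg, h⟩ := hasLog_Icc (f := f ∘ γ) (hf.comp hγ (mapsTo_image _ _))
    (fun x hx => h0 _ (mem_image_of_mem _ hx))
  obtain ⟨k, hk, hl⟩ := exists_inv isCompact_Icc hγ hi
  refine ⟨g ∘ k, hg.comp hk ?_, ?_⟩
  · rintro _ ⟨x, hx, rfl⟩; rwa [hl hx]
  · rintro _ ⟨x, hx, rfl⟩
    simp only [Function.comp]; rw [hl hx, h x hx]; rfl
end Logs

open Complex in
theorem circle_no_log {p : ℂ} {r : ℝ} (hr : 0 < r) {n : ℤ}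
    (h : HasLog (fun z => (z - p) ^ n) (Metric.sphere p r)) : n = 0 := by
  obtain ⟨g, hg, h⟩ := h
  have hmap : ∀ t : ℝ, circleMap p r t ∈ Metric.sphere p r := fun t => circleMap_mem_sphere p hr.le t
  obtain ⟨m, hm⟩ := log_unique (S := (univ : Set ℝ)) isPreconnected_univ
    (g1 := fun t => g (circleMap p r t)) (g2 := fun t => n * (Complex.log r + t * I))
    (hg.comp (continuous_circleMap p r).continuousOn (fun t _ => hmap t)) (by fun_prop) (by
      intro t _
      rw [h _ (hmap t), Complex.exp_int_mul, Complex.exp_add, Complex.exp_log (by exact_mod_cast hr.ne')]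
      simp [circleMap])
  have e : circleMap p r (2 * Real.pi) = circleMap p r 0 := by simp [circleMap]
  have h1 := hm 0 (mem_univ _)
  have h2 := hm (2 * Real.pi) (mem_univ _)
  simp only [e] at h2
  rw [h1] at h2
  have : (n : ℂ) * (2 * Real.pi * I) = 0 := by push_cast at h2; linear_combination -h2
  have h3 := Real.pi_ne_zero
  simpa [h3] using this

theorem no_ext {p : ℂ} {n : ℤ} {f : ℂ → ℂ} (hf : Continuous f) (h0 : ∀ z, f z ≠ 0) {R : ℝ}
    (hR : ∀ z, R < ‖z - p‖ → f z = (z - p) ^ n) : n = 0 := by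
  refine circle_no_log (p := p) (r := |R| + 1) (by positivity) ?_
  refine ((hasLog_of_sc hf h0).mono (subset_univ _)).congr fun z hz => ?_
  rw [hR z]
  rw [mem_sphere_iff_norm.1 hz]; linarith [le_abs_self R]

abbrev cc (K : Set ℂ) (p : ℂ) : Set ℂ := connectedComponentIn Kᶜ p
abbrev NS (K : Set ℂ) (p q : ℂ) : Prop := q ∈ cc K p

theorem NS.mem {K : Set ℂ} {p q : ℂ} (h : NS K p q) : p ∉ K ∧ q ∉ K := by
  refine ⟨fun hp => ?_, connectedComponentIn_subset _ _ h⟩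
  have : p ∈ Kᶜ := by
    by_contra h'
    rw [NS, cc, connectedComponentIn_eq_empty h'] at h; exact h
  exact this hp
theorem NS.refl {K : Set ℂ} {p : ℂ} (h : p ∉ K) : NS K p p := mem_connectedComponentIn h
theorem NS.cc_eq {K : Set ℂ} {p q : ℂ} (h : NS K p q) : cc K p = cc K q := connectedComponentIn_eq h
theorem NS.symm {K : Set ℂ} {p q : ℂ} (h : NS K p q) : NS K q p := by
  have := NS.refl h.mem.1
  rwa [NS, h.cc_eq] at this
theorem NS.trans {K : Set ℂ} {p q r : ℂ} (h : NS K p q) (h' : NS K q r) : NS K p r := by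
  rwa [NS, h.cc_eq]
theorem NS.of_conn {K S : Set ℂ} {p q : ℂ} (hS : IsPreconnected S) (hK : Disjoint S K) (hp : p ∈ S)
    (hq : q ∈ S) : NS K p q :=
  hS.subset_connectedComponentIn hp hK.subset_compl_right hq
theorem NS.mono {K L : Set ℂ} {p q : ℂ} (h : NS L p q) (hKL : K ⊆ L) : NS K p q :=
  connectedComponentIn_mono p (compl_subset_compl.2 hKL) h

theorem cc_closure {K : Set ℂ} (hK : IsClosed K) (p : ℂ) : closure (cc K p) ⊆ cc K p ∪ K := by
  intro x hx
  by_contra hn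
  simp only [mem_union, not_or] at hn
  have ho : IsOpen (cc K x) := hK.isOpen_compl.connectedComponentIn
  obtain ⟨y, hy1, hy2⟩ := mem_closure_iff.1 hx _ ho (NS.refl hn.2)
  exact hn.1 (NS.trans (show NS K p y from hy2) (NS.symm hy1))

theorem connected_norm_gt {R : ℝ} (hR : 0 < R) : IsPreconnected {z : ℂ | R < ‖z‖} := by
  have : {z : ℂ | R < ‖z‖} = Complex.exp '' {z | Real.log R < z.re} := by
    ext z; constructor
    · intro hz
      have hz0 : z ≠ 0 := by rintro rfl; simp at hz; linarith
      refine ⟨Complex.log z, ?_, Complex.exp_log hz0⟩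
      simpa [Complex.log_re] using Real.log_lt_log hR hz
    · rintro ⟨w, hw, rfl⟩
      simp only [mem_ofPred_eq, Complex.norm_exp] at hw ⊢
      rwa [← Real.log_lt_iff_lt_exp hR]
  rw [this]
  exact (convex_halfSpace_re_gt _).isPreconnected.image _ Complex.continuous_exp.continuousOn

theorem NS.of_unbdd {K : Set ℂ} (hK : IsCompact K) {p q : ℂ} (hp : ¬ Bornology.IsBounded (cc K p))
    (hq : ¬ Bornology.IsBounded (cc K q)) : NS K p q := by
  obtain ⟨R, hR⟩ := hK.isBounded.exists_norm_le
  have key : ∀ x, ¬ Bornology.IsBounded (cc K x) → ∃ y, NS K x y ∧ |R| + 1 < ‖y‖ := by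
    intro x hx
    by_contra h
    push Not at h
    exact hx (isBounded_iff_forall_norm_le.2 ⟨|R| + 1, fun y hy => h y hy⟩)
  obtain ⟨p', h1, h2⟩ := key p hp
  obtain ⟨q', h3, h4⟩ := key q hq
  refine h1.trans (NS.trans ?_ h3.symm)
  refine NS.of_conn (connected_norm_gt (R := |R| + 1) (by positivity)) ?_ h2 h4
  rw [Set.disjoint_left]
  intro x hx hxK
  have := hR x hxK
  simp only [mem_ofPred_eq] at hx
  linarith [le_abs_self R]

theorem NS.hasLog {K : Set ℂ} (hK : IsClosed K) {p q : ℂ} (h : NS K p q) :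
    HasLog (fun z => (z - p) / (z - q)) K := by
  have hsub : cc K p ⊆ Kᶜ := connectedComponentIn_subset _ _
  have hne : ∀ x ∈ cc K p, ∀ z ∈ K, z - x ≠ 0 := fun x hx z hz h => hsub hx (by rwa [← sub_eq_zero.1 h])
  refine IsPreconnected.induction₂ (s := cc K p) isPreconnected_connectedComponentIn
    (fun x y => HasLog (fun z => (z - x) / (z - y)) K) ?_ ?_ ?_ (NS.refl h.mem.1) h
  · intro x hx
    obtain ⟨r, hr, hb⟩ := Metric.isOpen_iff.1 hK.isOpen_compl x (hsub hx)
    refine mem_nhdsWithin_of_mem_nhds (mem_of_superset (Metric.ball_mem_nhds x (half_pos hr)) ?_)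
    intro y hy
    have h1 : ∀ z ∈ K, ‖(y - x) / (z - y)‖ < 1 := by
      intro z hz
      have hzx : r ≤ ‖z - x‖ := by
        by_contra h'
        exact hb (mem_ball_iff_norm.2 (not_le.1 h')) hz
      have hy' : ‖y - x‖ < r / 2 := mem_ball_iff_norm.1 hy
      have : ‖z - x‖ ≤ ‖z - y‖ + ‖y - x‖ := norm_sub_le_norm_sub_add_norm_sub z y x
      rw [norm_div, div_lt_one (by linarith)]; linarith
    have h2 : ∀ z ∈ K, z - y ≠ 0 := by
      intro z hz h0
      have : z = y := sub_eq_zero.1 h0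
      subst this
      refine hb (Metric.ball_subset_ball (by linarith) hy) hz
    have h3 : ∀ z ∈ K, (z - x) / (z - y) = 1 + (y - x) / (z - y) := fun z hz => by
      field_simp [h2 z hz]; ring
    have h4 : ∀ z ∈ K, (z - x) / (z - y) ∈ Complex.slitPlane := fun z hz => by
      rw [h3 z hz]; exact Complex.mem_slitPlane_of_norm_lt_one (h1 z hz)
    refine ⟨fun z => Complex.log ((z - x) / (z - y)), ?_, fun z hz =>
      Complex.exp_log (Complex.slitPlane_ne_zero (h4 z hz))⟩
    exact ContinuousOn.clog (ContinuousOn.div (by fun_prop) (by fun_prop) h2) h4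
  · intro x y z _ hy _ h1 h2
    refine (h1.mul h2).congr fun w hw => ?_
    have := hne y hy w hw
    field_simp
  · intro x y _ _ h1
    exact h1.inv.congr fun w hw => (inv_div _ _).symm

open Classical in
theorem deg_zero {K : Set ℂ} (hK : IsCompact K) {p q : ℂ} (hp : p ∉ K) (hq : ¬ NS K p q)
    (hb : Bornology.IsBounded (cc K p)) {m n : ℤ}
    (h : HasLog (fun z => (z - p) ^ n * (z - q) ^ m) K) (hqK : q ∉ K) : n = 0 := by
  obtain ⟨g, hg, h⟩ := h
  obtain ⟨G, hG⟩ := ContinuousMap.exists_restrict_eq hK.isClosed ⟨_, continuousOn_iff_continuous_domRestrict.1 hg⟩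
  have hGg : ∀ z ∈ K, G z = g z := fun z hz => by
    have := DFunLike.congr_fun hG (⟨z, hz⟩ : K); exact this
  have ho : IsOpen (cc K p) := hK.isClosed.isOpen_compl.connectedComponentIn
  have hpU : p ∈ cc K p := NS.refl hp
  have hne : ∀ z ∈ closure (cc K p), z - q ≠ 0 := fun z hz h0 => by
    rw [sub_eq_zero] at h0; subst h0
    rcases cc_closure hK.isClosed p hz with h | h
    exacts [hq h, hqK h]
  obtain ⟨R, hR⟩ := hb.exists_norm_le
  refine no_ext (p := p) (f := fun z => if z ∈ cc K p then Complex.exp (G z) * (z - q) ^ (-m) else (z - p) ^ n)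
    ?_ ?_ (R := |R| + ‖p‖) ?_
  · rw [← continuousOn_univ]
    refine ContinuousOn.if ?_ ?_ ?_
    · rintro z ⟨-, hz⟩
      have hz' : z ∈ frontier (cc K p) := hz
      rw [ho.frontier_eq] at hz'
      have hzK : z ∈ K := (cc_closure hK.isClosed p hz'.1).resolve_left hz'.2
      rw [hGg z hzK, h z hzK, zpow_neg, mul_inv_cancel_right₀]
      exact zpow_ne_zero _ (hne z hz'.1)
    · rw [univ_inter]
      refine ContinuousOn.mul (by fun_prop) (ContinuousOn.zpow₀ (by fun_prop) _ fun z hz => Or.inl (hne z hz))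
    · rw [univ_inter]
      refine ContinuousOn.zpow₀ (by fun_prop) _ fun z hz => Or.inl fun h0 => ?_
      rw [sub_eq_zero] at h0; subst h0
      have : closure {a | a ∉ cc K z} = (cc K z)ᶜ := ho.isClosed_compl.closure_eq
      rw [this] at hz; exact hz hpU
  · intro z
    split_ifs with hz
    · exact mul_ne_zero (Complex.exp_ne_zero _) (zpow_ne_zero _ (hne z (subset_closure hz)))
    · refine zpow_ne_zero _ fun h0 => hz ?_
      rw [sub_eq_zero] at h0; subst h0; exact hpU
  · intro z hz
    refine if_neg fun hzU => ?_
    have := hR z hzU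
    have := norm_sub_le z p
    linarith [le_abs_self R]

theorem NS.of_hasLog {K : Set ℂ} (hK : IsCompact K) {p q : ℂ} (hp : p ∉ K) (hq : q ∉ K)
    (h : HasLog (fun z => (z - p) / (z - q)) K) : NS K p q := by
  by_contra hn
  by_cases hb : Bornology.IsBounded (cc K p)
  · have := deg_zero hK hp hn hb (n := 1) (m := -1) (h.congr fun z _ => by simp [div_eq_mul_inv]) hq
    omega
  · by_cases hb' : Bornology.IsBounded (cc K q)
    · have := deg_zero hK hq (fun h => hn h.symm) hb' (n := -1) (m := 1) (h.congr fun z _ => by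
        simp [div_eq_mul_inv, mul_comm]) hp
      omega
    · exact hn (NS.of_unbdd hK hb hb')

theorem janiszewski {K L : Set ℂ} (hK : IsCompact K) (hL : IsCompact L) (hKL : IsPreconnected (K ∩ L))
    {p q : ℂ} (h1 : NS K p q) (h2 : NS L p q) : NS (K ∪ L) p q :=
  NS.of_hasLog (hK.union hL) (fun h => h.elim h1.mem.1 h2.mem.1) (fun h => h.elim h1.mem.2 h2.mem.2)
    (HasLog.glue (Or.inl ⟨hK.isClosed, hL.isClosed⟩) hKL (h1.hasLog hK.isClosed) (h2.hasLog hL.isClosed))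

theorem IsArc.ns {A : Set ℂ} {a b p q : ℂ} (hA : IsArc A a b) (hp : p ∉ A) (hq : q ∉ A) : NS A p q := by
  have h1 : ∀ x ∉ A, ∀ z ∈ A, z - x ≠ 0 := fun x hx z hz h => hx (by rwa [← sub_eq_zero.1 h])
  refine NS.of_hasLog hA.compact hp hq (HasLog.arc hA ?_ ?_)
  · exact ContinuousOn.div (by fun_prop) (by fun_prop) (h1 q hq)
  · exact fun z hz => div_ne_zero (h1 p hp z hz) (h1 q hq z hz)

theorem IsArc.compl_conn {A : Set ℂ} {a b : ℂ} (hA : IsArc A a b) : IsPreconnected Aᶜ := by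
  rcases Aᶜ.eq_empty_or_nonempty with h | ⟨p, hp⟩
  · rw [h]; exact isPreconnected_empty
  · have : Aᶜ = cc A p := Subset.antisymm (fun q hq => hA.ns hp hq) (connectedComponentIn_subset _ _)
    rw [this]; exact isPreconnected_connectedComponentIn

theorem IsArc.hasLog_compl {A : Set ℂ} {a b : ℂ} (hA : IsArc A a b) :
    HasLog (fun z => (z - a) / (z - b)) Aᶜ := by
  obtain ⟨γ, hγ, hi, h0, h1, hA⟩ := hA.symm
  have hm : ∀ (t : unitInterval) (z : ↥Aᶜ), (z : ℂ) - γ t ≠ 0 := fun t z h =>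
    z.2 (by rw [sub_eq_zero.1 h, ← hA]; exact mem_image_of_mem _ t.2)
  have hb : ∀ z : ↥Aᶜ, (z : ℂ) - b ≠ 0 := fun z h => z.2 (by
    rw [sub_eq_zero.1 h, ← hA, ← h0]; exact mem_image_of_mem _ (by simp))
  have hγ' : Continuous fun t : unitInterval => γ t := continuousOn_iff_continuous_domRestrict.1 hγ
  let H : C(unitInterval × ↥Aᶜ, {z : ℂ // z ≠ 0}) :=
    ⟨fun x => ⟨((x.2 : ℂ) - γ x.1) / (x.2 - b), div_ne_zero (hm _ _) (hb _)⟩, by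
      refine Continuous.subtype_mk (Continuous.div ?_ (by fun_prop) fun x => hb _) _
      exact (by fun_prop : Continuous fun x : unitInterval × ↥Aᶜ => (x.2 : ℂ)).sub
        (hγ'.comp continuous_fst)⟩
  have hH : ∀ z : ↥Aᶜ, H (0, z) = ⟨Complex.exp ((0 : C(↥Aᶜ, ℂ)) z), Complex.exp_ne_zero _⟩ := by
    intro z; simp only [H, ContinuousMap.coe_mk]
    refine Subtype.ext ?_
    simp [h0, div_self (hb z)]
  have := Complex.isCoveringMap_exp.liftHomotopy_lifts H 0 hH
  set L := Complex.isCoveringMap_exp.liftHomotopy H 0 hH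
  classical
  refine ⟨fun z => if hz : z ∈ Aᶜ then L (1, ⟨z, hz⟩) else 0, ?_, ?_⟩
  · rw [continuousOn_iff_continuous_domRestrict]
    have e : Aᶜ.domRestrict (fun z => if hz : z ∈ Aᶜ then L (1, ⟨z, hz⟩) else 0) = fun z => L (1, z) := by
      ext z; exact dif_pos z.2
    rw [e]; fun_prop
  · intro z hz
    simp only [dif_pos hz]
    have h2 := congrArg Subtype.val (congrFun this (1, ⟨z, hz⟩))
    simpa [H, h1] using h2
end

section
open Set Filter Topology

def ins (C : Set ℂ) : Set ℂ := {z | z ∉ C ∧ Bornology.IsBounded (cc C z)}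
def out (C : Set ℂ) : Set ℂ := {z | z ∉ C ∧ ¬ Bornology.IsBounded (cc C z)}
def disk (C : Set ℂ) : Set ℂ := ins C ∪ C

section basic
variable {C : Set ℂ}
theorem trich (z : ℂ) : z ∈ C ∨ z ∈ ins C ∨ z ∈ out C := by
  by_cases h : z ∈ C
  · exact Or.inl h
  · by_cases h' : Bornology.IsBounded (cc C z)
    exacts [Or.inr (Or.inl ⟨h, h'⟩), Or.inr (Or.inr ⟨h, h'⟩)]
theorem ins_nmem {z : ℂ} (h : z ∈ ins C) : z ∉ C := h.1
theorem out_nmem {z : ℂ} (h : z ∈ out C) : z ∉ C := h.1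
theorem ins_nout {z : ℂ} (h : z ∈ ins C) : z ∉ out C := fun h' => h'.2 h.2
theorem NS.to_ins {x y : ℂ} (h : NS C x y) (hx : x ∈ ins C) : y ∈ ins C :=
  ⟨h.mem.2, h.cc_eq ▸ hx.2⟩
theorem NS.to_out {x y : ℂ} (h : NS C x y) (hx : x ∈ out C) : y ∈ out C :=
  ⟨h.mem.2, h.cc_eq ▸ hx.2⟩
theorem ins_open (hC : IsClosed C) : IsOpen (ins C) := by
  rw [isOpen_iff_forall_mem_open]
  exact fun x hx => ⟨cc C x, fun y hy => NS.to_ins hy hx, hC.isOpen_compl.connectedComponentIn, NS.refl hx.1⟩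
theorem out_open (hC : IsClosed C) : IsOpen (out C) := by
  rw [isOpen_iff_forall_mem_open]
  exact fun x hx => ⟨cc C x, fun y hy => NS.to_out hy hx, hC.isOpen_compl.connectedComponentIn, NS.refl hx.1⟩
theorem closure_ins (hC : IsClosed C) : closure (ins C) ⊆ disk C := by
  intro z hz
  rcases trich (C := C) z with h | h | h
  · exact Or.inr h
  · exact Or.inl h
  · obtain ⟨y, h1, h2⟩ := mem_closure_iff.1 hz _ (out_open hC) h
    exact absurd h1 (ins_nout h2)
theorem closure_out (hC : IsClosed C) : closure (out C) ⊆ out C ∪ C := by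
  intro z hz
  rcases trich (C := C) z with h | h | h
  · exact Or.inr h
  · obtain ⟨y, h1, h2⟩ := mem_closure_iff.1 hz _ (ins_open hC) h
    exact absurd h2 (ins_nout h1)
  · exact Or.inl h
theorem subset_ins {S : Set ℂ} (hS : IsPreconnected S) (hd : Disjoint S C) {x : ℂ} (hx : x ∈ S)
    (hi : x ∈ ins C) : S ⊆ ins C := fun _ hy => (NS.of_conn hS hd hx hy).to_ins hi
theorem subset_out {S : Set ℂ} (hS : IsPreconnected S) (hd : Disjoint S C) {x : ℂ} (hx : x ∈ S)
    (hi : x ∈ out C) : S ⊆ out C := fun _ hy => (NS.of_conn hS hd hx hy).to_out hi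
theorem subset_out_of_unbdd {S : Set ℂ} (hS : IsPreconnected S) (hd : Disjoint S C)
    (hu : ¬ Bornology.IsBounded S) : S ⊆ out C := by
  intro x hx
  refine ⟨Set.disjoint_left.1 hd hx, fun hb => hu (hb.subset ?_)⟩
  exact fun y hy => NS.of_conn hS hd hx hy
theorem NS.of_out (hC : IsCompact C) {x y : ℂ} (hx : x ∈ out C) (hy : y ∈ out C) : NS C x y :=
  NS.of_unbdd hC hx.2 hy.2
theorem not_ns {x y : ℂ} (hx : x ∈ ins C) (hy : y ∈ out C) : ¬ NS C x y := fun h =>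
  ins_nout (h.to_ins hx) hy
theorem norm_gt_unbdd (R : ℝ) : ¬ Bornology.IsBounded {z : ℂ | R < ‖z‖} := by
  intro h
  obtain ⟨M, hM⟩ := h.exists_norm_le
  have := hM ((|R| + |M| + 1 : ℝ) : ℂ) (by
    simp only [mem_ofPred_eq, Complex.norm_real, Real.norm_eq_abs]
    rw [abs_of_nonneg (by positivity)]; linarith [le_abs_self R, abs_nonneg M])
  rw [Complex.norm_real, Real.norm_eq_abs, abs_of_nonneg (by positivity)] at this
  linarith [le_abs_self M, abs_nonneg R]
theorem exists_far (hC : IsCompact C) : ∃ R : ℝ, 0 < R ∧ {z : ℂ | R < ‖z‖} ⊆ out C := by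
  obtain ⟨R, hR⟩ := hC.isBounded.exists_norm_le
  refine ⟨|R| + 1, by positivity, subset_out_of_unbdd (connected_norm_gt (by positivity)) ?_ (norm_gt_unbdd _)⟩
  rw [Set.disjoint_left]
  intro z (hz : |R| + 1 < ‖z‖) hzC
  linarith [hR z hzC, le_abs_self R]
theorem far_mem {R : ℝ} (hR : 0 < R) : ((R + 1 : ℝ) : ℂ) ∈ {z : ℂ | R < ‖z‖} := by
  simp only [mem_ofPred_eq, Complex.norm_real, Real.norm_eq_abs]
  rw [abs_of_nonneg (by positivity)]; linarith
theorem out_nonempty (hC : IsCompact C) : (out C).Nonempty := by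
  obtain ⟨R, h0, hR⟩ := exists_far hC
  exact ⟨_, hR (far_mem h0)⟩
theorem out_conn (hC : IsCompact C) : IsPreconnected (out C) := by
  obtain ⟨x, hx⟩ := out_nonempty hC
  have : out C = cc C x := Subset.antisymm (fun y hy => NS.of_out hC hx hy) (fun y hy => NS.to_out hy hx)
  rw [this]; exact isPreconnected_connectedComponentIn
theorem common_far {C C' C'' : Set ℂ} (h : IsCompact C) (h' : IsCompact C') (h'' : IsCompact C'') :
    ∃ y, y ∈ out C ∧ y ∈ out C' ∧ y ∈ out C'' := by
  obtain ⟨R, hR, h1⟩ := exists_far h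
  obtain ⟨R', hR', h2⟩ := exists_far h'
  obtain ⟨R'', hR'', h3⟩ := exists_far h''
  have := far_mem (R := R + R' + R'') (by positivity)
  simp only [mem_ofPred_eq] at this
  exact ⟨_, h1 (show R < _ by linarith), h2 (show R' < _ by linarith), h3 (show R'' < _ by linarith)⟩
theorem ins_bounded (hC : IsCompact C) : Bornology.IsBounded (ins C) := by
  obtain ⟨R, -, hR⟩ := exists_far hC
  refine isBounded_iff_forall_norm_le.2 ⟨R, fun z hz => ?_⟩
  by_contra h
  exact ins_nout hz (hR (not_le.1 h))
theorem ins_subset_halfplane (u : ℂ) (hu : u ≠ 0) (c : ℝ) (h : C ⊆ {z | (u * z).re ≤ c}) :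
    disk C ⊆ {z | (u * z).re ≤ c} := by
  refine union_subset (fun z hz => ?_) h
  by_contra hn
  refine ins_nout hz (subset_out_of_unbdd (S := {z | c < (u * z).re}) ?_ ?_ ?_ (by rw [mem_ofPred_eq]; exact lt_of_not_ge hn))
  · refine Convex.isPreconnected ?_
    exact (convex_halfSpace_re_gt c).is_linear_preimage (f := fun z => u * z) (IsLinearMap.mk (by intros; ring) (by intros; simp; ring))
  · rw [Set.disjoint_left]; intro z (hz : c < (u * z).re) hC
    have : (u * z).re ≤ c := h hC
    linarith
  · intro hb
    obtain ⟨M, hM⟩ := hb.exists_norm_le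
    have h1 := hM (((|c| + ‖u‖ * |M| + 1 : ℝ) : ℂ) / u) (by
      simp only [mem_ofPred_eq]; rw [mul_div_cancel₀ _ hu, Complex.ofReal_re]
      have : 0 ≤ ‖u‖ * |M| := by positivity
      linarith [le_abs_self c])
    rw [norm_div, Complex.norm_real, Real.norm_eq_abs, abs_of_nonneg (by positivity), div_le_iff₀ (norm_pos_iff.2 hu)] at h1
    have : M * ‖u‖ ≤ ‖u‖ * |M| := by rw [mul_comm]; gcongr; exact le_abs_self M
    linarith [abs_nonneg c]
end basic

section JCT
variable {C A B : Set ℂ} {a b : ℂ}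

theorem Split.ins_nonempty (h : Split C a b A B) : (ins C).Nonempty := by
  by_contra hn
  rw [not_nonempty_iff_eq_empty] at hn
  have hcc : IsPreconnected Cᶜ := by
    have : Cᶜ = out C := by
      ext z; constructor
      · intro hz
        rcases trich (C := C) z with h | h | h
        exacts [absurd h hz, absurd h (by simp [hn]), h]
      · exact fun h => h.1
    rw [this]; exact out_conn h.compact
  obtain ⟨hA, hB, hAB, hC⟩ := h
  have hl : HasLog (fun z => (z - a) / (z - b)) (Aᶜ ∪ Bᶜ) := by
    refine HasLog.glue (Or.inr ⟨hA.closed.isOpen_compl, hB.closed.isOpen_compl⟩) ?_ hA.hasLog_compl hB.hasLog_compl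
    rw [← compl_union, hC]; exact hcc
  rw [← compl_inter, hAB] at hl
  have hab : 0 < ‖a - b‖ := norm_pos_iff.2 (sub_ne_zero.2 hA.ne)
  have hs : Metric.sphere a (‖a - b‖ / 2) ⊆ ({a, b} : Set ℂ)ᶜ := by
    intro z hz hz'
    rw [mem_sphere_iff_norm] at hz
    rcases hz' with rfl | rfl
    · rw [sub_self, norm_zero] at hz; linarith
    · rw [norm_sub_rev] at hz; linarith
  have h2 : HasLog (fun z => z - b) (Metric.sphere a (‖a - b‖ / 2)) := by
    have h4 : ∀ z ∈ Metric.sphere a (‖a - b‖ / 2), (z - b) / (a - b) ∈ Complex.slitPlane := fun z hz => by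
      have : (z - b) / (a - b) = 1 + (z - a) / (a - b) := by
        field_simp [sub_ne_zero.2 hA.ne]; ring
      rw [this]; refine Complex.mem_slitPlane_of_norm_lt_one ?_
      rw [norm_div, mem_sphere_iff_norm.1 hz, div_lt_one hab]; linarith
    refine ⟨fun z => Complex.log ((z - b) / (a - b)) + Complex.log (a - b),
      ((by fun_prop : ContinuousOn (fun z => (z - b) / (a - b)) _).clog h4).add continuousOn_const, fun z hz => ?_⟩
    have h5 : a - b ≠ 0 := sub_ne_zero.2 hA.ne
    rw [Complex.exp_add, Complex.exp_log (Complex.slitPlane_ne_zero (h4 z hz)), Complex.exp_log h5,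
      div_mul_cancel₀ _ h5]
  have := circle_no_log (p := a) (half_pos hab) (n := 1) (((hl.mono hs).mul h2).congr fun z hz => by
    rw [zpow_one, div_mul_cancel₀]
    exact fun h => hs hz (Or.inr (sub_eq_zero.1 h)))
  omega

theorem Split.degree (h : Split C a b A B) {f : ℂ → ℂ} (hf : ContinuousOn f C) (h0 : ∀ z ∈ C, f z ≠ 0) :
    ∃ (m : ℤ) (g g' : ℂ → ℂ), ContinuousOn g A ∧ ContinuousOn g' B ∧ (∀ z ∈ A, Complex.exp (g z) = f z) ∧
      (∀ z ∈ B, Complex.exp (g' z) = f z) ∧ g a = g' a ∧ g b = g' b + m * (2 * Real.pi * Complex.I) := by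
  obtain ⟨hA, hB, hAB, rfl⟩ := h
  obtain ⟨g, hg, e⟩ := HasLog.arc hA (hf.mono subset_union_left) fun x hx => h0 x (Or.inl hx)
  obtain ⟨g', hg', e'⟩ := HasLog.arc hB (hf.mono subset_union_right) fun x hx => h0 x (Or.inr hx)
  obtain ⟨n, hn⟩ := Complex.exp_eq_exp_iff_exists_int.1 ((e a hA.left_mem).trans (e' a hB.left_mem).symm)
  obtain ⟨m, hm⟩ := Complex.exp_eq_exp_iff_exists_int.1 ((e b hA.right_mem).trans (e' b hB.right_mem).symm)
  refine ⟨m - n, g, fun z => g' z + n * (2 * Real.pi * Complex.I), hg, hg'.add continuousOn_const, e, ?_, hn, ?_⟩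
  · intro z hz; rw [← e' z hz]; exact Complex.exp_eq_exp_iff_exists_int.2 ⟨n, rfl⟩
  · rw [hm]; push_cast; ring

open Classical in
theorem Split.glue (h : Split C a b A B) {f g g' : ℂ → ℂ} (hg : ContinuousOn g A) (hg' : ContinuousOn g' B)
    (e : ∀ z ∈ A, Complex.exp (g z) = f z) (e' : ∀ z ∈ B, Complex.exp (g' z) = f z) (ha : g a = g' a)
    (hb : g b = g' b) : HasLog f C := by
  obtain ⟨hA, hB, hAB, rfl⟩ := h
  have e1 : EqOn (fun z => if z ∈ A then g z else g' z) g A := fun z hz => if_pos hz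
  have e2 : EqOn (fun z => if z ∈ A then g z else g' z) g' B := fun z hz => by
    by_cases hz' : z ∈ A
    · have : z ∈ A ∩ B := ⟨hz', hz⟩
      rw [hAB] at this
      rw [e1 hz']
      rcases this with rfl | rfl
      exacts [ha, hb]
    · exact if_neg hz'
  refine ⟨_, (hg.congr e1).union_of_isClosed (hg'.congr e2) hA.closed hB.closed, ?_⟩
  rintro z (hz | hz)
  · exact (congrArg _ (e1 hz)).trans (e z hz)
  · exact (congrArg _ (e2 hz)).trans (e' z hz)

theorem Split.ins_ns (h : Split C a b A B) {p q : ℂ} (hp : p ∈ ins C) (hq : q ∈ ins C) : NS C p q := by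
  by_contra hn
  have hne : ∀ p ∉ C, ∀ z ∈ C, z - p ≠ 0 := fun p hp z hz h => hp (by rwa [← sub_eq_zero.1 h])
  obtain ⟨m, g, g', hg, hg', e, e', ga, gb⟩ := h.degree (f := fun z => z - p) (by fun_prop) (hne p hp.1)
  obtain ⟨n, k, k', hk, hk', d, d', ka, kb⟩ := h.degree (f := fun z => z - q) (by fun_prop) (hne q hq.1)
  have hl : HasLog (fun z => (z - p) ^ n * (z - q) ^ (-m)) C := by
    refine h.glue (g := fun z => n * g z + (-m : ℤ) * k z) (g' := fun z => n * g' z + (-m : ℤ) * k' z)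
      ((continuousOn_const.mul hg).add (continuousOn_const.mul hk))
      ((continuousOn_const.mul hg').add (continuousOn_const.mul hk')) ?_ ?_ (by rw [ga, ka]) ?_
    · intro z hz; rw [Complex.exp_add, Complex.exp_int_mul, Complex.exp_int_mul, e z hz, d z hz]
    · intro z hz; rw [Complex.exp_add, Complex.exp_int_mul, Complex.exp_int_mul, e' z hz, d' z hz]
    · rw [gb, kb]; push_cast; ring
  have hn0 : n = 0 := deg_zero h.compact hp.1 hn hp.2 hl hq.1
  subst hn0
  have hl' : HasLog (fun z => (z - q) ^ (1:ℤ) * (z - p) ^ (0:ℤ)) C := by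
    refine h.glue hk hk' (fun z hz => ?_) (fun z hz => ?_) ka (by simpa using kb)
    · simpa using d z hz
    · simpa using d' z hz
  have := deg_zero h.compact hq.1 (fun h => hn h.symm) hq.2 hl' hp.1
  omega

theorem IsJor.ins_nonempty (h : IsJor C) : (ins C).Nonempty := by
  obtain ⟨_, _, _, _, h⟩ := h; exact h.ins_nonempty
theorem IsJor.ins_ns (h : IsJor C) {p q : ℂ} (hp : p ∈ ins C) (hq : q ∈ ins C) : NS C p q := by
  obtain ⟨_, _, _, _, h⟩ := h; exact h.ins_ns hp hq
theorem IsJor.ins_conn (h : IsJor C) : IsPreconnected (ins C) := by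
  obtain ⟨x, hx⟩ := h.ins_nonempty
  have : ins C = cc C x := Subset.antisymm (fun y hy => h.ins_ns hx hy) (fun y hy => NS.to_ins hy hx)
  rw [this]; exact isPreconnected_connectedComponentIn

theorem IsJor.mem_closure_both (h : IsJor C) {z : ℂ} (hz : z ∈ C) : z ∈ closure (ins C) ∧ z ∈ closure (out C) := by
  have key : ∀ U V : Set ℂ, IsOpen U → U.Nonempty → V.Nonempty → U ⊆ Cᶜ → V ⊆ Cᶜ → Disjoint U V →
      closure U ⊆ U ∪ C → z ∈ closure U := by
    intro U V hU hUn hVn hUC hVC hUV hcl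
    rw [Metric.mem_closure_iff]
    intro ε hε
    obtain ⟨s, t, A, B, hS, hzA, hzB, hAb⟩ := h.small hz hε
    have hCB : Cᶜ ⊆ Bᶜ := compl_subset_compl.2 (hS.2.2.2 ▸ subset_union_right)
    by_contra hcon
    push Not at hcon
    have : closure U ∩ Bᶜ ⊆ U := by
      rintro x ⟨hx, hxB⟩
      refine (hcl hx).resolve_right fun hxC => ?_
      have hxA : x ∈ A := by rw [← hS.2.2.2] at hxC; exact hxC.resolve_right hxB
      obtain ⟨y, hy, hyU⟩ := mem_closure_iff.1 hx _ Metric.isOpen_ball (hAb hxA)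
      have := hcon y hyU
      rw [dist_comm] at this
      exact absurd (Metric.mem_ball.1 hy) (not_lt.2 this)
    obtain ⟨u, hu⟩ := hUn
    obtain ⟨v, hv⟩ := hVn
    have := hS.2.1.compl_conn.subset_of_closure_inter_subset hU ⟨u, hCB (hUC hu), hu⟩ this (hCB (hVC hv))
    exact Set.disjoint_left.1 hUV this hv
  have hd : Disjoint (ins C) (out C) := Set.disjoint_left.2 fun _ h => ins_nout h
  exact ⟨key _ _ (ins_open h.closed) h.ins_nonempty (out_nonempty h.compact) (fun _ h => h.1) (fun _ h => h.1) hd (closure_ins h.closed),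
    key _ _ (out_open h.closed) (out_nonempty h.compact) h.ins_nonempty (fun _ h => h.1) (fun _ h => h.1) hd.symm (closure_out h.closed)⟩

theorem IsJor.disk_eq (h : IsJor C) : disk C = closure (ins C) :=
  Subset.antisymm (union_subset subset_closure fun _ hz => (h.mem_closure_both hz).1) (closure_ins h.closed)
theorem IsJor.disk_compact (h : IsJor C) : IsCompact (disk C) := by
  rw [h.disk_eq]; exact (ins_bounded h.compact).isCompact_closure

theorem Split.ulc (h : IsJor C) {z : ℂ} (hz : z ∈ C) {ε : ℝ} (hε : 0 < ε) : ∃ δ, 0 < δ ∧ δ ≤ ε ∧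
    ∀ x ∈ Metric.ball z δ, ∀ y ∈ Metric.ball z δ, NS C x y →
      ∃ S, IsPreconnected S ∧ IsOpen S ∧ S ⊆ Metric.ball z ε ∧ Disjoint S C ∧ x ∈ S ∧ y ∈ S := by
  obtain ⟨s, t, A, B, hS, hzA, hzB, hAb⟩ := h.small hz hε
  obtain ⟨r, hr, hb⟩ := Metric.isOpen_iff.1 hS.2.1.closed.isOpen_compl z hzB
  refine ⟨min r ε, lt_min hr hε, min_le_right _ _, fun x hx y hy hxy => ?_⟩
  have hcs : C ∩ (B ∪ Metric.sphere z ε) = B := by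
    rw [inter_union_distrib_left, inter_eq_right.2 (hS.2.2.2 ▸ subset_union_right), union_eq_left]
    rintro w ⟨hw, hws⟩
    rw [← hS.2.2.2] at hw
    refine hw.resolve_left fun hwA => ?_
    have := hAb hwA
    rw [Metric.mem_ball, Metric.mem_sphere.1 hws] at this
    exact lt_irrefl _ this
  have hBs : Disjoint (Metric.ball z (min r ε)) (B ∪ Metric.sphere z ε) := by
    rw [Set.disjoint_left]; rintro w hw (hwB | hws)
    · exact hb (Metric.ball_subset_ball (min_le_left _ _) hw) hwB
    · have := Metric.ball_subset_ball (min_le_right _ _) hw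
      rw [Metric.mem_ball, Metric.mem_sphere.1 hws] at this
      exact lt_irrefl _ this
  have hns := janiszewski (p := x) (q := y) h.compact (hS.2.1.compact.union (isCompact_sphere z ε))
    (by rw [hcs]; exact hS.2.1.conn) hxy (NS.of_conn Metric.isPreconnected_ball hBs hx hy)
  have hsub : cc (C ∪ (B ∪ Metric.sphere z ε)) x ⊆ (C ∪ (B ∪ Metric.sphere z ε))ᶜ := connectedComponentIn_subset _ _
  refine ⟨cc (C ∪ (B ∪ Metric.sphere z ε)) x, isPreconnected_connectedComponentIn,
    (h.closed.union (hS.2.1.closed.union Metric.isClosed_sphere)).isOpen_compl.connectedComponentIn, ?_, ?_, NS.refl hns.mem.1, hns⟩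
  · refine isPreconnected_connectedComponentIn.subset_of_closure_inter_subset Metric.isOpen_ball
      ⟨x, NS.refl hns.mem.1, Metric.ball_subset_ball (min_le_right _ _) hx⟩ ?_
    rintro w ⟨hw, hwc⟩
    have h1 := Metric.closure_ball_subset_closedBall hw
    refine lt_of_le_of_ne h1 fun h2 => hsub hwc (Or.inr (Or.inr h2))
  · rw [Set.disjoint_left]; exact fun w hw hwC => hsub hw (Or.inl hwC)

end JCT

section Theta
variable {C A B σ : Set ℂ} {s t : ℂ}

/-- Three arcs with common ends -/
structure Theta (A B σ : Set ℂ) (s t : ℂ) : Prop where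
  a : IsArc A s t
  b : IsArc B s t
  c : IsArc σ s t
  ab : A ∩ B = {s, t}
  ac : A ∩ σ = {s, t}
  bc : B ∩ σ = {s, t}

theorem Theta.rot (h : Theta A B σ s t) : Theta B σ A s t :=
  ⟨h.b, h.c, h.a, h.bc, by rw [inter_comm, h.ab], by rw [inter_comm, h.ac]⟩
theorem Theta.swap (h : Theta A B σ s t) : Theta B A σ s t :=
  ⟨h.b, h.a, h.c, by rw [inter_comm, h.ab], h.bc, h.ac⟩
theorem Theta.split (h : Theta A B σ s t) : Split (A ∪ B) s t A B := ⟨h.a, h.b, h.ab, rfl⟩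

def Crosscut (C σ : Set ℂ) (s t : ℂ) : Prop := IsArc σ s t ∧ s ∈ C ∧ t ∈ C ∧ σ \ {s, t} ⊆ ins C

theorem Crosscut.symm (h : Crosscut C σ s t) : Crosscut C σ t s :=
  ⟨h.1.symm, h.2.2.1, h.2.1, by rw [pair_comm]; exact h.2.2.2⟩

theorem Crosscut.inter (h : Crosscut C σ s t) : C ∩ σ = {s, t} := by
  apply Subset.antisymm
  · rintro x ⟨h1, h2⟩
    by_contra hn
    exact (h.2.2.2 ⟨h2, hn⟩).1 h1
  · rintro x (rfl | rfl)
    exacts [⟨h.2.1, h.1.left_mem⟩, ⟨h.2.2.1, h.1.right_mem⟩]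

theorem Crosscut.theta (h : Split C s t A B) (hσ : Crosscut C σ s t) : Theta A B σ s t := by
  have hi := hσ.inter
  obtain ⟨hA, hB, hAB, rfl⟩ := h
  refine ⟨hA, hB, hσ.1, hAB, ?_, ?_⟩
  · refine Subset.antisymm ((inter_subset_inter_left _ subset_union_left).trans hi.le) ?_
    rintro x (rfl | rfl)
    exacts [⟨hA.left_mem, hσ.1.left_mem⟩, ⟨hA.right_mem, hσ.1.right_mem⟩]
  · refine Subset.antisymm ((inter_subset_inter_left _ subset_union_right).trans hi.le) ?_
    rintro x (rfl | rfl)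
    exacts [⟨hB.left_mem, hσ.1.left_mem⟩, ⟨hB.right_mem, hσ.1.right_mem⟩]

theorem Split.theta_out (h : Split C s t A B) (hσ : Crosscut C σ s t) :
    out C ⊆ out (A ∪ σ) ∧ B \ {s, t} ⊆ out (A ∪ σ) ∧ ins (A ∪ σ) ⊆ ins C ∧ Disjoint (ins (A ∪ σ)) (B ∪ σ) := by
  have th := Crosscut.theta h hσ
  have hj : IsJor (A ∪ σ) := th.swap.rot.split.jordan
  have hAC : A ⊆ C := h.2.2.2 ▸ subset_union_left
  have hBC : B ⊆ C := h.2.2.2 ▸ subset_union_right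
  have h1 : out C ⊆ out (A ∪ σ) := by
    obtain ⟨y, hy, hy', -⟩ := common_far h.compact hj.compact hj.compact
    refine subset_out (out_conn h.compact) ?_ hy hy'
    rw [Set.disjoint_left]; rintro x hx (hxA | hxσ)
    · exact hx.1 (hAC hxA)
    · by_cases hst : x ∈ ({s, t} : Set ℂ)
      · rw [← th.ab] at hst; exact hx.1 (hAC hst.1)
      · exact ins_nout (hσ.2.2.2 ⟨hxσ, hst⟩) hx
  have h2 : B \ {s, t} ⊆ out (A ∪ σ) := by
    rintro x ⟨hx, hst⟩
    refine (closure_out hj.closed (closure_mono h1 (h.jordan.mem_closure_both (hBC hx)).2)).resolve_right ?_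
    rintro (h | h)
    · exact hst (th.ab ▸ ⟨h, hx⟩)
    · exact hst (th.bc ▸ ⟨hx, h⟩)
  have h3 : Disjoint (ins (A ∪ σ)) (B ∪ σ) := by
    rw [Set.disjoint_left]; rintro x hx (hxB | hxσ)
    · by_cases hst : x ∈ ({s, t} : Set ℂ)
      · rw [← th.ab] at hst; exact hx.1 (Or.inl hst.1)
      · exact ins_nout hx (h2 ⟨hxB, hst⟩)
    · exact hx.1 (Or.inr hxσ)
  refine ⟨h1, h2, fun x hx => ?_, h3⟩
  rcases trich (C := C) x with hC | hC | hC
  · rw [← h.2.2.2] at hC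
    rcases hC with hC | hC
    · exact absurd (Or.inl hC) hx.1
    · exact absurd (Or.inl hC) (Set.disjoint_left.1 h3 hx)
  · exact hC
  · exact absurd (h1 hC) (ins_nout hx)

theorem Split.theta_ins (h : Split C s t A B) (hσ : Crosscut C σ s t) :
    Disjoint (ins (A ∪ σ)) (ins (B ∪ σ)) ∧ ∀ x ∈ ins C, x ∈ ins (A ∪ σ) ∨ x ∈ ins (B ∪ σ) ∨ x ∈ σ := by
  have th := Crosscut.theta h hσ
  have hj1 : IsJor (A ∪ σ) := th.swap.rot.split.jordan
  have hj2 : IsJor (B ∪ σ) := th.rot.split.jordan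
  obtain ⟨o1, a1, i1, d1⟩ := h.theta_out hσ
  obtain ⟨o2, a2, i2, d2⟩ := h.comm.theta_out hσ
  constructor
  · rw [Set.disjoint_left]; intro x hx hx'
    have e1 : ins (A ∪ σ) ⊆ ins (B ∪ σ) := subset_ins hj1.ins_conn d1 hx hx'
    obtain ⟨-, -, y, hy⟩ := h.1.diff_eq
    have := closure_mono e1 (hj1.mem_closure_both (Or.inl hy.1)).1
    obtain ⟨w, hw, hw'⟩ := mem_closure_iff.1 this _ (out_open hj2.closed) (a2 hy)
    exact ins_nout hw' hw
  · intro x hx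
    rcases trich (C := A ∪ σ) x with h1 | h1 | h1
    · rcases h1 with h1 | h1
      · exact absurd (h.2.2.2 ▸ Or.inl h1) hx.1
      · exact Or.inr (Or.inr h1)
    · exact Or.inl h1
    rcases trich (C := B ∪ σ) x with h2 | h2 | h2
    · rcases h2 with h1 | h1
      · exact absurd (h.2.2.2 ▸ Or.inr h1) hx.1
      · exact Or.inr (Or.inr h1)
    · exact Or.inr (Or.inl h2)
    exfalso
    obtain ⟨y, hy⟩ := out_nonempty h.compact
    have hi : (A ∪ σ) ∩ (B ∪ σ) = σ := by
      rw [← inter_union_distrib_right, th.ab, union_eq_right]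
      rintro x (rfl | rfl)
      exacts [hσ.1.left_mem, hσ.1.right_mem]
    have := janiszewski hj1.compact hj2.compact (by rw [hi]; exact hσ.1.conn)
      (NS.of_out hj1.compact h1 (o1 hy)) (NS.of_out hj2.compact h2 (o2 hy))
    refine not_ns hx hy (this.mono ?_)
    rw [← h.2.2.2]; exact union_subset_union subset_union_left subset_union_left

theorem Split.theta_disk (h : Split C s t A B) (hσ : Crosscut C σ s t) :
    disk (A ∪ σ) ∪ disk (B ∪ σ) = disk C ∧ disk (A ∪ σ) ∩ disk (B ∪ σ) = σ ∧ disk (A ∪ σ) ∩ B = {s, t} := by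
  have th := Crosscut.theta h hσ
  obtain ⟨o1, a1, i1, d1⟩ := h.theta_out hσ
  obtain ⟨o2, a2, i2, d2⟩ := h.comm.theta_out hσ
  obtain ⟨d, c⟩ := h.theta_ins hσ
  have hst : ∀ x, x ∈ ({s, t} : Set ℂ) → x ∈ A ∧ x ∈ B ∧ x ∈ σ := fun x hx => by
    have h1 := hx; have h2 := hx
    rw [← th.ab] at h1; rw [← th.bc] at h2
    exact ⟨h1.1, h1.2, h2.2⟩
  have hσC : σ ⊆ disk C := fun x hx => by
    by_cases hs : x ∈ ({s, t} : Set ℂ)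
    · exact Or.inr (h.2.2.2 ▸ Or.inl (hst x hs).1)
    · exact Or.inl (hσ.2.2.2 ⟨hx, hs⟩)
  refine ⟨?_, ?_, ?_⟩
  · apply Subset.antisymm
    · rintro x ((hx | hx | hx) | (hx | hx | hx))
      exacts [Or.inl (i1 hx), Or.inr (h.2.2.2 ▸ Or.inl hx), hσC hx, Or.inl (i2 hx), Or.inr (h.2.2.2 ▸ Or.inr hx), hσC hx]
    · rintro x (hx | hx)
      · rcases c x hx with h | h | h
        exacts [Or.inl (Or.inl h), Or.inr (Or.inl h), Or.inl (Or.inr (Or.inr h))]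
      · rw [← h.2.2.2] at hx
        rcases hx with h | h
        exacts [Or.inl (Or.inr (Or.inl h)), Or.inr (Or.inr (Or.inl h))]
  · apply Subset.antisymm
    · rintro x ⟨hx | hx, hx' | hx'⟩
      · exact absurd hx' (Set.disjoint_left.1 d hx)
      · exact absurd hx' (Set.disjoint_left.1 d1 hx)
      · exact absurd hx (Set.disjoint_left.1 d2 hx')
      · rcases hx with hx | hx
        · rcases hx' with hx' | hx'
          · exact (hst x (th.ab ▸ ⟨hx, hx'⟩)).2.2
          · exact hx'
        · exact hx
    · exact fun x hx => ⟨Or.inr (Or.inr hx), Or.inr (Or.inr hx)⟩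
  · apply Subset.antisymm
    · rintro x ⟨hx | hx | hx, hx'⟩
      · exact absurd (Or.inl hx') (Set.disjoint_left.1 d1 hx)
      · exact th.ab ▸ ⟨hx, hx'⟩
      · exact th.bc ▸ ⟨hx', hx⟩
    · exact fun x hx => ⟨Or.inr (Or.inl (hst x hx).1), (hst x hx).2.1⟩

theorem interlace (h : Split C s t A B) (hσ : Crosscut C σ s t) {τ : Set ℂ} {p q : ℂ} (hτ : Crosscut C τ p q)
    (hp : p ∈ A) (hq : q ∈ B) (hpq : ({s, t} : Set ℂ) ∩ {p, q} = ∅) : (σ ∩ τ).Nonempty := by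
  by_contra hn
  rw [not_nonempty_iff_eq_empty] at hn
  have th := Crosscut.theta h hσ
  have key : ∀ {A B p q}, Split C s t A B → Crosscut C τ p q → q ∈ B → q ∉ ({s, t} : Set ℂ) →
      ¬ (τ \ {p, q} ⊆ ins (A ∪ σ)) := by
    intro A B p q h hτ hq hq' hsub
    have hj1 : IsJor (A ∪ σ) := (Crosscut.theta h hσ).swap.rot.split.jordan
    obtain ⟨y, hy, hy'⟩ := mem_closure_iff.1 (closure_mono hsub (hτ.1.diff_eq.2.1 hτ.1.right_mem)) _
      (out_open hj1.closed) ((h.theta_out hσ).2.1 ⟨hq, hq'⟩)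
    exact ins_nout hy' hy
  have hp' : p ∉ ({s, t} : Set ℂ) := fun h' => by
    have : p ∈ ({s, t} : Set ℂ) ∩ {p, q} := ⟨h', by simp⟩
    rw [hpq] at this; exact this
  have hq' : q ∉ ({s, t} : Set ℂ) := fun h' => by
    have : q ∈ ({s, t} : Set ℂ) ∩ {p, q} := ⟨h', by simp⟩
    rw [hpq] at this; exact this
  obtain ⟨hc, -, x, hx⟩ := hτ.1.diff_eq
  have hxC := hτ.2.2.2 hx
  have hd : ∀ A ⊆ C, Disjoint (τ \ {p, q}) (A ∪ σ) := by
    intro A hA; rw [Set.disjoint_left]; rintro y hy (h1 | h1)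
    · exact (hτ.2.2.2 hy).1 (hA h1)
    · have : y ∈ σ ∩ τ := ⟨h1, hy.1⟩
      rw [hn] at this; exact this
  rcases (h.theta_ins hσ).2 x hxC with h1 | h1 | h1
  · exact key h hτ hq hq' (subset_ins hc (hd A (h.2.2.2 ▸ subset_union_left)) hx h1)
  · refine key h.comm hτ.symm hp hp' ?_
    rw [pair_comm]
    exact (subset_ins hc (hd B (h.2.2.2 ▸ subset_union_right)) hx h1)
  · have : x ∈ σ ∩ τ := ⟨h1, hx.1⟩
    rw [hn] at this; exact this

theorem Theta.open_disj (h : Theta A B σ s t) : Disjoint (σ \ {s, t}) (A ∪ B) := by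
  rw [Set.disjoint_left]; rintro x ⟨hx, hst⟩ (h' | h')
  exacts [hst (h.ac ▸ ⟨h', hx⟩), hst (h.bc ▸ ⟨h', hx⟩)]
theorem Theta.dich (h : Theta A B σ s t) : σ \ {s, t} ⊆ ins (A ∪ B) ∨ σ \ {s, t} ⊆ out (A ∪ B) := by
  obtain ⟨hc, -, x, hx⟩ := h.c.diff_eq
  rcases trich (C := A ∪ B) x with h1 | h1 | h1
  · exact absurd h1 (Set.disjoint_left.1 h.open_disj hx)
  · exact Or.inl (subset_ins hc h.open_disj hx h1)
  · exact Or.inr (subset_out hc h.open_disj hx h1)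

theorem Theta.one_inside (h : Theta A B σ s t) :
    A \ {s, t} ⊆ ins (B ∪ σ) ∨ B \ {s, t} ⊆ ins (A ∪ σ) ∨ σ \ {s, t} ⊆ ins (A ∪ B) := by
  by_contra hn
  push Not at hn
  obtain ⟨n1, n2, n3⟩ := hn
  have hA := h.rot.dich.resolve_left n1
  have hB := h.swap.rot.dich.resolve_left n2
  have hσ := h.dich.resolve_left n3
  have key : ∀ {A B σ : Set ℂ}, Theta A B σ s t → A \ {s, t} ⊆ out (B ∪ σ) → σ \ {s, t} ⊆ out (A ∪ B) →
      ins (A ∪ B) ⊆ ins (A ∪ σ) := by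
    intro A B σ h hA hσ
    have jAB : IsJor (A ∪ B) := h.split.jordan
    have jAσ : IsJor (A ∪ σ) := h.swap.rot.split.jordan
    have jBσ : IsJor (B ∪ σ) := h.rot.split.jordan
    have hd : Disjoint (ins (A ∪ B)) (B ∪ σ) := by
      rw [Set.disjoint_left]; rintro x hx (h1 | h1)
      · exact hx.1 (Or.inr h1)
      · by_cases hst : x ∈ ({s, t} : Set ℂ)
        · rw [← h.ab] at hst; exact hx.1 (Or.inl hst.1)
        · exact ins_nout hx (hσ ⟨h1, hst⟩)
    obtain ⟨-, -, x, hx⟩ := h.a.diff_eq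
    obtain ⟨p, hp, hp'⟩ := mem_closure_iff.1 (jAB.mem_closure_both (Or.inl hx.1)).1 _ (out_open jBσ.closed) (hA hx)
    have hs := subset_out jAB.ins_conn hd hp' hp
    intro q hq
    rcases trich (C := A ∪ σ) q with h1 | h1 | h1
    · rcases h1 with h1 | h1
      · exact absurd (Or.inl h1) hq.1
      · exact absurd (Or.inr h1) (Set.disjoint_left.1 hd hq)
    · exact h1
    exfalso
    obtain ⟨y, hy1, hy2, hy3⟩ := common_far jAB.compact jAσ.compact jBσ.compact
    have hi : (B ∪ σ) ∩ (A ∪ σ) = σ := by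
      rw [← inter_union_distrib_right, inter_comm B, h.ab, union_eq_right]
      rintro x (rfl | rfl)
      exacts [h.c.left_mem, h.c.right_mem]
    have := janiszewski jBσ.compact jAσ.compact (by rw [hi]; exact h.c.conn)
      (NS.of_out jBσ.compact (hs hq) hy3) (NS.of_out jAσ.compact h1 hy2)
    refine not_ns hq hy1 (this.mono ?_)
    rintro x (hx | hx)
    exacts [Or.inr (Or.inl hx), Or.inl (Or.inl hx)]
  have e1 := key h hA hσ
  obtain ⟨-, -, x, hx⟩ := h.b.diff_eq
  obtain ⟨y, hy, hy'⟩ := mem_closure_iff.1 (closure_mono e1 (h.split.jordan.mem_closure_both (Or.inr hx.1)).1) _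
    (out_open h.swap.rot.split.jordan.closed) (hB hx)
  exact ins_nout hy' hy
end Theta
end

section
open Set Filter Topology

theorem near_side {C A B σ : Set ℂ} {s t p p0 : ℂ} {δ ε : ℝ} (h : Split C s t A B) (hσ : Crosscut C σ s t)
    (hp : p ∈ C) (hε : Disjoint (Metric.ball p ε) σ) (hδ : 0 < δ)
    (hu : ∀ x ∈ Metric.ball p δ, ∀ y ∈ Metric.ball p δ, NS C x y →
      ∃ S, IsPreconnected S ∧ IsOpen S ∧ S ⊆ Metric.ball p ε ∧ Disjoint S C ∧ x ∈ S ∧ y ∈ S)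
    (hp0 : p0 ∈ Metric.ball p δ) (hi : p0 ∈ ins (A ∪ σ)) : p ∈ A := by
  by_contra hpA
  have hpB : p ∈ B := by rw [← h.2.2.2] at hp; exact hp.resolve_left hpA
  have jB : IsJor (B ∪ σ) := (Crosscut.theta h hσ).rot.split.jordan
  obtain ⟨y, hy, hy'⟩ := mem_closure_iff.1 (jB.mem_closure_both (Or.inl hpB)).1 _ Metric.isOpen_ball
    (Metric.mem_ball_self hδ)
  obtain ⟨S, hS, -, hSb, hSC, h1, h2⟩ := hu p0 hp0 y hy
    (h.ins_ns ((h.theta_out hσ).2.2.1 hi) ((h.comm.theta_out hσ).2.2.1 hy'))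
  have hd : Disjoint S (A ∪ σ) := by
    refine Disjoint.union_right (hSC.mono_right (h.2.2.2 ▸ subset_union_left)) (hε.mono_left hSb)
  exact Set.disjoint_left.1 (h.theta_ins hσ).1 (subset_ins hS hd h1 hi h2) hy'

theorem lemmaZ {C : Set ℂ} (hC : IsJor C) {u : ℂ} (hu : u ≠ 0) {c : ℝ} {p q : ℂ} (hp : p ∈ C) (hq : q ∈ C)
    (hpc : (u * p).re < c) (hqc : c < (u * q).re) :
    ∃ s t σ A B, Split C s t A B ∧ Crosscut C σ s t ∧ p ∈ A ∧ q ∈ B ∧ σ ⊆ {z | (u * z).re = c} := by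
  have hcont : Continuous fun z : ℂ => (u * z).re := by fun_prop
  let ℓ : ℝ → ℂ := fun t => (c + t * Complex.I) / u
  have hℓ : Continuous ℓ := by fun_prop
  have hℓre : ∀ t, (u * ℓ t).re = c := fun t => by simp [ℓ, mul_div_cancel₀ _ hu]
  have hℓsurj : ∀ z : ℂ, (u * z).re = c → ∃ t, ℓ t = z := fun z hz => ⟨(u * z).im, by
    simp only [ℓ]; rw [div_eq_iff hu, ← hz, Complex.re_add_im, mul_comm]⟩
  have hℓinj : Function.Injective ℓ := fun x y hxy => by
    simpa [ℓ, div_left_inj' hu] using hxy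
  -- points near p and q
  have hball : ∀ p, (u * p).re ≠ c → ∃ ε > 0, Disjoint (Metric.ball p ε) {z | (u * z).re = c} := fun p h => by
    obtain ⟨ε, h1, h2⟩ := Metric.isOpen_iff.1 (isClosed_eq hcont continuous_const : IsClosed {z | (u * z).re = c}).isOpen_compl p h
    exact ⟨ε, h1, Set.disjoint_left.2 h2⟩
  obtain ⟨ε1, e1, b1⟩ := hball p hpc.ne
  obtain ⟨ε2, e2, b2⟩ := hball q hqc.ne'
  obtain ⟨δ1, d1, -, u1⟩ := Split.ulc hC hp e1
  obtain ⟨δ2, d2, -, u2⟩ := Split.ulc hC hq e2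
  obtain ⟨p0, ⟨hp0, hp0c⟩, hp0i⟩ := mem_closure_iff.1 (hC.mem_closure_both hp).1 _
    (Metric.isOpen_ball.inter (isOpen_lt hcont continuous_const)) ⟨Metric.mem_ball_self d1, hpc⟩
  obtain ⟨q0, ⟨hq0, hq0c⟩, hq0i⟩ := mem_closure_iff.1 (hC.mem_closure_both hq).1 _
    (Metric.isOpen_ball.inter (isOpen_lt continuous_const hcont)) ⟨Metric.mem_ball_self d2, hqc⟩
  simp only [mem_ofPred_eq] at hp0c hq0c
  have hpl : ∀ t, ℓ t ≠ p0 := fun t h => by have := hℓre t; rw [h] at this; linarith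
  have hql : ∀ t, ℓ t ≠ q0 := fun t h => by have := hℓre t; rw [h] at this; linarith
  set f : ℂ → ℂ := fun z => (z - p0) / (z - q0) with hf
  obtain ⟨g, hg, eg⟩ := (hC.ins_ns hp0i hq0i).hasLog hC.closed
  obtain ⟨G, hG, eG⟩ : HasLog (fun t => f (ℓ t)) univ := by
    refine hasLog_of_sc ?_ ?_
    · exact Continuous.div (by fun_prop) (by fun_prop) fun t => sub_ne_zero.2 (hql t)
    · exact fun t => div_ne_zero (sub_ne_zero.2 (hpl t)) (sub_ne_zero.2 (hql t))
  rw [continuousOn_univ] at hG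
  set T : Set ℝ := ℓ ⁻¹' C with hT
  have hTc : IsClosed T := hC.closed.preimage hℓ
  let k : ℝ → ℂ := fun t => g (ℓ t) - G t
  have hk : ContinuousOn k T := (hg.comp hℓ.continuousOn fun t ht => ht).sub hG.continuousOn
  have hkexp : ∀ t ∈ T, Complex.exp (k t) = 1 := fun t ht => by
    simp only [k]; rw [Complex.exp_sub, eg _ ht, eG t (mem_univ _)]
    exact div_self (div_ne_zero (sub_ne_zero.2 (hpl t)) (sub_ne_zero.2 (hql t)))
  -- local constancy of k
  have hkloc : ∀ t ∈ T, ∃ δ > 0, ∀ x ∈ T, |x - t| < δ → k x = k t := by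
    intro t ht
    obtain ⟨δ, hδ, H⟩ := Metric.continuousWithinAt_iff.1 (hk t ht) 1 one_pos
    refine ⟨δ, hδ, fun x hx hxt => ?_⟩
    have h1 := H hx hxt
    obtain ⟨n, hn⟩ := Complex.exp_eq_exp_iff_exists_int.1 ((hkexp x hx).trans (hkexp t ht).symm)
    rw [dist_eq_norm, hn, add_sub_cancel_left] at h1
    simp only [norm_mul, Complex.norm_intCast, Complex.norm_ofNat, Complex.norm_real, Complex.norm_I, mul_one,
      Real.norm_eq_abs, abs_of_pos Real.pi_pos] at h1
    have : n = 0 := by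
      by_contra h0
      have h2 : (1:ℝ) ≤ |(n:ℝ)| := by exact_mod_cast Int.one_le_abs h0
      nlinarith [Real.pi_gt_three]
    rw [hn, this]; simp
  -- the main claim
  obtain ⟨a, b, hab, ha, hb, hgap, hne⟩ : ∃ a b, a < b ∧ a ∈ T ∧ b ∈ T ∧ (∀ t ∈ Ioo a b, ℓ t ∈ ins C) ∧ k a ≠ k b := by
    by_contra hno
    push Not at hno
    let T' : Set ℝ := ℓ ⁻¹' disk C
    have hT'c : IsClosed T' := hC.disk_compact.isClosed.preimage hℓ
    have hbd : ∃ M : ℝ, ∀ t ∈ T', |t| ≤ M := by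
      obtain ⟨M, hM⟩ := hC.disk_compact.isBounded.exists_norm_le
      refine ⟨M * ‖u‖, fun t ht => ?_⟩
      have h1 := hM _ ht
      rw [norm_div, div_le_iff₀ (norm_pos_iff.2 hu)] at h1
      refine le_trans ?_ h1
      simpa using Complex.abs_im_le_norm ((c : ℂ) + t * Complex.I)
    obtain ⟨M, hM⟩ := hbd
    -- neighbours
    have hleft : ∀ t ∈ T', ∃ a ∈ T, a ≤ t ∧ ∀ x, a < x → x ≤ t → x ∉ T := by
      intro t ht
      have hne : (Icc (-M - 1) t ∩ {x | ℓ x ∉ ins C}).Nonempty := by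
        refine ⟨-M - 1, ⟨le_rfl, ?_⟩, fun h => ?_⟩
        · have := hM t ht; rw [abs_le] at this; linarith [this.1]
        · have := hM (-M-1) (Or.inl h); rw [abs_le] at this; linarith [this.1]
      obtain ⟨y, hy⟩ := hne
      have hcl : IsClosed {x | ℓ x ∉ ins C} := ((ins_open hC.closed).preimage hℓ).isClosed_compl
      obtain ⟨a, ⟨ha, ha'⟩, hmax⟩ := (isCompact_Icc.inter_right hcl).exists_isGreatest ⟨y, hy⟩
      refine ⟨a, ?_, ha.2, fun x h1 h2 hx => ?_⟩
      · rcases eq_or_lt_of_le ha.2 with rfl | hlt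
        · exact ht.resolve_left ha'
        · have : ℓ a ∈ closure (ins C) := by
            have h1 : a ∈ closure (Ioo a t) := by rw [closure_Ioo hlt.ne]; exact ⟨le_rfl, hlt.le⟩
            refine map_mem_closure hℓ h1 fun x hx => ?_
            by_contra hn
            exact absurd (hmax ⟨⟨ha.1.trans hx.1.le, hx.2.le⟩, hn⟩) (not_le.2 hx.1)
          exact (closure_ins hC.closed this).resolve_left ha'
      · exact absurd (hmax ⟨⟨ha.1.trans h1.le, h2⟩, fun h => h.1 hx⟩) (not_le.2 h1)
    choose! α hαT hαle hα using hleft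
    have hαT' : ∀ t ∈ T, α t = t := fun t ht => by
      have ht' : t ∈ T' := Or.inr ht
      refine le_antisymm (hαle t ht') (not_lt.1 fun h => hα t ht' t h le_rfl ht)
    have hinsgap : ∀ t ∈ T', ∀ t', (∀ x ∈ uIcc t t', x ∉ T) → ℓ t' ∈ ins C := by
      intro t ht t' hx
      refine subset_ins (S := ℓ '' uIcc t t') (isPreconnected_uIcc.image _ hℓ.continuousOn) ?_
        (mem_image_of_mem _ left_mem_uIcc) (ht.resolve_right (hx t left_mem_uIcc)) (mem_image_of_mem _ right_mem_uIcc)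
      rw [Set.disjoint_left]; rintro _ ⟨x, hx', rfl⟩ h
      exact hx x hx' h
    have hκ : ∀ t0 ∈ T', ∃ δ > 0, ∀ t ∈ T', |t - t0| < δ → k (α t) = k (α t0) := by
      intro t0 ht0
      by_cases h0 : t0 ∈ T
      · obtain ⟨δ, hδ, H⟩ := hkloc t0 h0
        refine ⟨δ, hδ, fun t ht htd => ?_⟩
        rw [hαT' t0 h0]
        rw [abs_lt] at htd
        rcases le_or_gt t0 t with hle | hlt
        · refine H _ (hαT t ht) ?_
          have h1 : t0 ≤ α t := not_lt.1 fun h => hα t ht t0 h hle h0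
          rw [abs_of_nonneg (by linarith)]; linarith [hαle t ht]
        · by_cases hTt : t ∈ T
          · rw [hαT' t hTt]; exact H t hTt (by rw [abs_lt]; exact htd)
          · obtain ⟨b, ⟨hb, hbT⟩, hmin⟩ := (isCompact_Icc.inter_right hTc : IsCompact (Icc t t0 ∩ T)).exists_isLeast ⟨t0, ⟨hlt.le, le_rfl⟩, h0⟩
            have hbt : t < b := lt_of_le_of_ne hb.1 (by rintro rfl; exact hTt hbT)
            have hat : α t < t := lt_of_le_of_ne (hαle t ht) (fun h => hTt (h ▸ hαT t ht))
            have := hno (α t) b (hat.trans hbt) (hαT t ht) hbT (fun x hx => hinsgap t ht x fun y hy => ?_)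
            · rw [this]; refine H b hbT ?_
              rw [abs_lt]; constructor <;> linarith [hb.1, hb.2]
            · intro hyT
              rcases le_or_gt y t with h | h
              · refine hα t ht y (lt_of_lt_of_le ?_ hy.1) h hyT
                exact lt_min hat hx.1
              · have h3 : y < b := lt_of_le_of_lt hy.2 (max_lt hbt hx.2)
                exact absurd (hmin ⟨⟨h.le, h3.le.trans hb.2⟩, hyT⟩) (not_le.2 h3)
      · obtain ⟨δ, hδ, H⟩ := Metric.isOpen_iff.1 hTc.isOpen_compl t0 h0
        refine ⟨δ, hδ, fun t ht htd => ?_⟩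
        have hnt : ∀ x ∈ uIcc t t0, x ∉ T := fun x hx => H ((convex_ball t0 δ).ordConnected.uIcc_subset htd (Metric.mem_ball_self hδ) hx)
        have : α t = α t0 := by
          refine le_antisymm (not_lt.1 fun h => ?_) (not_lt.1 fun h => ?_)
          · by_cases h1 : α t ≤ t0
            · exact hα t0 ht0 _ h h1 (hαT t ht)
            · exact hnt (α t) ⟨min_le_of_right_le (not_le.1 h1).le, le_max_of_le_left (hαle t ht)⟩ (hαT t ht)
          · by_cases h1 : α t0 ≤ t
            · exact hα t ht _ h h1 (hαT t0 ht0)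
            · exact hnt (α t0) ⟨min_le_of_left_le (not_le.1 h1).le, le_max_of_le_right (hαle t0 ht0)⟩ (hαT t0 ht0)
        rw [this]
    -- glue to a log on C ∪ L
    classical
    let L : Set ℂ := ℓ '' T'
    have hLeq : L = disk C ∩ {z | (u * z).re = c} := by
      ext z; constructor
      · rintro ⟨t, ht, rfl⟩; exact ⟨ht, hℓre t⟩
      · rintro ⟨h1, h2⟩; obtain ⟨t, rfl⟩ := hℓsurj z h2; exact ⟨t, h1, rfl⟩
    have hLc : IsCompact L := by
      rw [hLeq]; exact hC.disk_compact.inter_right (isClosed_eq hcont continuous_const)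
    let h : ℂ → ℂ := fun z => G ((u * z).im) + k (α ((u * z).im))
    have hℓim : ∀ t, (u * ℓ t).im = t := fun t => by simp [ℓ, mul_div_cancel₀ _ hu]
    have him : Continuous fun z : ℂ => (u * z).im := by fun_prop
    have hh : ContinuousOn h L := by
      refine (hG.comp him).continuousOn.add ?_
      rintro _ ⟨t0, ht0, rfl⟩
      obtain ⟨δ, hδ, H⟩ := hκ t0 ht0
      have : ∀ᶠ z in 𝓝[L] (ℓ t0), k (α ((u * z).im)) = k (α ((u * ℓ t0).im)) := by
        have h1 : ∀ᶠ z in 𝓝 (ℓ t0), |(u * z).im - t0| < δ := by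
          refine (isOpen_lt (by fun_prop) continuous_const).mem_nhds ?_
          show |(u * ℓ t0).im - t0| < δ
          rw [hℓim, sub_self, abs_zero]; exact hδ
        filter_upwards [mem_nhdsWithin_of_mem_nhds h1, self_mem_nhdsWithin] with z hz hzL
        obtain ⟨t, ht, rfl⟩ := hzL
        rw [hℓim] at hz ⊢; rw [hℓim]; exact H t ht hz
      exact (continuousWithinAt_const (b := k (α ((u * ℓ t0).im)))).congr_of_eventuallyEq this rfl
    have eh : ∀ z ∈ L, Complex.exp (h z) = f z := by
      rintro _ ⟨t, ht, rfl⟩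
      simp only [h, hℓim]; rw [Complex.exp_add, hkexp _ (hαT t ht), mul_one, eG t (mem_univ _)]
    have hlog : HasLog f (C ∪ L) := by
      let F : ℂ → ℂ := fun z => if z ∈ C then g z else h z
      have f1 : EqOn F g C := fun z hz => if_pos hz
      have f2 : EqOn F h L := fun z hz => by
        by_cases hzC : z ∈ C
        · rw [f1 hzC]; obtain ⟨t, ht, rfl⟩ := hz
          simp only [h, hℓim]; rw [hαT' t hzC]; simp only [k]; ring
        · exact if_neg hzC
      refine ⟨F, (hg.congr f1).union_of_isClosed (hh.congr f2) hC.closed hLc.isClosed, ?_⟩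
      rintro z (hz | hz)
      · rw [f1 hz, eg z hz]
      · rw [f2 hz, eh z hz]
    have hp0n : p0 ∉ C ∪ L := fun h => h.elim hp0i.1 (by rintro ⟨t, -, h⟩; exact hpl t h)
    have hq0n : q0 ∉ C ∪ L := fun h => h.elim hq0i.1 (by rintro ⟨t, -, h⟩; exact hql t h)
    have hns := NS.of_hasLog (hC.compact.union hLc) hp0n hq0n hlog
    have hpre : IsPreconnected (cc (C ∪ L) p0) := isPreconnected_connectedComponentIn
    have hsub : cc (C ∪ L) p0 ⊆ (C ∪ L)ᶜ := connectedComponentIn_subset _ _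
    have hsubi : cc (C ∪ L) p0 ⊆ ins C := subset_ins hpre
      (Set.disjoint_left.2 fun x hx hxC => hsub hx (Or.inl hxC)) (NS.refl hp0n) hp0i
    obtain ⟨z, hz, hzc⟩ := hpre.intermediate_value (NS.refl hp0n) hns hcont.continuousOn ⟨hp0c.le, hq0c.le⟩
    exact hsub hz (Or.inr (hLeq ▸ ⟨Or.inl (hsubi hz), hzc⟩))
  set σ := ℓ '' Icc a b with hσdef
  have hσl : σ ⊆ {z | (u * z).re = c} := by rintro _ ⟨t, -, rfl⟩; exact hℓre t
  have hσ : Crosscut C σ (ℓ a) (ℓ b) := by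
    refine ⟨isArc_of_Icc hab hℓ.continuousOn hℓinj.injOn, ha, hb, ?_⟩
    rintro _ ⟨⟨t, ht, rfl⟩, hn⟩
    refine hgap t ⟨lt_of_le_of_ne ht.1 ?_, lt_of_le_of_ne ht.2 ?_⟩ <;> rintro rfl <;> simp at hn
  obtain ⟨A, B, hS⟩ := hC.split ha hb hσ.1.ne
  have hnσ : ∀ x, (∀ t, ℓ t ≠ x) → x ∉ σ := by rintro x hx ⟨t, -, rfl⟩; exact hx t rfl
  have key : ∀ {A B}, Split C (ℓ a) (ℓ b) A B → ¬ (p0 ∈ ins (A ∪ σ) ∧ q0 ∈ ins (A ∪ σ)) := by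
    rintro A B hS ⟨hP, hQ⟩
    have hj : IsJor (A ∪ σ) := (Crosscut.theta hS hσ).swap.rot.split.jordan
    obtain ⟨g1, hg1, eg1⟩ := (hj.ins_ns hP hQ).hasLog hj.closed
    have hAC : A ⊆ C := hS.2.2.2 ▸ subset_union_left
    obtain ⟨n, hn⟩ := log_unique hS.1.conn (hg1.mono subset_union_left) (hg.mono hAC)
      (fun z hz => by rw [eg1 z (Or.inl hz), eg z (hAC hz)])
    obtain ⟨m, hm⟩ := log_unique (S := Icc a b) isPreconnected_Icc (g1 := fun t => g1 (ℓ t))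
      (hg1.comp hℓ.continuousOn fun t ht => Or.inr (mem_image_of_mem _ ht)) hG.continuousOn
      (fun z hz => by rw [eg1 _ (Or.inr (mem_image_of_mem _ hz)), eG z (mem_univ _)])
    refine hne ?_
    have h1 := hm a (left_mem_Icc.2 hab.le)
    have h2 := hm b (right_mem_Icc.2 hab.le)
    rw [hn _ hS.1.left_mem] at h1
    rw [hn _ hS.1.right_mem] at h2
    simp only [k]; linear_combination h1 - h2
  have fin : ∀ {A B}, Split C (ℓ a) (ℓ b) A B → p0 ∈ ins (A ∪ σ) → q0 ∈ ins (B ∪ σ) →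
      p ∈ A ∧ q ∈ B := fun hS hP hQ =>
    ⟨near_side hS hσ hp (b1.mono_right hσl) d1 u1 hp0 hP,
      near_side hS.comm hσ hq (b2.mono_right hσl) d2 u2 hq0 hQ⟩
  rcases (hS.theta_ins hσ).2 p0 hp0i with h1 | h1 | h1
  · rcases (hS.theta_ins hσ).2 q0 hq0i with h2 | h2 | h2
    · exact absurd ⟨h1, h2⟩ (key hS)
    · exact ⟨_, _, σ, A, B, hS, hσ, (fin hS h1 h2).1, (fin hS h1 h2).2, hσl⟩
    · exact absurd h2 (hnσ _ hql)
  · rcases (hS.theta_ins hσ).2 q0 hq0i with h2 | h2 | h2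
    · exact ⟨_, _, σ, B, A, hS.comm, hσ, (fin hS.comm h1 h2).1, (fin hS.comm h1 h2).2, hσl⟩
    · exact absurd ⟨h1, h2⟩ (key hS.comm)
    · exact absurd h2 (hnσ _ hql)
  · exact absurd h1 (hnσ _ hpl)
end

section
open Set Filter Topology

theorem concatZ {X : Type*} [TopologicalSpace X] {p : ℤ → ℝ → X} (hp : ∀ n, ContinuousOn (p n) (Icc 0 1))
    (h1 : ∀ n, p n 1 = p (n + 1) 0) :
    ∃ f : ℝ → X, Continuous f ∧ ∀ n : ℤ, ∀ t ∈ Icc (0:ℝ) 1, f (n + t) = p n t := by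
  have key : ∀ n : ℤ, ∀ t ∈ Icc (0:ℝ) 1, p ⌊(n:ℝ) + t⌋ (Int.fract ((n:ℝ) + t)) = p n t := by
    intro n t ht
    rcases eq_or_lt_of_le ht.2 with rfl | h
    · have : ⌊(n:ℝ) + 1⌋ = n + 1 := by simp
      have h' : Int.fract ((n:ℝ) + 1) = 0 := by simp
      rw [this, h', h1]
    · have : Int.fract t = t := Int.fract_eq_self.2 ⟨ht.1, h⟩
      have h' : ⌊t⌋ = 0 := Int.floor_eq_zero_iff.2 ⟨ht.1, h⟩
      simp [this, h']
  refine ⟨fun t => p ⌊t⌋ (Int.fract t), ?_, key⟩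
  have lf : LocallyFinite fun n : ℤ => Icc (n:ℝ) (n + 1) := by
    intro x
    refine ⟨Ioo (x - 1) (x + 1), Ioo_mem_nhds (by linarith) (by linarith), ?_⟩
    refine (Set.finite_Icc (⌊x⌋ - 3) (⌊x⌋ + 3)).subset ?_
    rintro n ⟨y, hy, hy'⟩
    have := Int.floor_le x; have := Int.lt_floor_add_one x
    constructor
    · have : (⌊x⌋ : ℝ) - 3 ≤ n := by linarith [hy.1, hy.2, hy'.1, hy'.2]
      exact_mod_cast this
    · have : (n : ℝ) ≤ ⌊x⌋ + 3 := by linarith [hy.1, hy.2, hy'.1, hy'.2]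
      exact_mod_cast this
  refine lf.continuous ?_ (fun n => isClosed_Icc) fun n => ?_
  · refine eq_univ_of_forall fun x => mem_iUnion.2 ⟨⌊x⌋, Int.floor_le x, (Int.lt_floor_add_one x).le⟩
  · have : ContinuousOn (fun t : ℝ => p n (t - n)) (Icc (n:ℝ) (n + 1)) :=
      (hp n).comp (by fun_prop) fun t ht => ⟨by linarith [ht.1], by linarith [ht.2]⟩
    refine this.congr fun t ht => ?_
    have := key n (t - n) ⟨by linarith [ht.1], by linarith [ht.2]⟩
    simpa using this

theorem IsArc.toward {X : Type*} [TopologicalSpace X] [T2Space X] {B K : Set X} {a b y : X} (h : IsArc B a b)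
    (hy : y ∈ B) (hK : IsClosed K) (hyK : y ∉ K) (hne : (B ∩ K).Nonempty) :
    ∃ c C, c ∈ K ∧ C ⊆ B ∧ IsArc C y c ∧ C ∩ K = {c} := by
  by_cases h1 : y = a
  · subst h1; obtain ⟨c, C, h1, h2, h3, h4, -⟩ := h.firstHit hK hyK hne; exact ⟨c, C, h1, h2, h3, h4⟩
  by_cases h2 : y = b
  · subst h2; obtain ⟨c, C, h1, h2, h3, h4, -⟩ := h.symm.firstHit hK hyK hne; exact ⟨c, C, h1, h2, h3, h4⟩
  obtain ⟨A1, A2, ha, hb, hu, -⟩ := h.split hy h1 h2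
  obtain ⟨x, hx, hxK⟩ := hne
  rw [← hu] at hx
  rcases hx with hx | hx
  · obtain ⟨c, C, h1, h2, h3, h4, -⟩ := ha.symm.firstHit hK hyK ⟨x, hx, hxK⟩
    exact ⟨c, C, h1, h2.trans (hu ▸ subset_union_left), h3, h4⟩
  · obtain ⟨c, C, h1, h2, h3, h4, -⟩ := hb.firstHit hK hyK ⟨x, hx, hxK⟩
    exact ⟨c, C, h1, h2.trans (hu ▸ subset_union_right), h3, h4⟩

theorem IsArc.join {X : Type*} [TopologicalSpace X] [T2Space X] {A B : Set X} {a b c : X} (hA : IsArc A a b)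
    (hB : IsArc B b c) (hac : a ≠ c) : ∃ E, IsArc E a c ∧ E ⊆ A ∪ B := by
  by_cases ha : a ∈ B
  · obtain ⟨c', C, h1, h2, h3, h4⟩ := hB.toward ha (isClosed_singleton (x := c)) hac ⟨c, hB.right_mem, rfl⟩
    obtain rfl : c' = c := h1
    exact ⟨C, h3, h2.trans subset_union_right⟩
  · obtain ⟨d, A1, h1, h2, h3, h4, -⟩ := hA.firstHit hB.closed ha ⟨b, hA.right_mem, hB.left_mem⟩
    by_cases hdc : d = c
    · subst hdc; exact ⟨A1, h3, h2.trans subset_union_left⟩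
    obtain ⟨c', C, h5, h6, h7, h8⟩ := hB.toward h1 (isClosed_singleton (x := c)) hdc ⟨c, hB.right_mem, rfl⟩
    obtain rfl : c' = c := h5
    refine ⟨A1 ∪ C, h3.trans h7 ?_, union_subset_union h2 h6⟩
    exact (inter_subset_inter_right _ h6).trans h4.le

theorem arc_of_open {S : Set ℂ} (ho : IsOpen S) (hc : IsPreconnected S) {x y : ℂ} (hx : x ∈ S) (hy : y ∈ S)
    (hxy : x ≠ y) : ∃ A, IsArc A x y ∧ A ⊆ S := by
  have : x = y ∨ ∃ A, IsArc A x y ∧ A ⊆ S := by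
    refine hc.induction₂ (fun x y => x = y ∨ ∃ A, IsArc A x y ∧ A ⊆ S) ?_ ?_ ?_ hx hy
    · intro x hx
      obtain ⟨r, hr, hb⟩ := Metric.isOpen_iff.1 ho x hx
      filter_upwards [mem_nhdsWithin_of_mem_nhds (Metric.ball_mem_nhds x hr)] with y hy
      by_cases h : x = y
      · exact Or.inl h
      · exact Or.inr ⟨_, isArc_segment h, ((convex_ball x r).segment_subset (Metric.mem_ball_self hr) hy).trans hb⟩
    · rintro x y z hx hy hz (rfl | ⟨A, hA, hA'⟩) (rfl | ⟨B, hB, hB'⟩)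
      · exact Or.inl rfl
      · exact Or.inr ⟨B, hB, hB'⟩
      · exact Or.inr ⟨A, hA, hA'⟩
      · by_cases h : x = z
        · exact Or.inl h
        · obtain ⟨E, h1, h2⟩ := hA.join hB h
          exact Or.inr ⟨E, h1, h2.trans (union_subset hA' hB')⟩
    · rintro x y hx hy (rfl | ⟨A, hA, hA'⟩)
      · exact Or.inl rfl
      · exact Or.inr ⟨A, hA.symm, hA'⟩
  exact this.resolve_left hxy

theorem inf_arc {s : ℂ} {C : ℕ → Set ℂ} {y : ℕ → ℂ} {ε : ℕ → ℝ} (hC : ∀ k, IsArc (C k) (y k) (y (k + 1)))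
    (h1 : ∀ k, C k ∩ C (k + 1) ⊆ {y (k + 1)}) (h2 : ∀ k j, k + 2 ≤ j → Disjoint (C k) (C j))
    (hε : Tendsto ε atTop (𝓝 0)) (hb : ∀ k, C k ⊆ Metric.ball s (ε k)) (hs : ∀ k, s ∉ C k) :
    IsArc (⋃ k, C k ∪ {s}) (y 0) s := by
  choose γ hγ hi hγ0 hγ1 hγC using hC
  obtain ⟨f, hf, hfe⟩ := concatZ (p := fun n t => if 0 ≤ n then γ n.toNat t else y 0) (fun n => by
      by_cases h : 0 ≤ n
      · simpa [h] using hγ _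
      · simpa [h] using continuousOn_const) (fun n => by
      by_cases h : 0 ≤ n
      · have h' : 0 ≤ n + 1 := by omega
        have : (n + 1).toNat = n.toNat + 1 := by omega
        simp [h, h', this, hγ0, hγ1]
      · by_cases h' : 0 ≤ n + 1
        · have : n + 1 = 0 := by omega
          simp [h, this, hγ0]
        · simp [h, h'])
  have hfN : ∀ (n : ℕ), ∀ t ∈ Icc (0:ℝ) 1, f (n + t) = γ n t := fun n t ht => by
    have := hfe n t ht; simpa using this
  have dec : ∀ t : ℝ, 0 ≤ t → ∃ n : ℕ, ∃ r ∈ Ico (0:ℝ) 1, t = n + r := fun t ht =>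
    ⟨⌊t⌋₊, t - ⌊t⌋₊, ⟨by linarith [Nat.floor_le ht], by linarith [Nat.lt_floor_add_one t]⟩, by ring⟩
  have mem : ∀ n, ∀ t ∈ Icc (0:ℝ) 1, γ n t ∈ C n := fun n t ht => hγC n ▸ mem_image_of_mem _ ht
  have inj : ∀ n m : ℕ, n ≤ m → ∀ r ∈ Ico (0:ℝ) 1, ∀ r' ∈ Ico (0:ℝ) 1, γ n r = γ m r' → (n:ℝ) + r = m + r' := by
    intro n m hnm r hr r' hr' he
    have hr1 := Ico_subset_Icc_self hr
    have hr2 := Ico_subset_Icc_self hr'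
    rcases hnm.eq_or_lt with rfl | h
    · rw [hi n hr1 hr2 he]
    · exfalso
      rcases (Nat.succ_le_of_lt h).eq_or_lt with rfl | h'
      · have : γ n r = y (n + 1) := h1 n ⟨mem n r hr1, he ▸ mem _ _ hr2⟩
        have := hi n hr1 (right_mem_Icc.2 zero_le_one) (this.trans (hγ1 n).symm)
        exact hr.2.ne this
      · exact Set.disjoint_left.1 (h2 n m h') (mem n r hr1) (he ▸ mem _ _ hr2)
  have finj : InjOn f (Ici 0) := by
    intro t ht t' ht' he
    obtain ⟨n, r, hr, rfl⟩ := dec t ht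
    obtain ⟨m, r', hr', rfl⟩ := dec t' ht'
    rw [hfN _ _ (Ico_subset_Icc_self hr), hfN _ _ (Ico_subset_Icc_self hr')] at he
    rcases le_total n m with h | h
    · exact inj n m h r hr r' hr' he
    · exact (inj m n h r' hr' r hr he.symm).symm
  have fmem : ∀ t, 0 ≤ t → ∃ n : ℕ, (n:ℝ) ≤ t ∧ t < n + 1 ∧ f t ∈ C n := fun t ht => by
    obtain ⟨n, r, hr, rfl⟩ := dec t ht
    exact ⟨n, by linarith [hr.1], by linarith [hr.2], by
      rw [hfN _ _ (Ico_subset_Icc_self hr)]; exact mem _ _ (Ico_subset_Icc_self hr)⟩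
  have flim : Tendsto f atTop (𝓝 s) := by
    rw [Metric.tendsto_atTop]
    intro e he
    obtain ⟨N, hN⟩ := (hε.eventually (gt_mem_nhds he)).exists_forall_of_atTop
    refine ⟨N, fun t ht => ?_⟩
    obtain ⟨n, -, hn2, hn⟩ := fmem t ((Nat.cast_nonneg N).trans ht)
    have : N ≤ n := by have : (N:ℝ) < n + 1 := by linarith
                       exact Nat.lt_succ_iff.1 (by exact_mod_cast this)
    exact (Metric.mem_ball.1 (hb n hn)).trans (hN n this)
  let g : ℝ → ℂ := fun x => if x < 1 then f (x / (1 - x)) else s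
  have g1 : ∀ x, x < 1 → g x = f (x / (1 - x)) := fun x hx => if_pos hx
  have g2 : g 1 = s := if_neg (lt_irrefl _)
  have fs : ∀ t, 0 ≤ t → f t ≠ s := fun t ht h => by
    obtain ⟨n, -, -, hn⟩ := fmem t ht; exact hs n (h ▸ hn)
  refine ⟨g, ?_, ?_, ?_, g2, ?_⟩
  · intro x hx
    rcases hx.2.eq_or_lt with rfl | h
    · have : Tendsto (fun x : ℝ => x / (1 - x)) (𝓝[<] 1) atTop := by
        refine Tendsto.pos_mul_atTop (C := 1) one_pos (tendsto_id.mono_left nhdsWithin_le_nhds) ?_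
        refine tendsto_inv_nhdsGT_zero.comp (tendsto_nhdsWithin_iff.2 ⟨?_, ?_⟩)
        · have : Tendsto (fun x : ℝ => 1 - x) (𝓝 1) (𝓝 (1 - 1)) := by
            exact (continuous_const.sub continuous_id).tendsto 1
          simpa using this.mono_left nhdsWithin_le_nhds
        · filter_upwards [self_mem_nhdsWithin] with x hx
          exact sub_pos.2 (show x < 1 from hx)
      have h3 : Tendsto g (𝓝[<] 1) (𝓝 s) := (flim.comp this).congr' (by
        filter_upwards [self_mem_nhdsWithin] with x hx
        exact (g1 x hx).symm)
      have h4 : ContinuousWithinAt g (Iio 1) 1 := by rw [ContinuousWithinAt, g2]; exact h3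
      have h5 : ContinuousWithinAt g (Iic 1) 1 := by
        rw [← Iio_insert]; exact continuousWithinAt_insert_self.2 h4
      exact h5.mono Icc_subset_Iic_self
    · have : ContinuousAt (fun x => f (x / (1 - x))) x :=
        ContinuousAt.comp (f := fun x : ℝ => x / (1 - x)) hf.continuousAt
          (continuousAt_id.div (continuousAt_const.sub continuousAt_id) (by simpa using (sub_pos.2 h).ne'))
      refine (this.congr ?_).continuousWithinAt
      filter_upwards [Iio_mem_nhds h] with z hz
      exact (g1 z hz).symm
  · intro x hx x' hx' he
    rcases hx.2.eq_or_lt with rfl | h <;> rcases hx'.2.eq_or_lt with rfl | h'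
    · rfl
    · rw [g2, g1 _ h'] at he
      exact absurd he.symm (fs _ (div_nonneg hx'.1 (sub_pos.2 h').le))
    · rw [g2, g1 _ h] at he
      exact absurd he (fs _ (div_nonneg hx.1 (sub_pos.2 h).le))
    · rw [g1 _ h, g1 _ h'] at he
      have := finj (div_nonneg hx.1 (sub_pos.2 h).le) (div_nonneg hx'.1 (sub_pos.2 h').le) he
      rw [div_eq_div_iff (sub_pos.2 h).ne' (sub_pos.2 h').ne'] at this
      linarith
  · rw [g1 0 one_pos]
    have := hfN 0 0 (by simp)
    simpa [hγ0] using this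
  · apply Subset.antisymm
    · rintro _ ⟨x, hx, rfl⟩
      rcases hx.2.eq_or_lt with rfl | h
      · exact mem_iUnion.2 ⟨0, Or.inr g2⟩
      · rw [g1 _ h]; obtain ⟨n, -, -, hn⟩ := fmem _ (div_nonneg hx.1 (sub_pos.2 h).le)
        exact mem_iUnion.2 ⟨n, Or.inl hn⟩
    · refine iUnion_subset fun n => union_subset ?_ (singleton_subset_iff.2 ⟨1, by simp, g2⟩)
      rw [← hγC n]
      rintro _ ⟨r, hr, rfl⟩
      have h0 : (0:ℝ) ≤ n + r := add_nonneg n.cast_nonneg hr.1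
      refine ⟨(n + r) / (1 + (n + r)), ⟨by positivity, ?_⟩, ?_⟩
      · rw [div_le_one (by linarith)]; linarith
      · rw [g1 _ (by rw [div_lt_one (by linarith)]; linarith), ← hfN n r hr]
        congr 1; field_simp; ring

theorem IsJor.access {C : Set ℂ} (h : IsJor C) {s : ℂ} (hs : s ∈ C) :
    ∃ p A, p ∈ ins C ∧ IsArc A p s ∧ A \ {s} ⊆ ins C := by
  choose! δ hδ0 hδ1 hδ using fun n : ℕ => Split.ulc h hs (ε := (1/2:ℝ)^n) (by positivity)
  have hcl := (h.mem_closure_both hs).1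
  have hP : ∀ n : ℕ, ∀ y : ℂ, y ≠ s → ∃ x, x ∈ ins C ∧ dist x s < δ n ∧ dist x s < δ (n+1) ∧ x ≠ y := fun n y hy => by
    have := dist_pos.2 hy
    obtain ⟨x, hx, hd⟩ := Metric.mem_closure_iff.1 hcl (min (min (δ n) (δ (n+1))) (dist y s)) (by
      have := hδ0 n; have := hδ0 (n+1); positivity)
    rw [dist_comm] at hd
    simp only [lt_min_iff] at hd
    exact ⟨x, hx, hd.1.1, hd.1.2, by rintro rfl; exact lt_irrefl _ hd.2⟩
  choose! P hP1 hP2 hP3 hP4 using hP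
  let x : ℕ → ℂ := fun n => Nat.rec (P 0 (s + 1)) (fun n y => P (n + 1) y) n
  have hx : ∀ n, x n ∈ ins C ∧ dist (x n) s < δ n ∧ dist (x n) s < δ (n+1) := by
    intro n
    induction n with
    | zero => exact ⟨hP1 _ _ (by simp), hP2 _ _ (by simp), hP3 _ _ (by simp)⟩
    | succ n ih => have : x n ≠ s := fun e => ih.1.1 (e ▸ hs)
                   exact ⟨hP1 _ _ this, hP2 _ _ this, hP3 _ _ this⟩
  have hne : ∀ n, x n ≠ x (n+1) := fun n =>
    (hP4 (n+1) (x n) (fun e => (hx n).1.1 (e ▸ hs))).symm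
  have hB : ∀ n, ∃ B, IsArc B (x n) (x (n+1)) ∧ B ⊆ ins C ∧ B ⊆ Metric.ball s ((1/2:ℝ)^(n+1)) := fun n => by
    obtain ⟨S, h1, h2, h3, h4, h5, h6⟩ := hδ (n+1) (x n) (hx n).2.2 (x (n+1)) (hx (n+1)).2.1
      (h.ins_ns (hx n).1 (hx (n+1)).1)
    obtain ⟨B, hB, hBS⟩ := arc_of_open h2 h1 h5 h6 (hne n)
    exact ⟨B, hB, hBS.trans (subset_ins h1 h4 h5 (hx n).1), hBS.trans h3⟩
  choose B hB hBi hBb using hB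
  have hsB : ∀ n, s ∉ B n := fun n hn => (hBi n hn).1 hs
  have hlast : ∀ n, ∃ m, n < m ∧ (B n ∩ B m).Nonempty ∧ ∀ j, m < j → Disjoint (B n) (B j) := fun n => by
    classical
    obtain ⟨r, hr, hrb⟩ := Metric.isOpen_iff.1 (hB n).closed.isOpen_compl s (hsB n)
    obtain ⟨N, hN⟩ := exists_pow_lt_of_lt_one hr (by norm_num : (1/2:ℝ) < 1)
    have hfar : ∀ j, N ≤ j → Disjoint (B n) (B j) := fun j hj => by
      refine Set.disjoint_left.2 fun z hz hz' => hrb (Metric.ball_subset_ball ?_ (hBb j hz')) hz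
      exact (pow_le_pow_of_le_one (by norm_num) (by norm_num) (by omega)).trans hN.le
    have h1 : (B n ∩ B (n+1)).Nonempty := ⟨x (n+1), (hB n).right_mem, (hB (n+1)).left_mem⟩
    have hnN : n + 1 ≤ N := by
      by_contra hc
      exact Set.disjoint_iff_inter_eq_empty.1 (hfar (n+1) (by omega)) ▸ h1 |>.ne_empty rfl
    have hsp := Nat.findGreatest_spec (P := fun m => (B n ∩ B m).Nonempty) hnN h1
    refine ⟨Nat.findGreatest (fun m => (B n ∩ B m).Nonempty) N, Nat.le_findGreatest hnN h1, hsp, fun j hj => ?_⟩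
    rcases le_or_gt N j with h | h
    · exact hfar j h
    · rw [Set.disjoint_iff_inter_eq_empty, ← Set.not_nonempty_iff_eq_empty]
      exact Nat.findGreatest_is_greatest hj h.le
  choose nx hnx1 hnx2 hnx3 using hlast
  obtain ⟨n0, y0, h0, h0'⟩ : ∃ n0 y0, y0 ∈ B n0 ∧ y0 ∉ B (nx n0) := by
    by_cases h0 : x 0 ∈ B (nx 0)
    · exact ⟨_, _, h0, Set.disjoint_left.1 (hnx3 0 _ (hnx1 _)) (hB 0).left_mem⟩
    · exact ⟨_, _, (hB 0).left_mem, h0⟩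
  let N : ℕ → ℕ := fun k => nx^[k] n0
  have hN : ∀ k, N (k+1) = nx (N k) := fun k => Function.iterate_succ_apply' _ _ _
  have hNm : StrictMono N := strictMono_nat_of_lt_succ fun k => hN k ▸ hnx1 _
  have step : ∀ n, ∀ y, y ∈ B n → y ∉ B (nx n) → ∃ c E, c ∈ B (nx n) ∧ E ⊆ B n ∧ IsArc E y c ∧ E ∩ B (nx n) = {c} :=
    fun n y hy hy' => (hB n).toward hy (hB _).closed hy' (hnx2 n)
  choose! c E hc hE hEa hEi using step
  let y : ℕ → ℂ := fun k => Nat.rec y0 (fun k z => c (N k) z) k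
  have hdis : ∀ k j, k + 2 ≤ j → Disjoint (B (N k)) (B (N j)) := fun k j hj =>
    hnx3 _ _ (hN k ▸ hNm (by omega))
  have hy : ∀ k, y k ∈ B (N k) ∧ y k ∉ B (nx (N k)) := by
    intro k
    induction k with
    | zero => exact ⟨h0, h0'⟩
    | succ k ih =>
      refine ⟨hN k ▸ hc _ _ ih.1 ih.2, fun hh => ?_⟩
      have h1 : y (k+1) ∈ B (N k) :=
        hE _ _ ih.1 ih.2 (hEa _ _ ih.1 ih.2).right_mem
      rw [← hN (k+1)] at hh
      exact Set.disjoint_left.1 (hdis k (k+2) le_rfl) h1 hh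
  refine ⟨y 0, _, hBi _ (hy 0).1, inf_arc (C := fun k => E (N k) (y k)) (y := y) (ε := fun k => (1/2:ℝ)^(k+1))
    (fun k => hEa _ _ (hy k).1 (hy k).2) (fun k => ?_) (fun k j hj => ?_) ?_ (fun k => ?_) (fun k => ?_), ?_⟩
  · have := hEi _ _ (hy k).1 (hy k).2
    rw [← hN] at this
    exact (inter_subset_inter_right _ (hE _ _ (hy (k+1)).1 (hy (k+1)).2)).trans this.le
  · exact (hdis k j hj).mono (hE _ _ (hy k).1 (hy k).2) (hE _ _ (hy j).1 (hy j).2)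
  · exact (tendsto_pow_atTop_nhds_zero_of_lt_one (by norm_num) (by norm_num)).comp (tendsto_add_atTop_nat 1)
  · refine (hE _ _ (hy k).1 (hy k).2).trans ((hBb _).trans (Metric.ball_subset_ball ?_))
    exact pow_le_pow_of_le_one (by norm_num) (by norm_num) (Nat.succ_le_succ (hNm.le_apply))
  · exact fun hh => hsB _ (hE _ _ (hy k).1 (hy k).2 hh)
  · rintro z ⟨hz, hzs⟩
    obtain ⟨k, hk⟩ := mem_iUnion.1 hz
    exact hBi _ (hE _ _ (hy k).1 (hy k).2 (hk.resolve_right hzs))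

theorem IsJor.crosscut {C : Set ℂ} (h : IsJor C) {s t : ℂ} (hs : s ∈ C) (ht : t ∈ C) (hst : s ≠ t) :
    ∃ σ, Crosscut C σ s t := by
  obtain ⟨p, A, hp, hA, hA'⟩ := h.access hs
  obtain ⟨q, B, hq, hB, hB'⟩ := h.access ht
  have : ∃ E, IsArc E s q ∧ E \ {s} ⊆ ins C := by
    by_cases hpq : p = q
    · subst hpq; exact ⟨A, hA.symm, hA'⟩
    · obtain ⟨D, hD, hD'⟩ := arc_of_open (ins_open h.closed) h.ins_conn hp hq hpq
      obtain ⟨E, hE, hE'⟩ := hA.symm.join hD (by rintro rfl; exact hq.1 hs)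
      exact ⟨E, hE, fun z hz => (hE' hz.1).elim (fun h => hA' ⟨h, hz.2⟩) (fun h => hD' h)⟩
  obtain ⟨E, hE, hE'⟩ := this
  obtain ⟨σ, h1, h2⟩ := hE.join hB hst
  refine ⟨σ, h1, hs, ht, fun z hz => ?_⟩
  have hz2 : z ≠ s ∧ z ≠ t := by simpa using hz.2
  exact (h2 hz.1).elim (fun h => hE' ⟨h, hz2.1⟩) (fun h => hB' ⟨h, hz2.2⟩)
end

section
open Set Filter Topology

def pr (b : Bool) (x : ℂ × ℂ) : ℂ := if b then x.1 else x.2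
theorem pr_cont (b : Bool) : Continuous (pr b) := by
  cases b
  · exact continuous_snd
  · exact continuous_fst
theorem pr_ext {x y : ℂ × ℂ} (h : ∀ b, pr b x = pr b y) : x = y := Prod.ext (h true) (h false)

def pd (b : Bool) (G : Set (ℂ × ℂ)) : Set ℂ := disk (pr b '' G)
def Good (G : Set (ℂ × ℂ)) : Prop := IsJor G ∧ ∀ b, InjOn (pr b) G

theorem Good.jor {G : Set (ℂ × ℂ)} (h : Good G) (b : Bool) : IsJor (pr b '' G) :=
  h.1.image (pr_cont b).continuousOn (h.2 b)

structure Cut (G : Set (ℂ × ℂ)) (s t : ℂ × ℂ) (A B S : Set (ℂ × ℂ)) : Prop where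
  sp : Split G s t A B
  arc : IsArc S s t
  inj : ∀ b, InjOn (pr b) S
  cr : ∀ b, Crosscut (pr b '' G) (pr b '' S) (pr b s) (pr b t)

section
variable {G A B S : Set (ℂ × ℂ)} {s t : ℂ × ℂ}
theorem Cut.comm (h : Cut G s t A B S) : Cut G s t B A S := ⟨h.sp.comm, h.arc, h.inj, h.cr⟩
theorem Cut.image (h : Cut G s t A B S) (hG : Good G) (b : Bool) :
    Split (pr b '' G) (pr b s) (pr b t) (pr b '' A) (pr b '' B) :=
  h.sp.image (pr_cont b).continuousOn (hG.2 b)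
theorem Cut.good (h : Cut G s t A B S) (hG : Good G) : Good (A ∪ S) := by
  have hAG : A ⊆ G := h.sp.2.2.2 ▸ subset_union_left
  have key : ∀ b, ∀ x ∈ A, ∀ y ∈ S, pr b x = pr b y → x = y ∧ (x = s ∨ x = t) := by
    intro b x hx y hy e
    have : pr b x ∈ pr b '' G ∩ pr b '' S := ⟨mem_image_of_mem _ (hAG hx), e ▸ mem_image_of_mem _ hy⟩
    rw [(h.cr b).inter] at this
    rcases this with h1 | h1
    · have h2 := hG.2 b (hAG hx) (hAG h.sp.1.left_mem) h1
      exact ⟨h2.trans (h.inj b hy h.arc.left_mem (e.symm.trans h1)).symm, Or.inl h2⟩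
    · have h2 := hG.2 b (hAG hx) (hAG h.sp.1.right_mem) h1
      exact ⟨h2.trans (h.inj b hy h.arc.right_mem (e.symm.trans h1)).symm, Or.inr h2⟩
  refine ⟨⟨s, t, A, S, h.sp.1, h.arc, ?_, rfl⟩, fun b => ?_⟩
  · apply Subset.antisymm
    · rintro x ⟨h1, h2⟩; exact (key true x h1 x h2 rfl).2
    · rintro x (rfl | rfl)
      exacts [⟨h.sp.1.left_mem, h.arc.left_mem⟩, ⟨h.sp.1.right_mem, h.arc.right_mem⟩]
  · rintro x (hx | hx) y (hy | hy) e
    · exact hG.2 b (hAG hx) (hAG hy) e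
    · exact (key b x hx y hy e).1
    · exact (key b y hy x hx e.symm).1.symm
    · exact h.inj b hx hy e
theorem Cut.disk (h : Cut G s t A B S) (hG : Good G) (b : Bool) :
    pd b (A ∪ S) ∪ pd b (B ∪ S) = pd b G ∧ pd b (A ∪ S) ∩ pd b (B ∪ S) = pr b '' S := by
  simp only [pd, image_union]
  have := (h.image hG b).theta_disk (h.cr b)
  exact ⟨this.1, this.2.1⟩
theorem Cut.pers (h : Cut G s t A B S) (hG : Good G) {b : Bool} {x : ℂ × ℂ} (hx : x ∈ G)
    (hd : pr b x ∈ pd b (A ∪ S)) : x ∈ A ∪ S := by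
  have hxG := hx
  rw [← h.sp.2.2.2] at hx
  rcases hx with hx | hx
  · exact Or.inl hx
  · simp only [pd, image_union] at hd
    have : pr b x ∈ ({pr b s, pr b t} : Set ℂ) := by
      rw [← ((h.image hG b).theta_disk (h.cr b)).2.2]; exact ⟨hd, mem_image_of_mem _ hx⟩
    have hAG : A ⊆ G := h.sp.2.2.2 ▸ subset_union_left
    rcases this with h1 | h1
    · rw [hG.2 b hxG (hAG h.sp.1.left_mem) h1]; exact Or.inl h.sp.1.left_mem
    · rw [hG.2 b hxG (hAG h.sp.1.right_mem) h1]; exact Or.inl h.sp.1.right_mem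
end

inductive Cuts : Set (ℂ × ℂ) → List (Set (ℂ × ℂ)) → Prop
  | leaf (G) : Cuts G [G]
  | node {G s t A B S l l'} (h : Cut G s t A B S) (h1 : Cuts (A ∪ S) l) (h2 : Cuts (B ∪ S) l') : Cuts G (l ++ l')

variable {G H K : Set (ℂ × ℂ)} {l : List (Set (ℂ × ℂ))}

theorem Cuts.sub (h : Cuts G l) (hG : Good G) : ∀ H ∈ l, Good H ∧ ∀ b, pd b H ⊆ pd b G := by
  induction h with
  | leaf G => intro H hH; rw [List.mem_singleton.1 hH]; exact ⟨hG, fun b => Subset.rfl⟩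
  | node h h1 h2 ih1 ih2 =>
    intro H hH
    rcases List.mem_append.1 hH with hH | hH
    · obtain ⟨h3, h4⟩ := ih1 (h.good hG) H hH
      exact ⟨h3, fun b => (h4 b).trans ((h.disk hG b).1 ▸ subset_union_left)⟩
    · obtain ⟨h3, h4⟩ := ih2 (h.comm.good hG) H hH
      exact ⟨h3, fun b => (h4 b).trans ((h.disk hG b).1 ▸ subset_union_right)⟩

theorem Cuts.cover (h : Cuts G l) (hG : Good G) {b : Bool} {z : ℂ} (hz : z ∈ pd b G) : ∃ H ∈ l, z ∈ pd b H := by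
  induction h with
  | leaf G => exact ⟨G, by simp, hz⟩
  | node h h1 h2 ih1 ih2 =>
    rw [← (h.disk hG b).1] at hz
    rcases hz with hz | hz
    · obtain ⟨H, h3, h4⟩ := ih1 (h.good hG) hz; exact ⟨H, List.mem_append_left _ h3, h4⟩
    · obtain ⟨H, h3, h4⟩ := ih2 (h.comm.good hG) hz; exact ⟨H, List.mem_append_right _ h3, h4⟩

theorem Cuts.pers (h : Cuts G l) (hG : Good G) {b : Bool} (hH : H ∈ l) {x : ℂ × ℂ} (hx : x ∈ G)
    (hd : pr b x ∈ pd b H) : x ∈ H := by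
  induction h with
  | leaf G => rw [List.mem_singleton.1 hH]; exact hx
  | node h h1 h2 ih1 ih2 =>
    rcases List.mem_append.1 hH with hH | hH
    · exact ih1 (h.good hG) hH (h.pers hG hx ((h1.sub (h.good hG) H hH).2 b hd))
    · exact ih2 (h.comm.good hG) hH (h.comm.pers hG hx ((h2.sub (h.comm.good hG) H hH).2 b hd))

theorem mem_pd {b : Bool} {x : ℂ × ℂ} (hx : x ∈ G) : pr b x ∈ pd b G := Or.inr (mem_image_of_mem _ hx)

theorem Cuts.meet (h : Cuts G l) (hG : Good G) {b : Bool} (hH : H ∈ l) (hK : K ∈ l) {z : ℂ}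
    (hz : z ∈ pd b H) (hz' : z ∈ pd b K) : (H ∩ K).Nonempty := by
  induction h with
  | leaf G =>
    rw [List.mem_singleton.1 hH, List.mem_singleton.1 hK, inter_self]
    obtain ⟨a, b, A, B, h⟩ := hG.1
    exact ⟨a, h.2.2.2 ▸ Or.inl h.1.left_mem⟩
  | @node G s t A B S l l' h h1 h2 ih1 ih2 =>
    have g1 := h.good hG
    have g2 := h.comm.good hG
    have key : ∀ {H K}, H ∈ l → K ∈ l' → z ∈ pd b H → z ∈ pd b K → (H ∩ K).Nonempty := by
      intro H K hH hK hz hz'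
      have : z ∈ pd b (A ∪ S) ∩ pd b (B ∪ S) := ⟨(h1.sub g1 H hH).2 b hz, (h2.sub g2 K hK).2 b hz'⟩
      rw [(h.disk hG b).2] at this
      obtain ⟨x, hx, rfl⟩ := this
      exact ⟨x, h1.pers g1 hH (Or.inr hx) hz, h2.pers g2 hK (Or.inr hx) hz'⟩
    rcases List.mem_append.1 hH with hH | hH <;> rcases List.mem_append.1 hK with hK | hK
    · exact ih1 g1 hH hK
    · exact key hH hK hz hz'
    · rw [inter_comm]; exact key hK hH hz' hz
    · exact ih2 g2 hH hK

theorem Cuts.bind (h : Cuts G l) (hG : Good G) {f : Set (ℂ × ℂ) → List (Set (ℂ × ℂ))}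
    (hf : ∀ H ∈ l, Good H → Cuts H (f H)) : Cuts G (l.flatMap f) := by
  induction h with
  | leaf G => simpa using hf G (by simp) hG
  | node h h1 h2 ih1 ih2 =>
    rw [List.flatMap_append]
    exact .node h (ih1 (h.good hG) fun H hH => hf H (List.mem_append_left _ hH))
      (ih2 (h.comm.good hG) fun H hH => hf H (List.mem_append_right _ hH))

theorem double_arc {σ : Bool → Set ℂ} {s t : ℂ × ℂ} (h : ∀ b, IsArc (σ b) (pr b s) (pr b t)) :
    ∃ S, IsArc S s t ∧ ∀ b, InjOn (pr b) S ∧ pr b '' S = σ b := by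
  choose γ hγ hi h0 h1 hσ using h
  let Γ : ℝ → ℂ × ℂ := fun x => (γ true x, γ false x)
  have e : ∀ b x, pr b (Γ x) = γ b x := by rintro (_ | _) x <;> rfl
  refine ⟨Γ '' Icc 0 1, ⟨Γ, (hγ true).prodMk (hγ false), fun x hx y hy he => ?_, ?_, ?_, rfl⟩, fun b => ⟨?_, ?_⟩⟩
  · exact hi true hx hy (congrArg Prod.fst he)
  · exact pr_ext fun b => by rw [e, h0]
  · exact pr_ext fun b => by rw [e, h1]
  · rintro _ ⟨x, hx, rfl⟩ _ ⟨y, hy, rfl⟩ he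
    rw [e, e] at he; rw [hi b hx hy he]
  · rw [← hσ b, image_image]; exact image_congr fun x _ => e b x

theorem Good.cut (hG : Good G) {b : Bool} {s t : ℂ} {A B σ : Set ℂ} (h : Split (pr b '' G) s t A B)
    (hσ : Crosscut (pr b '' G) σ s t) :
    ∃ s' t' A' B' S, Cut G s' t' A' B' S ∧ pr b '' A' = A ∧ pr b '' B' = B ∧ pr b '' S = σ := by
  obtain ⟨g, hg, hl⟩ := exists_inv hG.1.compact (pr_cont b).continuousOn (hG.2 b)
  have hr : ∀ z ∈ pr b '' G, g z ∈ G ∧ pr b (g z) = z := by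
    rintro _ ⟨x, hx, rfl⟩; rw [hl hx]; exact ⟨hx, rfl⟩
  have hgi : InjOn g (pr b '' G) := fun x hx y hy e => by rw [← (hr x hx).2, e, (hr y hy).2]
  have e1 : g '' (pr b '' G) = G := hl.image_image
  have hsp := h.image hg hgi
  rw [e1] at hsp
  have himg : ∀ A ⊆ pr b '' G, pr b '' (g '' A) = A := fun A hA => by
    rw [image_image]; exact (image_congr fun z hz => (hr z (hA hz)).2).trans (image_id _)
  have hs := hr s hσ.2.1
  have ht := hr t hσ.2.2.1
  have hne : g s ≠ g t := hsp.1.ne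
  have : ∀ b', ∃ τ, Crosscut (pr b' '' G) τ (pr b' (g s)) (pr b' (g t)) ∧ (b' = b → τ = σ) := fun b' => by
    by_cases e : b' = b
    · subst e; exact ⟨σ, by rw [hs.2, ht.2]; exact hσ, fun _ => rfl⟩
    · obtain ⟨τ, hτ⟩ := (hG.jor b').crosscut (mem_image_of_mem _ hs.1) (mem_image_of_mem _ ht.1)
        (fun e => hne (hG.2 b' hs.1 ht.1 e))
      exact ⟨τ, hτ, fun h => absurd h e⟩
  choose τ hτ hτb using this
  obtain ⟨S, hS, hS'⟩ := double_arc fun b' => (hτ b').1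
  refine ⟨g s, g t, g '' A, g '' B, S, ⟨hsp, hS, fun b => (hS' b).1, fun b' => (hS' b').2 ▸ hτ b'⟩,
    himg _ (h.2.2.2 ▸ subset_union_left), himg _ (h.2.2.2 ▸ subset_union_right), ?_⟩
  rw [(hS' b).2, hτb b rfl]

theorem IsJor.sample {C : Set ℂ} (h : IsJor C) {K U : Set ℂ} (hK : IsCompact K) (hKC : K ⊆ C) (hU : IsOpen U)
    (hKU : K ⊆ U) : ∃ F : Finset ℂ, ∀ z ∈ K, ∃ f ∈ F, ∃ S, IsPreconnected S ∧ S ⊆ C ∩ U ∧ z ∈ S ∧ f ∈ S := by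
  have : ∀ z ∈ K, ∃ r, 0 < r ∧ ∃ S, IsPreconnected S ∧ S ⊆ C ∩ U ∧ z ∈ S ∧ C ∩ Metric.ball z r ⊆ S := by
    intro z hz
    obtain ⟨e, he, hb⟩ := Metric.isOpen_iff.1 hU z (hKU hz)
    obtain ⟨s, t, A, B, hS, h1, h2, h3⟩ := h.small (hKC hz) he
    obtain ⟨r, hr, hb'⟩ := Metric.isOpen_iff.1 hS.2.1.closed.isOpen_compl z h2
    refine ⟨r, hr, A, hS.1.conn, subset_inter (hS.2.2.2 ▸ subset_union_left) (h3.trans hb), h1, fun x hx => ?_⟩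
    have := hx.1
    rw [← hS.2.2.2] at this
    exact this.resolve_right (hb' hx.2)
  choose! r hr S hS1 hS2 hS3 hS4 using this
  obtain ⟨F, hF, hcov⟩ := hK.elim_nhds_subcover (fun z => Metric.ball z (r z)) fun z hz => Metric.ball_mem_nhds z (hr z hz)
  refine ⟨F, fun z hz => ?_⟩
  obtain ⟨f, hf, hzf⟩ := mem_iUnion₂.1 (hcov hz)
  exact ⟨f, hf, S f, hS1 f (hF f hf), hS2 f (hF f hf), hS4 f (hF f hf) ⟨hKC hz, hzf⟩, hS3 f (hF f hf)⟩

theorem Split.conn_side {C A B T : Set ℂ} {s t z : ℂ} (h : Split C s t A B) (hT : IsPreconnected T) (hTC : T ⊆ C)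
    (hs : s ∉ T) (ht : t ∉ T) (hz : z ∈ T) (hzA : z ∈ A) : T ⊆ A := by
  have hd : ∀ x ∈ T, x ∈ A → x ∉ B := fun x hx h1 h2 => by
    have : x ∈ A ∩ B := ⟨h1, h2⟩
    rw [h.2.2.1] at this
    rcases this with rfl | rfl
    exacts [hs hx, ht hx]
  have hT' : T ⊆ Bᶜ := hT.subset_left_of_subset_union (u := Bᶜ) (v := Aᶜ) h.2.1.closed.isOpen_compl h.1.closed.isOpen_compl
    |> fun f => by
      by_contra hn
      obtain ⟨x, hx, hxB⟩ := not_subset.1 hn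
      have hxB : x ∈ B := not_not.1 hxB
      obtain ⟨y, hy, h1, h2⟩ := hT Bᶜ Aᶜ h.2.1.closed.isOpen_compl h.1.closed.isOpen_compl
        (fun y hy => by
          by_cases hyA : y ∈ A
          · exact Or.inl (hd y hy hyA)
          · exact Or.inr hyA) ⟨z, hz, hd z hz hzA⟩ ⟨x, hx, fun h1 => hd x hx h1 hxB⟩
      have := hTC hy
      rw [← h.2.2.2] at this
      exact this.elim h2 h1
  intro x hx
  have := hTC hx
  rw [← h.2.2.2] at this
  exact this.resolve_right (hT' hx)

theorem strip_cuts {b : Bool} {u : ℂ} (hu : u ≠ 0) {c1 c c2 : ℝ} (h1 : c1 < c) (h2 : c < c2) (n : ℕ) :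
    ∀ (G : Set (ℂ × ℂ)) (F : Finset ℂ), Good G → F.card ≤ n →
      (∀ z ∈ pr b '' G, (u * z).re ≤ c1 ∨ c2 ≤ (u * z).re → ∃ f ∈ F, ∃ S, IsPreconnected S ∧
        S ⊆ pr b '' G ∩ {z | (u * z).re ≠ c} ∧ z ∈ S ∧ f ∈ S) →
      ∃ l, Cuts G l ∧ ∀ H ∈ l, pr b '' H ⊆ {z | (u * z).re ≤ c2} ∨ pr b '' H ⊆ {z | c1 ≤ (u * z).re} := by
  have hcont : Continuous fun z : ℂ => (u * z).re := by fun_prop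
  classical
  induction n with
  | zero =>
    intro G F hG hF hs
    obtain rfl : F = ∅ := Finset.card_eq_zero.1 (Nat.le_zero.1 hF)
    refine ⟨[G], .leaf G, fun H hH => Or.inl fun z hz => ?_⟩
    rw [List.mem_singleton.1 hH] at hz
    by_contra hn
    rw [mem_ofPred_eq, not_le] at hn
    obtain ⟨f, hf, -⟩ := hs z hz (Or.inr hn.le)
    simp at hf
  | succ n ih =>
    intro G F hG hF hs
    by_cases hl : pr b '' G ⊆ {z | (u * z).re ≤ c2} ∨ pr b '' G ⊆ {z | c1 ≤ (u * z).re}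
    · exact ⟨[G], .leaf G, fun H hH => by rw [List.mem_singleton.1 hH]; exact hl⟩
    obtain ⟨hl1, hl2⟩ := not_or.1 hl
    obtain ⟨q, hq, hqc⟩ := not_subset.1 hl1
    obtain ⟨p, hp, hpc⟩ := not_subset.1 hl2
    rw [mem_ofPred_eq, not_le] at hqc hpc
    obtain ⟨fp, hfp, Sp, a1, a2, a3, a4⟩ := hs p hp (Or.inl hpc.le)
    obtain ⟨fq, hfq, Sq, b1, b2, b3, b4⟩ := hs q hq (Or.inr hqc.le)
    have hfpc : (u * fp).re < c := by
      by_contra hn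
      rw [not_lt] at hn
      obtain ⟨x, hx, hxc⟩ := a1.intermediate_value a3 a4 hcont.continuousOn ⟨(hpc.trans h1).le, hn⟩
      exact (a2 hx).2 hxc
    have hfqc : c < (u * fq).re := by
      by_contra hn
      rw [not_lt] at hn
      obtain ⟨x, hx, hxc⟩ := b1.intermediate_value b4 b3 hcont.continuousOn ⟨hn, (h2.trans hqc).le⟩
      exact (b2 hx).2 hxc
    obtain ⟨s, t, σ, A, B, hsp, hσ, hA, hB, hσc⟩ := lemmaZ (hG.jor b) hu (a2 a4).1 (b2 b4).1 hfpc hfqc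
    obtain ⟨s', t', A', B', S, hcut, rfl, rfl, rfl⟩ := hG.cut hsp hσ
    have hsc : (u * s).re = c := hσc hσ.1.left_mem
    have htc : (u * t).re = c := hσc hσ.1.right_mem
    have key : ∀ {A' B' : Set (ℂ × ℂ)} {g g' : ℂ}, Cut G s' t' A' B' S → Split (pr b '' G) s t (pr b '' A') (pr b '' B') →
        g ∈ F → g ∈ pr b '' B' → (u * g).re ≠ c →
        ∃ l, Cuts (A' ∪ S) l ∧ ∀ H ∈ l, pr b '' H ⊆ {z | (u * z).re ≤ c2} ∨ pr b '' H ⊆ {z | c1 ≤ (u * z).re} := by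
      intro A' B' g _ hcut hsp hgF hgB hgc
      refine ih (A' ∪ S) (F.erase g) (hcut.good hG) (by rw [Finset.card_erase_of_mem hgF]; omega) ?_
      rw [image_union]
      rintro z (hz | hz) hzc
      · obtain ⟨f, hf, T, t1, t2, t3, t4⟩ := hs z (hsp.2.2.2 ▸ Or.inl hz) hzc
        have hTA := hsp.conn_side t1 (t2.trans inter_subset_left) (fun h => (t2 h).2 hsc) (fun h => (t2 h).2 htc) t3 hz
        refine ⟨f, Finset.mem_erase.2 ⟨?_, hf⟩, T, t1, fun x hx => ⟨Or.inl (hTA hx), (t2 hx).2⟩, t3, t4⟩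
        rintro rfl
        have : f ∈ pr b '' A' ∩ pr b '' B' := ⟨hTA t4, hgB⟩
        rw [hsp.2.2.1] at this
        rcases this with rfl | rfl
        exacts [hgc hsc, hgc htc]
      · have : (u * z).re = c := hσc hz
        rcases hzc with h | h <;> linarith
    obtain ⟨l, hl1, hl2⟩ := key (g' := 0) hcut hsp hfq hB hfqc.ne'
    obtain ⟨l', hl3, hl4⟩ := key (g' := 0) hcut.comm hsp.comm hfp hA hfpc.ne
    exact ⟨l ++ l', .node hcut hl1 hl3, fun H hH => (List.mem_append.1 hH).elim (hl2 H) (hl4 H)⟩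

def Ach (P : Set (ℂ × ℂ) → Prop) : Prop := ∀ G, Good G → ∃ l, Cuts G l ∧ ∀ H ∈ l, P H
def Her (P : Set (ℂ × ℂ) → Prop) : Prop := ∀ G H, (∀ b, pd b H ⊆ pd b G) → P G → P H

theorem Ach.and {P Q : Set (ℂ × ℂ) → Prop} (hP : Ach P) (hQ : Ach Q) (h : Her P) : Ach fun H => P H ∧ Q H := by
  intro G hG
  obtain ⟨l, hl, hlP⟩ := hP G hG
  choose! f hf hfQ using hQ
  refine ⟨l.flatMap f, hl.bind hG fun H _ hH => hf H hH, fun H hH => ?_⟩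
  obtain ⟨K, hK, hHK⟩ := List.mem_flatMap.1 hH
  have gK := (hl.sub hG K hK).1
  exact ⟨h K H ((hf K gK).sub gK H hHK).2 (hlP K hK), hfQ K gK H hHK⟩

theorem Ach.all {ι : Type*} (s : Finset ι) {P : ι → Set (ℂ × ℂ) → Prop} (h : ∀ i, Ach (P i)) (h' : ∀ i, Her (P i)) :
    Ach fun H => ∀ i ∈ s, P i H := by
  classical
  induction s using Finset.induction_on with
  | empty => exact fun G hG => ⟨[G], .leaf G, by simp⟩
  | insert a s ha ih =>
    intro G hG
    obtain ⟨l, h1, h2⟩ := (h a).and ih (h' a) G hG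
    exact ⟨l, h1, fun H hH i hi => (Finset.mem_insert.1 hi).elim (fun e => e ▸ (h2 H hH).1) ((h2 H hH).2 i)⟩

theorem ach_strip {b : Bool} {u : ℂ} (hu : u ≠ 0) {c1 c2 : ℝ} (h : c1 < c2) :
    Ach fun H => pd b H ⊆ {z | (u * z).re ≤ c2} ∨ pd b H ⊆ {z | c1 ≤ (u * z).re} := by
  intro G hG
  have hcont : Continuous fun z : ℂ => (u * z).re := by fun_prop
  have h1 : c1 < (c1 + c2) / 2 := by linarith
  have h2 : (c1 + c2) / 2 < c2 := by linarith
  obtain ⟨F, hF⟩ := (hG.jor b).sample (K := pr b '' G ∩ {z | (u * z).re ≤ c1 ∨ c2 ≤ (u * z).re})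
    (U := {z | (u * z).re ≠ (c1 + c2) / 2})
    ((hG.jor b).compact.inter_right ((isClosed_le hcont continuous_const).union (isClosed_le continuous_const hcont)))
    inter_subset_left (isOpen_ne_fun hcont continuous_const) (by
      rintro z ⟨-, hz⟩ he
      rcases hz with h | h <;> linarith)
  obtain ⟨l, hl, hl'⟩ := strip_cuts hu h1 h2 F.card G F hG le_rfl fun z hz hzc => hF z ⟨hz, hzc⟩
  refine ⟨l, hl, fun H hH => (hl' H hH).imp (ins_subset_halfplane u hu c2) fun h => ?_⟩
  have := ins_subset_halfplane (C := pr b '' H) (-u) (neg_ne_zero.2 hu) (-c1) (fun z hz => by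
    have : c1 ≤ (u * z).re := h hz
    rw [mem_ofPred_eq, neg_mul, Complex.neg_re]; linarith)
  intro z hz
  have := this hz
  rw [mem_ofPred_eq, neg_mul, Complex.neg_re] at this
  rw [mem_ofPred_eq]; linarith

theorem Good.fine (hG : Good G) {ε : ℝ} (hε : 0 < ε) :
    ∃ l, Cuts G l ∧ ∀ H ∈ l, ∀ b, ∀ z ∈ pd b H, ∀ w ∈ pd b H, dist z w ≤ ε := by
  obtain ⟨η, hη, hηε⟩ : ∃ η : ℝ, 0 < η ∧ 6 * η = ε := ⟨ε / 6, by positivity, by ring⟩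
  have : ∃ R : ℝ, ∀ b, ∀ z ∈ pd b G, ‖z‖ ≤ R := by
    have := fun b => (hG.jor b).disk_compact.isBounded.exists_norm_le
    choose R hR using this
    exact ⟨max (R true) (R false), fun b z hz => by
      cases b
      exacts [(hR false z hz).trans (le_max_right _ _), (hR true z hz).trans (le_max_left _ _)]⟩
  obtain ⟨R, hR⟩ := this
  obtain ⟨N, hN⟩ := exists_nat_gt (R / η)
  let u : Bool → ℂ := fun a => if a then 1 else -Complex.I
  have hu : ∀ a, u a ≠ 0 ∧ ‖u a‖ = 1 := by rintro (_ | _) <;> simp [u]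
  let P : (Bool × Bool × ℤ) → Set (ℂ × ℂ) → Prop := fun i H =>
    pd i.1 H ⊆ {z | (u i.2.1 * z).re ≤ (i.2.2 + 1) * η} ∨ pd i.1 H ⊆ {z | i.2.2 * η ≤ (u i.2.1 * z).re}
  obtain ⟨l, hl, hP⟩ := Ach.all (Finset.univ ×ˢ Finset.univ ×ˢ Finset.Icc (-(N:ℤ) - 2) (N + 2)) (P := P)
    (fun i => ach_strip (hu _).1 (by nlinarith)) (fun i G H h => Or.imp ((h _).trans) ((h _).trans)) G hG
  refine ⟨l, hl, fun H hH b => ?_⟩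
  have hsub := (hl.sub hG H hH).2 b
  have key : ∀ a, ∀ z ∈ pd b H, ∀ w ∈ pd b H, (u a * w).re - (u a * z).re ≤ 3 * η := by
    intro a z hz w hw
    by_contra hn
    rw [not_le] at hn
    have hzR : |(u a * z).re| ≤ R := (Complex.abs_re_le_norm _).trans (by
      rw [norm_mul, (hu a).2, one_mul]; exact hR b z (hsub hz))
    have hz1 : |(u a * z).re / η| < N := by
      rw [abs_div, abs_of_pos hη]; exact lt_of_le_of_lt (div_le_div_of_nonneg_right hzR hη.le) hN
    obtain ⟨k, hk⟩ : ∃ k, k = ⌊(u a * z).re / η⌋ := ⟨_, rfl⟩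
    have k1 := Int.floor_le ((u a * z).re / η)
    have k2 := Int.lt_floor_add_one ((u a * z).re / η)
    rw [← hk] at k1 k2
    have k3 : (-(N:ℤ) - 2) ≤ k + 1 := by
      have : -(N:ℝ) - 2 ≤ (k:ℝ) + 1 := by linarith [(abs_lt.1 hz1).1]
      exact_mod_cast this
    have k4 : k + 1 ≤ N + 2 := by
      have : (k:ℝ) + 1 ≤ N + 2 := by linarith [(abs_lt.1 hz1).2]
      exact_mod_cast this
    rw [le_div_iff₀ hη] at k1
    rw [div_lt_iff₀ hη] at k2
    rcases hP H hH (b, a, k + 1) (by simp; omega) with h | h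
    · have := h hw
      simp only [mem_ofPred_eq] at this
      push_cast at this
      nlinarith
    · have := h hz
      simp only [mem_ofPred_eq] at this
      push_cast at this
      linarith
  intro z hz w hw
  have h1 := key true z hz w hw
  have h2 := key true w hw z hz
  have h3 := key false z hz w hw
  have h4 := key false w hw z hz
  simp [u] at h1 h2 h3 h4
  rw [Complex.dist_eq]
  refine (Complex.norm_le_abs_re_add_abs_im _).trans ?_
  have : |(z - w).re| ≤ 3 * η := abs_le.2 ⟨by simp; linarith, by simp; linarith⟩
  have : |(z - w).im| ≤ 3 * η := abs_le.2 ⟨by simp; linarith, by simp; linarith⟩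
  linarith

theorem Cuts.mem (h : Cuts G l) (hG : Good G) {x : ℂ × ℂ} (hx : x ∈ G) : ∃ H ∈ l, x ∈ H := by
  obtain ⟨H, hH, hd⟩ := h.cover hG (mem_pd (b := true) hx)
  exact ⟨H, hH, h.pers hG hH hx hd⟩

theorem schoenflies (hG : Good G) {l0 : List (Set (ℂ × ℂ))} (h0 : Cuts G l0) :
    ∃ Γ : Set (ℂ × ℂ), IsCompact Γ ∧ (∀ b, InjOn (pr b) Γ) ∧ (∀ b, pr b '' Γ = pd b G) ∧ G ⊆ Γ ∧ ∀ H ∈ l0, H ⊆ Γ := by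
  have fine := fun (n : ℕ) (H : Set (ℂ × ℂ)) (h : Good H) => h.fine (ε := 1 / (n + 1 : ℝ)) (by positivity)
  choose! f hf hfs using fine
  obtain ⟨L, hL0, hLs⟩ : ∃ L : ℕ → List (Set (ℂ × ℂ)), L 0 = l0 ∧ ∀ n, L (n+1) = (L n).flatMap (f n) :=
    ⟨fun n => Nat.rec l0 (fun n l => l.flatMap (f n)) n, rfl, fun n => rfl⟩
  have hL : ∀ n, Cuts G (L n) := by
    intro n
    induction n with
    | zero => rw [hL0]; exact h0
    | succ n ih => rw [hLs]; exact ih.bind hG fun H _ hH => hf n H hH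
  have hgood : ∀ n, ∀ H ∈ L n, Good H := fun n H hH => ((hL n).sub hG H hH).1
  have hsmall : ∀ n, ∀ H ∈ L (n+1), ∀ b, ∀ z ∈ pd b H, ∀ w ∈ pd b H, dist z w ≤ 1 / (n + 1 : ℝ) := by
    intro n H hH
    obtain ⟨K, hK, hHK⟩ := List.mem_flatMap.1 (hLs n ▸ hH)
    exact hfs n K (hgood n K hK) H hHK
  let R : ℕ → Set (ℂ × ℂ) := fun n => ⋃ H ∈ {H | H ∈ L n}, pd true H ×ˢ pd false H
  have hRm : ∀ n x, x ∈ R n ↔ ∃ H ∈ L n, ∀ b, pr b x ∈ pd b H := by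
    intro n x
    simp only [R, mem_iUnion₂]
    refine exists_congr fun H => ⟨fun ⟨h1, h2⟩ => ⟨h1, fun b => ?_⟩, fun ⟨h1, h2⟩ => ⟨h1, h2 true, h2 false⟩⟩
    cases b
    exacts [h2.2, h2.1]
  have hRc : ∀ n, IsCompact (R n) := fun n =>
    (List.finite_toSet (L n)).isCompact_biUnion fun H hH =>
      ((hgood n H hH).jor _).disk_compact.prod ((hgood n H hH).jor _).disk_compact
  have hRs : ∀ n, R (n+1) ⊆ R n := by
    intro n x hx
    obtain ⟨H, hH, hx⟩ := (hRm _ _).1 hx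
    obtain ⟨K, hK, hHK⟩ := List.mem_flatMap.1 (hLs n ▸ hH)
    exact (hRm _ _).2 ⟨K, hK, fun b => ((hf n K (hgood n K hK)).sub (hgood n K hK) H hHK).2 b (hx b)⟩
  have hpers : ∀ n, ∀ H ∈ L n, ∀ x ∈ H, ∃ K ∈ L (n+1), x ∈ K := by
    intro n H hH x hx
    obtain ⟨K, hK, hxK⟩ := (hf n H (hgood n H hH)).mem (hgood n H hH) hx
    exact ⟨K, hLs n ▸ List.mem_flatMap.2 ⟨H, hH, hK⟩, hxK⟩
  have hin : ∀ H ∈ l0, H ⊆ ⋂ n, R n := by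
    intro H hH x hx
    refine mem_iInter.2 fun n => ?_
    have : ∃ K ∈ L n, x ∈ K := by
      induction n with
      | zero => exact ⟨H, hL0 ▸ hH, hx⟩
      | succ n ih => obtain ⟨K, hK, hxK⟩ := ih; exact hpers n K hK x hxK
    obtain ⟨K, hK, hxK⟩ := this
    exact (hRm _ _).2 ⟨K, hK, fun b => mem_pd hxK⟩
  have hproj : ∀ n b, pr b '' R n = pd b G := by
    intro n b
    apply Subset.antisymm
    · rintro _ ⟨x, hx, rfl⟩
      obtain ⟨H, hH, hx⟩ := (hRm _ _).1 hx
      exact ((hL n).sub hG H hH).2 b (hx b)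
    · intro z hz
      obtain ⟨H, hH, hzH⟩ := (hL n).cover hG hz
      have hne : ∀ b, (pd b H).Nonempty := fun b => by
        obtain ⟨z, hz⟩ := ((hgood n H hH).jor b).ins_nonempty; exact ⟨z, Or.inl hz⟩
      cases b
      · obtain ⟨w, hw⟩ := hne true
        exact ⟨(w, z), (hRm _ _).2 ⟨H, hH, by rintro (_ | _) <;> assumption⟩, rfl⟩
      · obtain ⟨w, hw⟩ := hne false
        exact ⟨(z, w), (hRm _ _).2 ⟨H, hH, by rintro (_ | _) <;> assumption⟩, rfl⟩
  refine ⟨⋂ n, R n, (hRc 0).of_isClosed_subset (isClosed_iInter fun n => (hRc n).isClosed) (iInter_subset R 0), fun b x hx y hy e => ?_, fun b => ?_, fun x hx => ?_, hin⟩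
  · refine pr_ext fun b' => ?_
    refine eq_of_dist_eq_zero (le_antisymm ?_ dist_nonneg)
    have key : ∀ n : ℕ, dist (pr b' x) (pr b' y) ≤ 2 * (1 / (n + 1 : ℝ)) := by
      intro n
      obtain ⟨H, hH, hxH⟩ := (hRm _ _).1 (mem_iInter.1 hx (n+1))
      obtain ⟨K, hK, hyK⟩ := (hRm _ _).1 (mem_iInter.1 hy (n+1))
      obtain ⟨v, hv1, hv2⟩ := (hL (n+1)).meet hG hH hK (hxH b) (e ▸ hyK b)
      have h1 := hsmall n H hH b' _ (hxH b') _ (mem_pd hv1)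
      have h2 := hsmall n K hK b' _ (mem_pd hv2) _ (hyK b')
      linarith [dist_triangle (pr b' x) (pr b' v) (pr b' y)]
    have lim : Tendsto (fun n : ℕ => 2 * (1 / (n + 1 : ℝ))) atTop (𝓝 (2 * 0)) :=
      tendsto_one_div_add_atTop_nhds_zero_nat.const_mul 2
    rw [mul_zero] at lim
    exact ge_of_tendsto' lim key
  · apply Subset.antisymm
    · exact (image_mono (iInter_subset R 0)).trans (hproj 0 b).le
    · intro z hz
      have : (⋂ n, R n ∩ pr b ⁻¹' {z}).Nonempty := by
        refine IsCompact.nonempty_iInter_of_sequence_nonempty_isCompact_isClosed _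
          (fun n => inter_subset_inter_left _ (hRs n)) (fun n => ?_)
          ((hRc 0).inter_right (isClosed_singleton.preimage (pr_cont b)))
          (fun n => (hRc n).isClosed.inter (isClosed_singleton.preimage (pr_cont b)))
        rw [← hproj n b] at hz
        obtain ⟨x, hx, hxz⟩ := hz
        exact ⟨x, hx, hxz⟩
      obtain ⟨x, hx⟩ := this
      rw [mem_iInter] at hx
      exact ⟨x, mem_iInter.2 fun n => (hx n).1, (hx 0).2⟩
  · obtain ⟨H, hH, hxH⟩ := h0.mem hG hx
    exact hin H hH hxH
end

section
open Set Filter Topology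

theorem np_aux {X Y Z τ : Set ℂ} {s t p q : ℂ} (h : Theta X Y Z s t) (hX : X \ {s, t} ⊆ ins (Y ∪ Z)) (hτ : IsArc τ p q)
    (hp : p ∈ X \ {s, t}) (hq : q ∈ Y \ {s, t}) (hd : Disjoint (τ \ {p, q}) (X ∪ Y ∪ Z)) :
    τ \ {p, q} ⊆ ins (X ∪ Y) := by
  have sp : Split (Y ∪ Z) s t Y Z := h.rot.split
  have cr : Crosscut (Y ∪ Z) X s t := ⟨h.a, Or.inl h.b.left_mem, Or.inl h.b.right_mem, hX⟩
  obtain ⟨hc, hcl, x0, hx0⟩ := hτ.diff_eq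
  have d1 : Disjoint (τ \ {p, q}) (Y ∪ Z) := hd.mono_right (by rw [union_assoc]; exact subset_union_right)
  have d2 : Disjoint (τ \ {p, q}) (Y ∪ X) := hd.mono_right (by rw [union_comm Y]; exact subset_union_left)
  have d3 : Disjoint (τ \ {p, q}) (Z ∪ X) := hd.mono_right (union_subset subset_union_right (subset_union_left.trans subset_union_left))
  have a1 : τ \ {p, q} ⊆ ins (Y ∪ Z) := by
    obtain ⟨y, h1, h2⟩ := mem_closure_iff.1 (hcl hτ.left_mem) _ (ins_open sp.jordan.closed) (hX hp)
    exact subset_ins hc d1 h2 h1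
  rcases (sp.theta_ins cr).2 x0 (a1 hx0) with h1 | h1 | h1
  · rw [union_comm]; exact subset_ins hc d2 hx0 h1
  · have := subset_ins hc d3 hx0 h1
    have h2 := closure_ins h.rot.rot.split.jordan.closed (closure_mono this (hcl hτ.right_mem))
    exact absurd ((sp.comm.theta_disk cr).2.2 ▸ (⟨h2, hq.1⟩ : q ∈ disk (Z ∪ X) ∩ Y)) hq.2
  · exact absurd (Or.inl (Or.inl h1)) (Set.disjoint_left.1 hd hx0)

theorem nonplanar {C : Set ℂ} {c X Y : Fin 3 → Set ℂ} {s t : Fin 3 → ℂ} (h : ∀ i, Split C (s i) (t i) (X i) (Y i))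
    (hc : ∀ i, IsArc (c i) (s i) (t i)) (hi : ∀ i, C ∩ c i = {s i, t i}) (hd : ∀ i j, i ≠ j → Disjoint (c i) (c j))
    (hX : ∀ i j, i ≠ j → (s j ∈ X i ∧ t j ∈ Y i) ∨ (t j ∈ X i ∧ s j ∈ Y i)) : False := by
  have hXY := fun i => (h i).2.2.2
  have e1 : ∀ i j, i ≠ j → ({s i, t i} : Set ℂ) ∩ {s j, t j} = ∅ := by
    intro i j hij
    rw [← disjoint_iff_inter_eq_empty]
    refine (hd i j hij).mono ?_ ?_ <;> rw [← hi] <;> exact inter_subset_right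
  have th : ∀ i, Theta (X i) (Y i) (c i) (s i) (t i) := by
    intro i
    have := hi i
    rw [← hXY i] at this
    refine ⟨(h i).1, (h i).2.1, hc i, (h i).2.2.1, ?_, ?_⟩
    · refine Subset.antisymm (fun z hz => this ▸ ⟨Or.inl hz.1, hz.2⟩) ?_
      rintro z (rfl | rfl)
      exacts [⟨(h i).1.left_mem, (hc i).left_mem⟩, ⟨(h i).1.right_mem, (hc i).right_mem⟩]
    · refine Subset.antisymm (fun z hz => this ▸ ⟨Or.inr hz.1, hz.2⟩) ?_
      rintro z (rfl | rfl)
      exacts [⟨(h i).2.1.left_mem, (hc i).left_mem⟩, ⟨(h i).2.1.right_mem, (hc i).right_mem⟩]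
  have two : ∀ i j, i ≠ j → c i \ {s i, t i} ⊆ ins C → c j \ {s j, t j} ⊆ ins C → False := by
    intro i j hij h1 h2
    have m : ∀ i, s i ∈ C ∧ t i ∈ C := fun i => by
      rw [← hXY i]; exact ⟨Or.inl (h i).1.left_mem, Or.inl (h i).1.right_mem⟩
    have c1 : Crosscut C (c i) (s i) (t i) := ⟨hc i, (m i).1, (m i).2, h1⟩
    have c2 : Crosscut C (c j) (s j) (t j) := ⟨hc j, (m j).1, (m j).2, h2⟩
    have : (c i ∩ c j).Nonempty := by
      rcases hX i j hij with h3 | h3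
      · exact interlace (h i) c1 c2 h3.1 h3.2 (e1 i j hij)
      · exact interlace (h i) c1 c2.symm h3.1 h3.2 (by rw [pair_comm (t j)]; exact e1 i j hij)
    obtain ⟨z, hz⟩ := this
    exact Set.disjoint_left.1 (hd i j hij) hz.1 hz.2
  have step : ∀ i, (c i \ {s i, t i} ⊆ ins C) ∨ ∀ j, i ≠ j → c j \ {s j, t j} ⊆ ins C := by
    intro i
    have dj : ∀ j, i ≠ j → Disjoint (c j \ {s j, t j}) (X i ∪ Y i ∪ c i) := by
      intro j hij
      rw [hXY, Set.disjoint_left]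
      rintro z ⟨hz, hn⟩ (h1 | h1)
      · exact hn (hi j ▸ ⟨h1, hz⟩)
      · exact Set.disjoint_left.1 (hd i j hij) h1 hz
    have ne : ∀ j, i ≠ j → s j ∉ ({s i, t i} : Set ℂ) ∧ t j ∉ ({s i, t i} : Set ℂ) := fun j hij => by
      have := disjoint_iff_inter_eq_empty.2 (e1 i j hij)
      exact ⟨Set.disjoint_right.1 this (Or.inl rfl), Set.disjoint_right.1 this (Or.inr rfl)⟩
    rcases (th i).one_inside with h1 | h1 | h1
    · refine Or.inr fun j hij => ?_
      rw [← hXY i]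
      rcases hX i j hij with h3 | h3
      · exact np_aux (th i) h1 (hc j) ⟨h3.1, (ne j hij).1⟩ ⟨h3.2, (ne j hij).2⟩ (dj j hij)
      · rw [pair_comm]; exact np_aux (th i) h1 (hc j).symm ⟨h3.1, (ne j hij).2⟩ ⟨h3.2, (ne j hij).1⟩ (pair_comm (s j) _ ▸ dj j hij)
    · refine Or.inr fun j hij => ?_
      have dj := dj j hij
      rw [← hXY i]; rw [union_comm (X i)] at dj ⊢
      rcases hX i j hij with h3 | h3
      · rw [pair_comm]; exact np_aux (th i).swap h1 (hc j).symm ⟨h3.2, (ne j hij).2⟩ ⟨h3.1, (ne j hij).1⟩ (pair_comm (s j) _ ▸ dj)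
      · exact np_aux (th i).swap h1 (hc j) ⟨h3.2, (ne j hij).1⟩ ⟨h3.1, (ne j hij).2⟩ dj
    · left; rwa [hXY] at h1
  rcases step 0 with h0 | h0
  · rcases step 1 with h1 | h1
    · exact two 0 1 (by decide) h0 h1
    · exact two 0 2 (by decide) h0 (h1 2 (by decide))
  · exact two 1 2 (by decide) (h0 1 (by decide)) (h0 2 (by decide))
end

section
open Set Filter Topology

def Lam : AddSubgroup ℂ where
  carrier := {z | ∃ m n : ℤ, z = m + n * Complex.I}
  add_mem' := by
    rintro _ _ ⟨a, b, rfl⟩ ⟨c, d, rfl⟩; exact ⟨a + c, b + d, by push_cast; ring⟩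
  zero_mem' := ⟨0, 0, by simp⟩
  neg_mem' := by rintro _ ⟨a, b, rfl⟩; exact ⟨-a, -b, by push_cast; ring⟩

theorem mem_Lam {z : ℂ} : z ∈ Lam ↔ ∃ m n : ℤ, z = m + n * Complex.I := Iff.rfl
theorem Lam_iff {z : ℂ} : z ∈ Lam ↔ (∃ m : ℤ, z.re = m) ∧ ∃ n : ℤ, z.im = n := by
  constructor
  · rintro ⟨m, n, rfl⟩; exact ⟨⟨m, by simp⟩, n, by simp⟩
  · rintro ⟨⟨m, hm⟩, n, hn⟩; exact ⟨m, n, by apply Complex.ext <;> simp [hm, hn]⟩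

theorem lam_of {a b : ℂ} (h : a ∈ Lam) (e : a = b) : b ∈ Lam := e ▸ h
def pj (z : ℂ) : Torus := ((z.re : UnitAddCircle), (z.im : UnitAddCircle))
theorem pj_cont : Continuous pj :=
  ((AddCircle.continuous_mk' 1).comp Complex.continuous_re).prodMk ((AddCircle.continuous_mk' 1).comp Complex.continuous_im)
theorem circ_eq {x y : ℝ} : (x : UnitAddCircle) = y ↔ ∃ n : ℤ, x - y = n := by
  rw [QuotientAddGroup.eq_iff_sub_mem, AddSubgroup.mem_zmultiples_iff]
  simp [eq_comm]
theorem pj_eq {z z' : ℂ} : pj z = pj z' ↔ z - z' ∈ Lam := by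
  rw [Lam_iff, pj, pj, Prod.mk.injEq, circ_eq, circ_eq]; simp
theorem pj_add {z k : ℂ} (hk : k ∈ Lam) : pj (z + k) = pj z := pj_eq.2 (by simpa using hk)
theorem pj_surj (x : Torus) : ∃ z, pj z = x := by
  obtain ⟨a, b⟩ := x
  obtain ⟨a, rfl⟩ := QuotientAddGroup.mk_surjective a
  obtain ⟨b, rfl⟩ := QuotientAddGroup.mk_surjective b
  exact ⟨⟨a, b⟩, rfl⟩

def sh (k : ℂ) (A : Set ℂ) : Set ℂ := (fun z => z + k) '' A
theorem mem_sh {k z : ℂ} {A : Set ℂ} : z ∈ sh k A ↔ z - k ∈ A :=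
  ⟨by rintro ⟨y, hy, rfl⟩; simpa using hy, fun h => ⟨_, h, by simp⟩⟩
theorem pj_sh {k : ℂ} (hk : k ∈ Lam) (A : Set ℂ) : pj '' sh k A = pj '' A := by
  rw [sh, image_image]; exact image_congr fun z _ => pj_add hk
theorem IsArc.sh {A : Set ℂ} {a b : ℂ} (h : IsArc A a b) (k : ℂ) : IsArc (sh k A) (a + k) (b + k) :=
  h.image (f := fun z => z + k) (by fun_prop) (fun _ _ _ _ h => by simpa using h)

def ad (i j : Fin 6) : Prop := (i.val + j.val) % 2 = 1
instance (i j : Fin 6) : Decidable (ad i j) := inferInstanceAs (Decidable (_ = _))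
theorem ad.symm {i j : Fin 6} (h : ad i j) : ad j i := by unfold ad at *; omega

structure PE where
  v : Fin 6 → ℂ
  μ : Fin 6 → Fin 6 → ℂ
  e : Fin 6 → Fin 6 → Set ℂ
  hμ : ∀ i j, μ i j ∈ Lam
  anti : ∀ i j, μ j i = -μ i j
  arc : ∀ i j, ad i j → IsArc (e i j) (v i) (v j + μ i j)
  rev : ∀ i j, ad i j → ∀ z, z ∈ e j i ↔ z + μ i j ∈ e i j
  vinj : ∀ i j, v i - v j ∈ Lam → i = j
  vtx : ∀ i j l, ad i j → ∀ z ∈ e i j, z - v l ∈ Lam → z = v i ∨ z = v j + μ i j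
  disj : ∀ i j i' j', ad i j → ad i' j' → ∀ z k, z ∈ e i j → k ∈ Lam → z - k ∈ e i' j' →
    (i = i' ∧ j = j' ∧ k = 0) ∨ (i = j' ∧ j = i' ∧ k = μ i j) ∨ ∃ l, z - v l ∈ Lam

def PE.relabel (P : PE) (g : Equiv.Perm (Fin 6)) (hg : ∀ i j, ad i j → ad (g i) (g j)) (n : Fin 6 → ℂ) (hn : ∀ i, n i ∈ Lam) : PE where
  v i := P.v (g i) + n i
  μ i j := P.μ (g i) (g j) + n i - n j
  e i j := sh (n i) (P.e (g i) (g j))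
  hμ i j := sub_mem (add_mem (P.hμ _ _) (hn i)) (hn j)
  anti i j := by rw [P.anti]; ring
  arc i j h := by
    have := (P.arc _ _ (hg i j h)).sh (n i)
    rwa [show P.v (g j) + n j + (P.μ (g i) (g j) + n i - n j) = P.v (g j) + P.μ (g i) (g j) + n i by ring]
  rev i j h z := by
    rw [mem_sh, mem_sh, P.rev _ _ (hg i j h)]; ring_nf
  vinj i j h := g.injective (P.vinj _ _ (lam_of (sub_mem (add_mem h (hn j)) (hn i)) (by ring)))
  vtx i j l h z hz hl := by
    rw [mem_sh] at hz
    have := P.vtx _ _ (g l) (hg i j h) _ hz (lam_of (sub_mem (add_mem hl (hn l)) (hn i)) (by ring))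
    rcases this with h | h
    · left; linear_combination h
    · right; linear_combination h
  disj i j i' j' h h' z k hz hk hz' := by
    rw [mem_sh] at hz hz'
    rcases P.disj _ _ _ _ (hg i j h) (hg i' j' h') (z - n i) (k + n i' - n i) hz (sub_mem (add_mem hk (hn _)) (hn _))
      (by ring_nf at hz' ⊢; exact hz') with ⟨h1, h2, h3⟩ | ⟨h1, h2, h3⟩ | ⟨l, hl⟩
    · obtain rfl := g.injective h1
      exact Or.inl ⟨rfl, g.injective h2, by linear_combination h3⟩
    · obtain rfl := g.injective h1; obtain rfl := g.injective h2
      exact Or.inr (Or.inl ⟨rfl, rfl, by linear_combination h3⟩)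
    · exact Or.inr (Or.inr ⟨g.symm l, lam_of (sub_mem (add_mem hl (hn i)) (hn (g.symm l))) (by simp only [Equiv.apply_symm_apply]; ring)⟩)

def ev (i : Fin 6) : Prop := i.val % 2 = 0
instance (i : Fin 6) : Decidable (ev i) := inferInstanceAs (Decidable (_ = _))
theorem ad.ev {i j : Fin 6} (h : ad i j) : (ev i ∧ ¬ ev j) ∨ (ev j ∧ ¬ ev i) := by
  unfold ad at h; simp only [_root_.ev]; omega

theorem PE.ofHalf (v : Fin 6 → ℂ) (M : Fin 6 → Fin 6 → ℂ) (E : Fin 6 → Fin 6 → Set ℂ) (hM : ∀ i j, M i j ∈ Lam)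
    (arc : ∀ i j, ev i → ¬ ev j → IsArc (E i j) (v i) (v j + M i j))
    (vinj : ∀ i j, v i - v j ∈ Lam → i = j)
    (vtx : ∀ i j l, ev i → ¬ ev j → ∀ z ∈ E i j, z - v l ∈ Lam → z = v i ∨ z = v j + M i j)
    (disj : ∀ i j i' j', ev i → ¬ ev j → ev i' → ¬ ev j' → ∀ z k, z ∈ E i j → k ∈ Lam → z - k ∈ E i' j' →
      (i = i' ∧ j = j' ∧ k = 0) ∨ ∃ l, z - v l ∈ Lam) :
    ∃ P : PE, P.v = v ∧ ∀ i j, ev i → ¬ ev j → P.e i j = E i j ∧ P.μ i j = M i j := by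
  have hs : ∀ i j : Fin 6, ¬ ad i j → ¬ ad j i := fun i j h h' => h h'.symm
  let m : Fin 6 → Fin 6 → ℂ := fun i j => if ad i j then (if ev i then M i j else -M j i) else 0
  let e : Fin 6 → Fin 6 → Set ℂ := fun i j => if ev i then E i j else sh (-M j i) (E j i)
  have m1 : ∀ i j, ev i → ¬ ev j → m i j = M i j ∧ m j i = - M i j ∧ e i j = E i j ∧ e j i = sh (-M i j) (E i j) := by
    intro i j h h'
    have : ad i j := by simp only [ev] at h h'; unfold ad; omega
    simp only [m, e]
    exact ⟨by rw [if_pos this, if_pos h], by rw [if_pos this.symm, if_neg h'], by rw [if_pos h], by rw [if_neg h']⟩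
  have hm : ∀ i j, m i j ∈ Lam := fun i j => by
    simp only [m]; split_ifs
    exacts [hM _ _, neg_mem (hM _ _), zero_mem _]
  have anti : ∀ i j, m j i = - m i j := fun i j => by
    by_cases h : ad i j
    · rcases h.ev with h | h
      · rw [(m1 i j h.1 h.2).1, (m1 i j h.1 h.2).2.1]
      · rw [(m1 j i h.1 h.2).1, (m1 j i h.1 h.2).2.1, neg_neg]
    · simp only [m]; rw [if_neg h, if_neg (hs _ _ h), neg_zero]
  have half : ∀ i j, ad i j → ∃ a b c, ev a ∧ ¬ ev b ∧ c ∈ Lam ∧ (∀ z, z ∈ e i j ↔ z - c ∈ E a b) ∧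
      ((i = a ∧ j = b ∧ c = 0) ∨ (i = b ∧ j = a ∧ c = m i j)) := by
    intro i j h
    rcases h.ev with h | h
    · exact ⟨i, j, 0, h.1, h.2, zero_mem _, fun z => by rw [(m1 i j h.1 h.2).2.2.1, sub_zero], Or.inl ⟨rfl, rfl, rfl⟩⟩
    · exact ⟨j, i, m i j, h.1, h.2, hm _ _, fun z => by rw [(m1 j i h.1 h.2).2.2.2, mem_sh, (m1 j i h.1 h.2).2.1], Or.inr ⟨rfl, rfl, rfl⟩⟩
  refine ⟨⟨v, m, e, hm, anti, ?_, ?_, vinj, ?_, ?_⟩, rfl, fun i j h h' => ⟨(m1 i j h h').2.2.1, (m1 i j h h').1⟩⟩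
  · intro i j h
    rcases h.ev with h | h
    · rw [(m1 i j h.1 h.2).1, (m1 i j h.1 h.2).2.2.1]; exact arc i j h.1 h.2
    · rw [(m1 j i h.1 h.2).2.1, (m1 j i h.1 h.2).2.2.2]
      have := ((arc j i h.1 h.2).sh (-M j i)).symm
      rwa [show v i + M j i + -M j i = v i by ring] at this
  · intro i j h z
    rcases h.ev with h | h
    · rw [(m1 i j h.1 h.2).1, (m1 i j h.1 h.2).2.2.1, (m1 i j h.1 h.2).2.2.2, mem_sh, sub_neg_eq_add]
    · rw [(m1 j i h.1 h.2).2.1, (m1 j i h.1 h.2).2.2.1, (m1 j i h.1 h.2).2.2.2, mem_sh]; simp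
  · intro i j l h z hz hl
    rcases h.ev with h | h
    · rw [(m1 i j h.1 h.2).1]; rw [(m1 i j h.1 h.2).2.2.1] at hz; exact vtx i j l h.1 h.2 z hz hl
    · rw [(m1 j i h.1 h.2).2.1]; rw [(m1 j i h.1 h.2).2.2.2, mem_sh] at hz
      rcases vtx j i l h.1 h.2 _ hz (lam_of (add_mem hl (hM j i)) (by ring)) with h | h
      · right; linear_combination h
      · left; linear_combination h
  · intro i j i' j' h h' z k hz hk hz'
    obtain ⟨a, b, c, ha, hb, hc, hE, h1⟩ := half i j h
    obtain ⟨a', b', c', ha', hb', hc', hE', h1'⟩ := half i' j' h'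
    rw [hE] at hz; rw [hE'] at hz'
    rcases disj a b a' b' ha hb ha' hb' (z - c) (k + c' - c) hz (sub_mem (add_mem hk hc') hc) (by ring_nf at hz' ⊢; exact hz') with ⟨rfl, rfl, h3⟩ | ⟨l, hl⟩
    · rcases h1 with ⟨rfl, rfl, rfl⟩ | ⟨rfl, rfl, rfl⟩ <;> rcases h1' with ⟨rfl, rfl, rfl⟩ | ⟨rfl, rfl, rfl⟩
      · exact Or.inl ⟨rfl, rfl, by linear_combination h3⟩
      · exact Or.inr (Or.inl ⟨rfl, rfl, by linear_combination h3 - anti j' i'⟩)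
      · exact Or.inr (Or.inl ⟨rfl, rfl, by linear_combination h3⟩)
      · exact Or.inl ⟨rfl, rfl, by linear_combination h3⟩
    · exact Or.inr (Or.inr ⟨l, lam_of (add_mem hl hc) (by ring)⟩)
end

section
open Set Filter Topology

structure Hex where
  f : ℝ → ℂ
  w : ℂ
  u : Fin 3 → ℂ
  K : Fin 3 → Set ℂ
  cont : Continuous f
  per : ∀ t, f (t + 6) = f t + w
  hw : w ∈ Lam
  hu : ∀ c, u c ∈ Lam
  inj : ∀ s t k, k ∈ Lam → f s + k = f t → ∃ n : ℤ, k = n * w ∧ t = s + 6 * n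
  arc : ∀ c : Fin 3, IsArc (K c) (f c.val) (f (c.val + 3) + u c)
  KL : ∀ (c : Fin 3) z s k, z ∈ K c → k ∈ Lam → z = f s + k → z = f c.val ∨ z = f (c.val + 3) + u c
  KK : ∀ c c' z k, z ∈ K c → k ∈ Lam → z - k ∈ K c' → c = c' ∧ k = 0

def i0 (c : Fin 3) : Fin 6 := ⟨c, by omega⟩
def i3 (c : Fin 3) : Fin 6 := ⟨c + 3, by omega⟩
theorem lam_z {w : ℂ} (h : w ∈ Lam) (n : ℤ) : (n : ℂ) * w ∈ Lam := by simpa using Lam.zsmul_mem h n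

def PE.Gauged (P : PE) : Prop := ∀ i : Fin 6, i ≠ 5 → P.μ i (i + 1) = 0

theorem PE.hex (P : PE) (hg : P.Gauged) : ∃ H : Hex, H.w = P.μ 5 0 ∧ (∀ c, H.u c = P.μ (i0 c) (i3 c)) ∧
    (∀ i : Fin 6, H.f i.val = P.v i) ∧ (∀ i : Fin 6, H.f '' Icc (i.val : ℝ) (i.val + 1) = P.e i (i + 1)) ∧
    ∀ c, H.K c = P.e (i0 c) (i3 c) := by
  have ad1 : ∀ i : Fin 6, ad i (i + 1) := by decide
  have ad3 : ∀ c : Fin 3, ad (i0 c) (i3 c) := by decide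
  choose γ γc γi γ0 γ1 γe using fun i => P.arc i (i + 1) (ad1 i)
  set w := P.μ 5 0 with hw
  have wL : w ∈ Lam := P.hμ _ _
  let q : ℤ → Fin 6 := fun n => ⟨(n % 6).toNat, by omega⟩
  have qv : ∀ n, ((q n).val : ℤ) = n % 6 := fun n => by simp only [q]; omega
  have qs : ∀ n, q (n + 1) = q n + 1 := fun n => by
    apply Fin.ext; rw [Fin.val_add]; simp only [q]; simp; omega
  obtain ⟨f, fc, hf⟩ := concatZ (p := fun n t => γ (q n) t + (n / 6 : ℤ) * w) (fun n => (γc _).add continuousOn_const) (by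
    intro n
    beta_reduce
    rw [γ1, qs, γ0]
    by_cases h : q n = 5
    · have h2 := qv n
      rw [h] at h2
      rw [show (n + 1) / 6 = n / 6 + 1 by simp at h2; omega, h]
      push_cast; rw [hw]; ring
    · have h2 := qv n
      have h3 : (q n).val ≠ 5 := fun h' => h (Fin.ext h')
      rw [show (n + 1) / 6 = n / 6 by have := (q n).isLt; omega, hg _ h]; ring)
  have val : ∀ (i : Fin 6) (m : ℤ), ∀ a ∈ Icc (0 : ℝ) 1, f (6 * m + i.val + a) = γ i a + m * w := by
    intro i m a ha
    have := hf (6 * m + i.val) a ha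
    rw [show q (6 * m + i.val) = i by apply Fin.ext; simp only [q]; omega, show (6 * m + (i.val : ℤ)) / 6 = m by omega] at this
    rw [← this]; push_cast; rfl
  have rep : ∀ s : ℝ, ∃ (i : Fin 6) (m : ℤ), ∃ a ∈ Ico (0 : ℝ) 1, s = 6 * m + i.val + a := by
    intro s
    refine ⟨q ⌊s⌋, ⌊s⌋ / 6, Int.fract s, ⟨Int.fract_nonneg s, Int.fract_lt_one s⟩, ?_⟩
    have : (6 * (⌊s⌋ / 6) + (q ⌊s⌋).val : ℤ) = ⌊s⌋ := by rw [qv]; omega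
    have h2 : (6 * ((⌊s⌋ / 6 : ℤ) : ℝ) + ((q ⌊s⌋).val : ℝ)) = ⌊s⌋ := by exact_mod_cast this
    rw [h2, Int.floor_add_fract]
  have I0 : ∀ {a : ℝ}, a ∈ Ico (0 : ℝ) 1 → a ∈ Icc (0 : ℝ) 1 := fun h => ⟨h.1, h.2.le⟩
  have z1 : ∀ i, ∀ a ∈ Icc (0 : ℝ) 1, γ i a ∈ P.e i (i + 1) := fun i a ha => γe i ▸ ⟨a, ha, rfl⟩
  have vz : ∀ i l, ∀ a ∈ Ico (0 : ℝ) 1, γ i a - P.v l ∈ Lam → a = 0 := by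
    intro i l a ha h
    rcases P.vtx i (i + 1) l (ad1 i) _ (z1 i a (I0 ha)) h with h | h
    · exact γi i (I0 ha) (by simp) (h.trans (γ0 i).symm)
    · exact absurd (γi i (I0 ha) (by simp) (h.trans (γ1 i).symm)) ha.2.ne
  refine ⟨⟨f, w, fun c => P.μ (i0 c) (i3 c), fun c => P.e (i0 c) (i3 c), fc, ?_, wL, fun c => P.hμ _ _, ?_, ?_, ?_, ?_⟩,
    rfl, fun _ => rfl, ?_, ?_, fun _ => rfl⟩
  · intro t
    obtain ⟨i, m, a, ha, rfl⟩ := rep t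
    rw [val i m a (I0 ha), show 6 * (m : ℝ) + i.val + a + 6 = 6 * ((m + 1 : ℤ) : ℝ) + i.val + a by push_cast; ring, val i _ a (I0 ha)]
    push_cast; ring
  · intro s t k hk h
    obtain ⟨i, m, a, ha, rfl⟩ := rep s
    obtain ⟨j, m', b, hb, rfl⟩ := rep t
    rw [val _ _ _ (I0 ha), val _ _ _ (I0 hb)] at h
    have fin : i = j → a = b → ∃ n : ℤ, k = n * w ∧ 6 * (m' : ℝ) + j.val + b = 6 * m + i.val + a + 6 * n := by
      rintro rfl rfl
      exact ⟨m' - m, by push_cast; linear_combination h, by push_cast; ring⟩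
    rcases P.disj i (i + 1) j (j + 1) (ad1 i) (ad1 j) (γ i a) ((m' - m : ℤ) * w - k) (z1 i a (I0 ha)) (sub_mem (lam_z wL _) hk)
      (by convert z1 j b (I0 hb) using 1; push_cast; linear_combination h) with ⟨h1, -, h3⟩ | ⟨h1, h2, -⟩ | ⟨l, hl⟩
    · subst h1
      exact fin rfl (γi i (I0 ha) (I0 hb) (by push_cast at h3; linear_combination h + h3))
    · exact absurd (h1 ▸ h2) ((by decide : ∀ j : Fin 6, j + 1 + 1 ≠ j) j)
    · have a0 := vz i l a ha hl
      have b0 : b = 0 := vz j l b hb (lam_of (add_mem (sub_mem hl (lam_z wL (m' - m))) hk) (by push_cast; linear_combination h))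
      subst a0 b0
      refine fin (P.vinj i j (lam_of (sub_mem (lam_z wL (m' - m)) hk) ?_)) rfl
      rw [γ0, γ0] at h
      push_cast; linear_combination -h
  · intro c
    have := P.arc _ _ (ad3 c)
    have h1 := val (i0 c) 0 0 (by simp)
    have h2 := val (i3 c) 0 0 (by simp)
    rw [γ0] at h1 h2
    simp only [i0, i3] at h1 h2 this ⊢
    push_cast at h1 h2
    simp only [mul_zero, zero_add, add_zero, zero_mul] at h1 h2
    rw [h1, h2]; exact this
  · intro c z s k hz hk hs
    obtain ⟨i, m, a, ha, rfl⟩ := rep s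
    have h1 := val (i0 c) 0 0 (by simp)
    have h2 := val (i3 c) 0 0 (by simp)
    rw [γ0] at h1 h2
    rw [val _ _ _ (I0 ha)] at hs
    have : z = P.v (i0 c) ∨ z = P.v (i3 c) + P.μ (i0 c) (i3 c) := by
      rcases P.disj _ _ i (i + 1) (ad3 c) (ad1 i) z (k + m * w) hz (add_mem hk (lam_z wL _)) (by
        convert z1 i a (I0 ha) using 1; linear_combination hs) with ⟨h1, h2, -⟩ | ⟨h1, h2, -⟩ | ⟨l, hl⟩
      · exact absurd (h1 ▸ h2) ((by decide : ∀ c : Fin 3, i3 c ≠ i0 c + 1) c)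
      · exact absurd (h2 ▸ h1) ((by decide : ∀ c : Fin 3, i0 c ≠ i3 c + 1) c)
      · exact P.vtx _ _ l (ad3 c) z hz hl
    simp only [i0, i3] at h1 h2 this ⊢
    push_cast at h1 h2
    simp only [mul_zero, zero_add, add_zero, zero_mul] at h1 h2
    rw [h1, h2]; exact this
  · intro c c' z k hz hk hz'
    have inj0 : ∀ a b : Fin 3, i0 a = i0 b → a = b := by decide
    have inj3 : ∀ a b : Fin 3, i3 a = i3 b → a = b := by decide
    have ne : ∀ a b : Fin 3, i0 a ≠ i3 b := by decide
    rcases P.disj _ _ _ _ (ad3 c) (ad3 c') z k hz hk hz' with ⟨h1, h2, h3⟩ | ⟨h1, h2, -⟩ | ⟨l, hl⟩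
    · exact ⟨inj0 _ _ h1, h3⟩
    · exact absurd h1 (ne _ _)
    · have m1 := P.hμ (i0 c) (i3 c)
      have m2 := P.hμ (i0 c') (i3 c')
      rcases P.vtx _ _ l (ad3 c) z hz hl with h | h <;>
        rcases P.vtx _ _ l (ad3 c') (z - k) hz' (lam_of (sub_mem hl hk) (by ring)) with h' | h'
      · obtain rfl := inj0 _ _ (P.vinj (i0 c) (i0 c') (lam_of hk (by linear_combination h - h')))
        exact ⟨rfl, by linear_combination h - h'⟩
      · exact absurd (P.vinj (i0 c) (i3 c') (lam_of (add_mem hk m2) (by linear_combination h - h'))) (ne _ _)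
      · exact absurd (P.vinj (i3 c) (i0 c') (lam_of (sub_mem hk m1) (by linear_combination h - h'))).symm (ne _ _)
      · obtain rfl := inj3 _ _ (P.vinj (i3 c) (i3 c') (lam_of (add_mem (sub_mem hk m1) m2) (by linear_combination h - h')))
        exact ⟨rfl, by linear_combination h - h'⟩
  · intro i
    have := val i 0 0 (by simp)
    rw [γ0] at this; simpa using this
  · intro i
    rw [← γe i]
    ext z; constructor
    · rintro ⟨t, ht, rfl⟩
      have h2 : t - i.val ∈ Icc (0 : ℝ) 1 := ⟨by linarith [ht.1], by linarith [ht.2]⟩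
      have := val i 0 (t - i.val) h2
      exact ⟨_, h2, by simpa using this.symm⟩
    · rintro ⟨a, ha, rfl⟩
      have := val i 0 a ha
      exact ⟨i.val + a, ⟨by linarith [ha.1], by linarith [ha.2]⟩, by simpa using this⟩
end

section
open Set Filter Topology

def dt (a b : ℂ) : ℝ := a.re * b.im - a.im * b.re

theorem Lam_prim {d : ℂ} (hd : d ∈ Lam) (h0 : d ≠ 0) : ∃ w0 ∈ Lam, w0 ≠ 0 ∧ ∀ x ∈ Lam, dt d x = 0 → ∃ n : ℤ, x = n * w0 := by
  obtain ⟨a, b, rfl⟩ := hd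
  have hg : 0 < Int.gcd a b := by
    rw [Int.gcd_pos_iff]
    by_contra h
    push Not at h
    exact h0 (by rw [h.1, h.2]; simp)
  obtain ⟨a', b', h1, ha, hb⟩ := Int.exists_gcd_one hg
  obtain ⟨r, s, hrs⟩ := Int.isCoprime_iff_gcd_eq_one.2 h1
  refine ⟨_, ⟨a', b', rfl⟩, fun h => h0 ?_, ?_⟩
  · have ha' : (a : ℂ) = a' * (Int.gcd a b : ℂ) := by exact_mod_cast ha
    have hb' : (b : ℂ) = b' * (Int.gcd a b : ℂ) := by exact_mod_cast hb
    linear_combination ha' + hb' * Complex.I + (Int.gcd a b : ℂ) * h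
  · rintro _ ⟨p, q, rfl⟩ h
    have h3 : a * q = b * p := by
      have : (a : ℝ) * q - b * p = 0 := by simpa [dt] using h
      have : (a : ℝ) * q = b * p := by linarith
      exact_mod_cast this
    have h2 : a' * q = b' * p := by
      have : (Int.gcd a b : ℤ) ≠ 0 := by exact_mod_cast hg.ne'
      apply mul_left_cancel₀ this
      rw [mul_comm a', ← mul_assoc]
      calc _ = a' * Int.gcd a b * q := by ring
        _ = b' * Int.gcd a b * p := by rw [← ha, ← hb, h3]
        _ = _ := by ring
    refine ⟨r * p + s * q, ?_⟩
    have e1 : p = (r * p + s * q) * a' := by linear_combination (-p) * hrs - s * h2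
    have e2 : q = (r * p + s * q) * b' := by linear_combination (-q) * hrs + r * h2
    have e1' : (p : ℂ) = (r * p + s * q) * a' := by exact_mod_cast e1
    have e2' : (q : ℂ) = (r * p + s * q) * b' := by exact_mod_cast e2
    push_cast
    linear_combination e1' + e2' * Complex.I

theorem int_zero {n : ℤ} (h1 : (-1 : ℝ) < n) (h2 : (n : ℝ) < 1) : n = 0 := by
  have : (-1 : ℤ) < n := by exact_mod_cast h1
  have : n < (1 : ℤ) := by exact_mod_cast h2
  omega

theorem Hex.rank (H : Hex) {w0 : ℂ} (hw0 : w0 ∈ Lam) (h0 : w0 ≠ 0) (h1 : ∃ n : ℤ, H.w = n * w0)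
    (h2 : ∀ c, ∃ n : ℤ, H.u c = n * w0) : False := by
  have pi0 := Complex.two_pi_I_ne_zero
  set ψ : ℂ → ℂ := fun z => Complex.exp (2 * Real.pi * Complex.I * z / w0) with hψ
  have ψc : Continuous ψ := by fun_prop
  have ψe : ∀ z z', ψ z = ψ z' ↔ ∃ n : ℤ, z - z' = n * w0 := by
    intro z z'
    simp only [hψ]
    rw [Complex.exp_eq_exp_iff_exists_int]
    refine exists_congr fun n => ?_
    rw [show 2 * Real.pi * Complex.I * z' / w0 + n * (2 * Real.pi * Complex.I) = 2 * Real.pi * Complex.I * (z' + n * w0) / w0 by field_simp,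
      div_left_inj' h0, mul_right_inj' pi0, sub_eq_iff_eq_add']
  set F : ℝ → ℂ := fun t => ψ (H.f t) with hF
  have Fc : Continuous F := ψc.comp H.cont
  have Fp : Function.Periodic F 6 := fun t => by
    obtain ⟨n, hn⟩ := h1
    exact (ψe _ _).2 ⟨n, by rw [H.per, hn]; ring⟩
  have Fi : ∀ s t, F s = F t → ∃ n : ℤ, t = s + 6 * n := by
    intro s t h
    obtain ⟨n, hn⟩ := (ψe _ _).1 h
    obtain ⟨m, -, h⟩ := H.inj s t (-(n * w0)) (neg_mem (lam_z hw0 n)) (by linear_combination hn)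
    exact ⟨m, h⟩
  have Fii : ∀ a b, b ≤ a + 3 → InjOn F (Icc a b) := by
    intro a b hab s hs t ht h
    obtain ⟨n, hn⟩ := Fi s t h
    have : n = 0 := int_zero (by linarith [hs.1, hs.2, ht.1, ht.2]) (by linarith [hs.1, hs.2, ht.1, ht.2])
    rw [hn, this]; simp
  have e3 : ∀ c : Fin 3, ψ (H.f (c.val + 3) + H.u c) = F (c.val + 3) := fun c => by
    obtain ⟨n, hn⟩ := h2 c
    exact (ψe _ _).2 ⟨n, by rw [hn]; ring⟩
  have Ki : ∀ c c' : Fin 3, ∀ x ∈ H.K c, ∀ y ∈ H.K c', ψ x = ψ y → c = c' ∧ x = y := by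
    intro c c' x hx y hy h
    obtain ⟨n, hn⟩ := (ψe _ _).1 h
    obtain ⟨h3, h4⟩ := H.KK c c' x (x - y) hx (hn ▸ lam_z hw0 n) (by simpa using hy)
    exact ⟨h3, sub_eq_zero.1 h4⟩
  refine nonplanar (C := range F) (c := fun c => ψ '' H.K c) (X := fun c => F '' Icc c.val (c.val + 3))
    (Y := fun c => F '' Icc (c.val + 3) (c.val + 6)) (s := fun c => F c.val) (t := fun c => F (c.val + 3)) ?_ ?_ ?_ ?_ ?_
  · intro c
    refine ⟨isArc_of_Icc (by linarith) Fc.continuousOn (Fii _ _ le_rfl), ?_, ?_, ?_⟩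
    · have := isArc_of_Icc (s := (c.val + 3 : ℝ)) (t := c.val + 6) (by linarith) Fc.continuousOn (Fii _ _ (by linarith))
      rw [Fp c.val] at this
      exact this.symm
    · apply Subset.antisymm
      · rintro _ ⟨⟨s, hs, rfl⟩, ⟨t, ht, h⟩⟩
        obtain ⟨n, hn⟩ := Fi s t h.symm
        rcases lt_or_ge (n : ℝ) 1 with hn1 | hn1
        · have : n = 0 := int_zero (by linarith [hs.1, hs.2, ht.1, ht.2]) hn1
          subst this
          right; rw [mem_singleton_iff]; congr 1; push_cast at hn; linarith [hs.2, ht.1]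
        · left; congr 1; linarith [hs.1, ht.2]
      · rintro _ (rfl | rfl)
        · exact ⟨⟨_, ⟨le_rfl, by linarith⟩, rfl⟩, ⟨_, ⟨by linarith, le_rfl⟩, Fp _⟩⟩
        · exact ⟨⟨_, ⟨by linarith, le_rfl⟩, rfl⟩, ⟨_, ⟨le_rfl, by linarith⟩, rfl⟩⟩
    · rw [← image_union, Icc_union_Icc_eq_Icc (by linarith) (by linarith)]
      exact Fp.image_Icc (by norm_num) _
  · intro c
    have := (H.arc c).image (f := ψ) ψc.continuousOn (fun x hx y hy h => (Ki c c x hx y hy h).2)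
    rwa [e3] at this
  · intro c
    apply Subset.antisymm
    · rintro _ ⟨⟨t, rfl⟩, ⟨z, hz, h⟩⟩
      obtain ⟨n, hn⟩ := (ψe _ _).1 h
      rcases H.KL c z t (n * w0) hz (lam_z hw0 n) (by linear_combination hn) with h' | h'
      · left; rw [← h, h']
      · right; rw [← h, h', e3]; rfl
    · rintro _ (rfl | rfl)
      · exact ⟨⟨_, rfl⟩, ⟨_, (H.arc c).left_mem, rfl⟩⟩
      · exact ⟨⟨_, rfl⟩, ⟨_, (H.arc c).right_mem, e3 c⟩⟩
  · intro c c' hcc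
    rw [Set.disjoint_left]
    rintro _ ⟨x, hx, rfl⟩ ⟨y, hy, h⟩
    exact hcc (Ki c c' x hx y hy h.symm).1
  · intro c c' hcc
    have h3 : (c.val : ℝ) ≤ 2 ∧ (c'.val : ℝ) ≤ 2 := ⟨by exact_mod_cast Nat.le_of_lt_succ c.isLt, by exact_mod_cast Nat.le_of_lt_succ c'.isLt⟩
    have h4 : (0 : ℝ) ≤ c.val ∧ (0 : ℝ) ≤ c'.val := ⟨by positivity, by positivity⟩
    rcases lt_or_gt_of_ne (fun h => hcc (Fin.ext h) : c.val ≠ c'.val) with h | h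
    · have h5 : (c.val : ℝ) ≤ c'.val := by exact_mod_cast h.le
      exact Or.inl ⟨⟨_, ⟨by linarith, by linarith⟩, rfl⟩, ⟨_, ⟨by linarith, by linarith⟩, rfl⟩⟩
    · have h5 : (c'.val : ℝ) ≤ c.val := by exact_mod_cast h.le
      exact Or.inr ⟨⟨_, ⟨by linarith, by linarith⟩, rfl⟩, ⟨c'.val + 6, ⟨by linarith, by linarith⟩, Fp _⟩⟩

theorem Hex.indep (H : Hex) {d : ℂ} (hd : d ∈ Lam) (h0 : d ≠ 0) (h1 : dt d H.w = 0) (h2 : ∀ c, dt d (H.u c) = 0) : False := by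
  obtain ⟨w0, hw, h, hp⟩ := Lam_prim hd h0
  exact H.rank hw h (hp _ H.hw h1) fun c => hp _ (H.hu c) (h2 c)

def Aut (g : Fin 6 → Fin 6) : Prop := (∀ i j, g i = g j → i = j) ∧ ∀ i j, ad i j → ad (g i) (g j)
instance (g : Fin 6 → Fin 6) : Decidable (Aut g) := inferInstanceAs (Decidable (_ ∧ _))
def PRel (P P' : PE) (g : Fin 6 → Fin 6) : Prop :=
  Aut g ∧ (∀ i, pj (P'.v i) = pj (P.v (g i))) ∧ ∀ i j, ad i j → pj '' P'.e i j = pj '' P.e (g i) (g j)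
theorem PRel.trans {P P' P'' : PE} {g g'} (h : PRel P P' g) (h' : PRel P' P'' g') : PRel P P'' (g ∘ g') :=
  ⟨⟨fun _ _ e => h'.1.1 _ _ (h.1.1 _ _ e), fun _ _ e => h.1.2 _ _ (h'.1.2 _ _ e)⟩, fun i => (h'.2.1 i).trans (h.2.1 _),
    fun i j e => (h'.2.2 i j e).trans (h.2.2 _ _ (h'.1.2 _ _ e))⟩

def nn {A : Type} [AddCommGroup A] (g : Fin 6 → Fin 6) (M : Fin 6 → Fin 6 → A) : Fin 6 → A :=
  let a := M (g 0) (g 1)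
  let b := a + M (g 1) (g 2)
  let c := b + M (g 2) (g 3)
  let d := c + M (g 3) (g 4)
  ![0, a, b, c, d, d + M (g 4) (g 5)]
def tr {A : Type} [AddCommGroup A] (g : Fin 6 → Fin 6) (M : Fin 6 → Fin 6 → A) (i j : Fin 6) : A :=
  M (g i) (g j) + nn g M i - nn g M j
def std {A : Type} [AddCommGroup A] (w u0 u1 u2 : A) : Fin 6 → Fin 6 → A :=
  ![![0, 0, 0, u0, 0, -w], ![0, 0, 0, 0, u1, 0], ![0, 0, 0, 0, 0, u2], ![-u0, 0, 0, 0, 0, 0], ![0, -u1, 0, 0, 0, 0], ![w, 0, -u2, 0, 0, 0]]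

theorem PE.gauge (P : PE) {g : Fin 6 → Fin 6} (hg : Aut g) : ∃ P' : PE, P'.Gauged ∧ PRel P P' g ∧ P'.μ = tr g P.μ := by
  have hn : ∀ i, nn g P.μ i ∈ Lam := by
    have m := P.hμ
    intro i
    fin_cases i <;> simp [nn, -add_assoc] <;> (repeat' apply add_mem) <;> apply m
  let E := Equiv.ofBijective g ⟨fun i j h => hg.1 i j h, Finite.injective_iff_surjective.1 fun i j h => hg.1 i j h⟩
  refine ⟨P.relabel E hg.2 _ hn, ?_, ⟨hg, fun i => pj_add (hn i), fun i j _ => pj_sh (hn i) _⟩, rfl⟩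
  intro i hi
  show P.μ (g i) (g (i + 1)) + nn g P.μ i - nn g P.μ (i + 1) = 0
  fin_cases i <;> simp [nn] at hi ⊢ <;> ring

theorem PE.Gauged.std {P : PE} (h : P.Gauged) : ∀ i j, ad i j → P.μ i j = std (P.μ 5 0) (P.μ 0 3) (P.μ 1 4) (P.μ 2 5) i j := by
  have h0 := h 0 (by decide); have h1 := h 1 (by decide); have h2 := h 2 (by decide)
  have h3 := h 3 (by decide); have h4 := h 4 (by decide)
  simp only [Fin.isValue, zero_add, Fin.reduceAdd] at h0 h1 h2 h3 h4
  intro i j hij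
  fin_cases i <;> fin_cases j <;> first | exact absurd hij (by decide) | skip
  all_goals simp [_root_.std, h0, h1, h2, h3, h4, ← P.anti]
  all_goals rw [P.anti, neg_eq_zero]; assumption

theorem tr_congr {A : Type} [AddCommGroup A] {g : Fin 6 → Fin 6} (hg : Aut g) {M M' : Fin 6 → Fin 6 → A}
    (h : ∀ i j, ad i j → M i j = M' i j) : ∀ i j, ad i j → tr g M i j = tr g M' i j := by
  have : ∀ i, nn g M i = nn g M' i := by
    intro i
    have a : ∀ i : Fin 6, M (g i) (g (i + 1)) = M' (g i) (g (i + 1)) := fun i => h _ _ (hg.2 _ _ ((by decide : ∀ i : Fin 6, ad i (i + 1)) i))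
    have a0 := a 0; have a1 := a 1; have a2 := a 2; have a3 := a 3; have a4 := a 4
    simp only [Fin.isValue, zero_add, Fin.reduceAdd] at a0 a1 a2 a3 a4
    simp only [nn, a0, a1, a2, a3, a4]
  intro i j hij
  rw [tr, tr, h _ _ (hg.2 i j hij), this, this]

theorem PE.exists_indep (P : PE) : ∃ P' g, P'.Gauged ∧ PRel P P' g ∧ dt (P'.μ 5 0) (P'.μ 0 3) ≠ 0 := by
  have key : ∀ P : PE, P.Gauged → ∀ d ∈ Lam, d ≠ 0 → dt d (P.μ 5 0) = 0 → dt d (P.μ 0 3) = 0 → dt d (P.μ 1 4) = 0 → dt d (P.μ 2 5) = 0 → False := by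
    intro P hP d hd h0 h1 h2 h3 h4
    obtain ⟨H, hw, hu, -⟩ := P.hex hP
    refine H.indep hd h0 (by rwa [hw]) fun c => ?_
    rw [hu]; fin_cases c
    exacts [h2, h3, h4]
  have step : ∀ (P : PE), P.Gauged → ∀ g, Aut g → ∃ P' : PE, P'.Gauged ∧ PRel P P' g ∧ ∀ i j, ad i j →
      P'.μ i j = tr g (std (P.μ 5 0) (P.μ 0 3) (P.μ 1 4) (P.μ 2 5)) i j := by
    intro P hP g hg
    obtain ⟨P', h1, h2, h3⟩ := P.gauge hg
    exact ⟨P', h1, h2, fun i j hij => by rw [h3]; exact tr_congr hg hP.std i j hij⟩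
  have rot : ∀ P : PE, P.Gauged → P.μ 5 0 ≠ 0 → ∃ P' g, P'.Gauged ∧ PRel P P' g ∧ dt (P'.μ 5 0) (P'.μ 0 3) ≠ 0 := by
    intro P hP h0
    obtain ⟨P0, a0, b0, c0⟩ := step P hP ![0, 1, 2, 3, 4, 5] (by decide)
    obtain ⟨P1, a1, b1, c1⟩ := step P hP ![1, 2, 3, 4, 5, 0] (by decide)
    obtain ⟨P2, a2, b2, c2⟩ := step P hP ![2, 3, 4, 5, 0, 1] (by decide)
    have d0 := c0 5 0 (by decide); have d1 := c1 5 0 (by decide); have d2 := c2 5 0 (by decide)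
    have e0 := c0 0 3 (by decide); have e1 := c1 0 3 (by decide); have e2 := c2 0 3 (by decide)
    simp [tr, nn, std] at d0 d1 d2 e0 e1 e2
    by_contra hn
    push Not at hn
    have f0 := hn P0 _ a0 b0; have f1 := hn P1 _ a1 b1; have f2 := hn P2 _ a2 b2
    rw [d0, e0] at f0; rw [d1, e1] at f1; rw [d2, e2] at f2
    exact key P hP _ (P.hμ _ _) h0 (by simp only [dt]; ring) f0 f1 f2
  have : ∃ P' g, P'.Gauged ∧ PRel P P' g ∧ P'.μ 5 0 ≠ 0 := by
    obtain ⟨P0, a0, b0, -⟩ := P.gauge (g := id) (by decide)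
    by_contra hn
    push Not at hn
    obtain ⟨P1, a1, b1, c1⟩ := step P0 a0 ![0, 1, 2, 5, 4, 3] (by decide)
    obtain ⟨P2, a2, b2, c2⟩ := step P0 a0 ![0, 3, 2, 1, 4, 5] (by decide)
    obtain ⟨P3, a3, b3, c3⟩ := step P0 a0 ![0, 3, 2, 5, 4, 1] (by decide)
    have d0 := hn P0 _ a0 b0
    have d1 := hn P1 _ a1 (b0.trans b1); have d2 := hn P2 _ a2 (b0.trans b2); have d3 := hn P3 _ a3 (b0.trans b3)
    rw [c1 5 0 (by decide)] at d1; rw [c2 5 0 (by decide)] at d2; rw [c3 5 0 (by decide)] at d3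
    simp [tr, nn, std, d0] at d1 d2 d3
    have u0 : P0.μ 0 3 = 0 := by linear_combination (1 / 3) * d2 - (1 / 3) * d1 + (1 / 3) * d3
    have u1 : P0.μ 1 4 = 0 := by linear_combination d2 - u0
    have u2 : P0.μ 2 5 = 0 := by linear_combination d1 + u0
    exact key P0 a0 1 ⟨1, 0, by simp⟩ one_ne_zero (by simp [d0, dt]) (by simp [u0, dt]) (by simp [u1, dt]) (by simp [u2, dt])
  obtain ⟨P1, g, a, b, c⟩ := this
  obtain ⟨P2, g', a', b', c'⟩ := rot P1 a c
  exact ⟨P2, _, a', b.trans b', c'⟩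
end

section
open Set Filter Topology

def Hex.Q (H : Hex) : Set ℂ := (H.f '' Icc 0 6 ∪ sh H.w (H.K 0)) ∪ (H.K 0 ∪ sh (H.u 0) (H.f '' Icc 3 9))
def Hex.Ind (H : Hex) : Prop := dt H.w (H.u 0) ≠ 0

theorem dt_ind {w u : ℂ} (hd : dt w u ≠ 0) {m n : ℤ} (h : m * w + n * u = 0) : m = 0 ∧ n = 0 := by
  have h1 := congrArg Complex.re h
  have h2 := congrArg Complex.im h
  simp at h1 h2
  have a : (m : ℝ) * dt w u = 0 := by rw [dt]; linear_combination u.im * h1 - u.re * h2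
  have b : (n : ℝ) * dt w u = 0 := by rw [dt]; linear_combination w.re * h2 - w.im * h1
  simp [hd] at a b
  exact ⟨a, b⟩

namespace Hex
variable {H : Hex}

theorem arc0 : IsArc (H.K 0) (H.f 0) (H.f 3 + H.u 0) := by have := H.arc 0; simpa using this
theorem KL0 {z s k} (hz : z ∈ H.K 0) (hk : k ∈ Lam) (h : z = H.f s + k) : z = H.f 0 ∨ z = H.f 3 + H.u 0 := by
  have := H.KL 0 z s k hz hk h; simpa using this
theorem f6 : H.f 0 + H.w = H.f 6 := by rw [← H.per]; norm_num
theorem f9 : H.f 3 + H.w = H.f 9 := by rw [← H.per]; norm_num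

theorem fQ {s k} (hk : k ∈ Lam) (h : H.f s + k ∈ H.Q) :
    (∃ n : ℤ, k = n * H.w ∧ s + 6 * n ∈ Icc (0 : ℝ) 6) ∨ ∃ n : ℤ, k = H.u 0 + n * H.w ∧ s + 6 * n ∈ Icc (3 : ℝ) 9 := by
  have h1 : (∃ t ∈ Icc (0 : ℝ) 6, H.f s + k = H.f t) ∨ ∃ t ∈ Icc (3 : ℝ) 9, H.f s + k = H.f t + H.u 0 := by
    rcases h with (⟨t, ht, h⟩ | h) | (h | h)
    · exact Or.inl ⟨t, ht, h.symm⟩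
    · rw [mem_sh] at h
      rcases KL0 h (sub_mem hk H.hw) (by ring) with h | h
      · exact Or.inl ⟨6, by norm_num, by rw [← f6]; linear_combination h⟩
      · exact Or.inr ⟨9, by norm_num, by rw [← f9]; linear_combination h⟩
    · rcases KL0 h hk rfl with h | h
      · exact Or.inl ⟨0, by norm_num, h⟩
      · exact Or.inr ⟨3, by norm_num, h⟩
    · rw [mem_sh] at h
      obtain ⟨t, ht, h⟩ := h
      exact Or.inr ⟨t, ht, by rw [h]; ring⟩
  rcases h1 with ⟨t, ht, h⟩ | ⟨t, ht, h⟩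
  · obtain ⟨n, h1, rfl⟩ := H.inj s t k hk h
    exact Or.inl ⟨n, h1, ht⟩
  · obtain ⟨n, h1, rfl⟩ := H.inj s t (k - H.u 0) (sub_mem hk (H.hu 0)) (by linear_combination h)
    exact Or.inr ⟨n, by linear_combination h1, ht⟩

theorem KQ {c z k} (hz : z ∈ H.K c) (hk : k ∈ Lam) (h : z + k ∈ H.Q) :
    (z = H.f c.val ∨ z = H.f (c.val + 3) + H.u c) ∨ c = 0 ∧ (k = 0 ∨ k = H.w) := by
  rcases h with (⟨t, ht, h⟩ | h) | (h | h)
  · exact Or.inl (H.KL c z t (-k) hz (neg_mem hk) (by linear_combination -h))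
  · rw [mem_sh] at h
    obtain ⟨h1, h2⟩ := H.KK c 0 z (H.w - k) hz (sub_mem H.hw hk) (by convert h using 1; ring)
    exact Or.inr ⟨h1, Or.inr (by linear_combination -h2)⟩
  · obtain ⟨h1, h2⟩ := H.KK c 0 z (-k) hz (neg_mem hk) (by convert h using 1; ring)
    exact Or.inr ⟨h1, Or.inl (by linear_combination -h2)⟩
  · rw [mem_sh] at h
    obtain ⟨t, ht, h⟩ := h
    exact Or.inl (H.KL c z t (H.u 0 - k) hz (sub_mem (H.hu 0) hk) (by linear_combination -h))

theorem ind (hd : H.Ind) (m n : ℤ) (h : m * H.w + n * H.u 0 = 0) : m = 0 ∧ n = 0 := dt_ind hd h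
theorem nu (hd : H.Ind) (m : ℤ) : H.u 0 ≠ m * H.w := fun h => by simpa using (ind hd (-m) 1 (by push_cast; linear_combination h)).2
theorem w0 (hd : H.Ind) : H.w ≠ 0 := fun h => by simpa using (ind hd 1 0 (by simp [h])).1
theorem finj (hd : H.Ind) : Function.Injective H.f := fun s t h => by
  obtain ⟨n, h1, h2⟩ := H.inj s t 0 (zero_mem _) (by simpa using h)
  have := (ind hd n 0 (by rw [← h1]; simp)).1
  subst this; simpa using h2.symm
theorem ff (hd : H.Ind) {s t : ℝ} {m : ℤ} (h : H.f s = H.f t + H.u 0 + m * H.w) : False := by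
  obtain ⟨n, h1, h2⟩ := H.inj t s (H.u 0 + m * H.w) (add_mem (H.hu 0) (lam_z H.hw m)) (by linear_combination -h)
  exact nu hd (n - m) (by push_cast; linear_combination h1)

theorem jor (hd : H.Ind) : IsJor H.Q := by
  have fi := finj hd
  have a1 : IsArc (H.f '' Icc 0 6) (H.f 0) (H.f 6) := isArc_of_Icc (by norm_num) H.cont.continuousOn fi.injOn
  have a2 : IsArc (sh (H.u 0) (H.f '' Icc 3 9)) (H.f 3 + H.u 0) (H.f 9 + H.u 0) :=
    (isArc_of_Icc (by norm_num) H.cont.continuousOn fi.injOn).sh _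
  have k1 := H.arc0
  have k2 : IsArc (sh H.w (H.K 0)) (H.f 6) (H.f 9 + H.u 0) := by
    have := k1.sh H.w
    rwa [f6, show H.f 3 + H.u 0 + H.w = H.f 9 + H.u 0 by rw [← f9]; ring] at this
  have e1 : ∀ z, z ∈ H.f '' Icc 0 6 → z ∈ sh H.w (H.K 0) → z = H.f 6 := by
    rintro _ ⟨s, hs, rfl⟩ h
    rw [mem_sh] at h
    rcases KL0 h (neg_mem H.hw) (by ring) with h | h
    · rw [← f6]; linear_combination h
    · exact (ff hd (s := s) (t := 3) (m := 1) (by push_cast; linear_combination h)).elim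
  have e2 : ∀ z, z ∈ H.K 0 → z ∈ sh (H.u 0) (H.f '' Icc 3 9) → z = H.f 3 + H.u 0 := by
    intro z hz h
    rw [mem_sh] at h
    obtain ⟨s, hs, h⟩ := h
    rcases KL0 hz (H.hu 0) (by rw [h]; ring) with h' | h'
    · exact (ff hd (s := 0) (t := s) (m := 0) (by push_cast; linear_combination -h' - h)).elim
    · exact h'
  refine ⟨H.f 0, H.f 9 + H.u 0, _, _, a1.trans k2 fun z hz => e1 z hz.1 hz.2, k1.trans a2 fun z hz => e2 z hz.1 hz.2, ?_, rfl⟩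
  apply Subset.antisymm
  · rintro z ⟨h1 | h1, h2 | h2⟩
    · obtain ⟨s, hs, rfl⟩ := h1
      rcases KL0 h2 (zero_mem _) (by ring) with h | h
      · exact Or.inl h
      · exact (ff hd (s := s) (t := 3) (m := 0) (by push_cast; linear_combination h)).elim
    · obtain ⟨s, hs, rfl⟩ := h1
      rw [mem_sh] at h2
      obtain ⟨t, ht, h⟩ := h2
      exact (ff hd (s := s) (t := t) (m := 0) (by push_cast; linear_combination -h)).elim
    · rw [mem_sh] at h1
      exact (w0 hd (H.KK 0 0 z H.w h2 H.hw h1).2).elim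
    · rw [mem_sh] at h1 h2
      obtain ⟨s, hs, h⟩ := h2
      rcases KL0 h1 (sub_mem (H.hu 0) H.hw) (show _ = H.f s + (H.u 0 - H.w) by rw [h]; ring) with h' | h'
      · exact (ff hd (s := 0) (t := s) (m := -1) (by push_cast; linear_combination -h' - h)).elim
      · right; rw [mem_singleton_iff, ← f9]; linear_combination h'
  · rintro _ (rfl | rfl)
    · exact ⟨Or.inl a1.left_mem, Or.inl k1.left_mem⟩
    · exact ⟨Or.inr k2.right_mem, Or.inr a2.right_mem⟩

theorem perZ (H : Hex) (s : ℝ) (n : ℤ) : H.f (s + 6 * n) = H.f s + n * H.w := by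
  induction n using Int.induction_on with
  | zero => simp
  | succ i ih => rw [show s + 6 * ((i : ℤ) + 1 : ℤ) = s + 6 * (i : ℤ) + 6 by push_cast; ring, H.per, ih]; push_cast; ring
  | pred i ih =>
    have := H.per (s + 6 * (-(i : ℤ) - 1 : ℤ))
    rw [show s + 6 * ((-(i : ℤ) - 1 : ℤ) : ℝ) + 6 = s + 6 * (-(i : ℤ) : ℤ) by push_cast; ring, ih] at this
    push_cast at this ⊢; linear_combination -this

theorem unbdd (hd : H.Ind) (s : ℝ) (k : ℂ) (e : ℤ) (he : e ≠ 0) {S : Set ℂ} (hS : ∀ n : ℕ, H.f (s + 6 * (e * n : ℤ)) + k ∈ S) : ¬ Bornology.IsBounded S := by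
  intro hb
  obtain ⟨R, hR⟩ := isBounded_iff_forall_norm_le.1 hb
  have hw : 0 < ‖H.w‖ := norm_pos_iff.2 (w0 hd)
  obtain ⟨n, hn⟩ := exists_nat_gt ((R + ‖H.f s + k‖) / ‖H.w‖)
  rw [div_lt_iff₀ hw] at hn
  have h1 := hR _ (hS n)
  rw [H.perZ] at h1
  have h2 : ‖((e * n : ℤ) : ℂ) * H.w‖ ≤ R + ‖H.f s + k‖ := by
    calc _ = ‖(H.f s + (e * n : ℤ) * H.w + k) - (H.f s + k)‖ := by congr 1; ring
      _ ≤ _ := (norm_sub_le _ _).trans (by linarith)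
  rw [norm_mul, Complex.norm_intCast] at h2
  have h3 : (n : ℝ) ≤ |((e * n : ℤ) : ℝ)| := by
    push_cast; rw [abs_mul, abs_of_nonneg (by positivity : (0 : ℝ) ≤ n)]
    have : (1 : ℝ) ≤ |(e : ℝ)| := by exact_mod_cast Int.one_le_abs he
    nlinarith [(by positivity : (0 : ℝ) ≤ n)]
  nlinarith

/-- lines are never inside -/
theorem f_nins (hd : H.Ind) {s k} (hk : k ∈ Lam) : H.f s + k ∉ ins H.Q := by
  intro hi
  have hn : H.f s + k ∉ H.Q := ins_nmem hi
  have key : ∀ I : Set ℝ, IsPreconnected I → s ∈ I → (∀ t ∈ I, H.f t + k ∉ H.Q) → (∃ e : ℤ, e ≠ 0 ∧ ∀ n : ℕ, s + 6 * (e * n : ℤ) ∈ I) → False := by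
    intro I hI hs h ⟨e, he, hen⟩
    refine ins_nout hi (subset_out_of_unbdd (S := (fun t => H.f t + k) '' I) (hI.image _ (H.cont.add continuous_const).continuousOn) ?_
      (unbdd hd s k e he fun n => ⟨_, hen n, rfl⟩) ⟨s, hs, rfl⟩)
    rw [Set.disjoint_left]; rintro _ ⟨t, ht, rfl⟩; exact h t ht
  have conv : ∀ t1 t2, t1 ≤ s → s ≤ t2 → H.f t1 + k ∈ H.Q → H.f t2 + k ∈ H.Q → False := by
    intro t1 t2 h1 h2 q1 q2
    apply hn
    have m1 : ∀ n : ℤ, k = n * H.w → s + 6 * n ∈ Icc (0 : ℝ) 6 → H.f s + k ∈ H.Q := fun n e h => by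
      subst e; exact Or.inl (Or.inl ⟨_, h, H.perZ s n⟩)
    have m2 : ∀ n : ℤ, k = H.u 0 + n * H.w → s + 6 * n ∈ Icc (3 : ℝ) 9 → H.f s + k ∈ H.Q := fun n e h => by
      subst e; exact Or.inr (Or.inr (mem_sh.2 ⟨_, h, by rw [H.perZ s n]; ring⟩))
    rcases fQ hk q1 with ⟨n, e, h⟩ | ⟨n, e, h⟩ <;> rcases fQ hk q2 with ⟨n', e', h'⟩ | ⟨n', e', h'⟩
    · have := (ind hd (n - n') 0 (by push_cast; linear_combination e' - e)).1
      obtain rfl : n = n' := by omega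
      exact m1 n e ⟨by linarith [h.1], by linarith [h'.2]⟩
    · exact absurd (by push_cast; linear_combination e - e') (nu hd (n - n'))
    · exact absurd (by push_cast; linear_combination e' - e) (nu hd (n' - n))
    · have := (ind hd (n - n') 0 (by push_cast; linear_combination e' - e)).1
      obtain rfl : n = n' := by omega
      exact m2 n e ⟨by linarith [h.1], by linarith [h'.2]⟩
  by_cases h : ∃ t ≤ s, H.f t + k ∈ H.Q
  · obtain ⟨t1, h1, h1'⟩ := h
    refine key (Ici s) isPreconnected_Ici self_mem_Ici (fun t ht h2 => conv t1 t h1 ht h1' h2) ⟨1, by simp, fun n => ?_⟩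
    rw [mem_Ici]; push_cast; linarith [(by positivity : (0 : ℝ) ≤ n)]
  · push Not at h
    refine key (Iic s) isPreconnected_Iic self_mem_Iic h ⟨-1, by simp, fun n => ?_⟩
    rw [mem_Iic]; push_cast; linarith [(by positivity : (0 : ℝ) ≤ n)]
end Hex
end

section
open Set Filter Topology

namespace Hex
variable {H : Hex}

theorem K_ins (hd : H.Ind) {c z k} (hz : z ∈ H.K c) (hk : k ∈ Lam) (hi : z + k ∈ ins H.Q) :
    Crosscut H.Q (sh k (H.K c)) (H.f c.val + k) (H.f (c.val + 3) + H.u c + k) := by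
  have ar := (H.arc c).sh k
  obtain ⟨h1, h2, -⟩ := ar.diff_eq
  have e1 : H.f c.val + k ∉ ins H.Q := f_nins hd hk
  have e2 : H.f (c.val + 3) + H.u c + k ∉ ins H.Q := by rw [add_assoc]; exact f_nins hd (add_mem (H.hu c) hk)
  have dj : Disjoint (sh k (H.K c) \ {H.f c.val + k, H.f (c.val + 3) + H.u c + k}) H.Q := by
    rw [Set.disjoint_left]
    rintro _ ⟨⟨y, hy, rfl⟩, hne⟩ hQ
    rcases KQ hy hk hQ with (rfl | rfl) | ⟨rfl, rfl | rfl⟩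
    · exact hne (Or.inl rfl)
    · exact hne (Or.inr rfl)
    · exact ins_nmem hi (Or.inr (Or.inl (by simpa using hz)))
    · exact ins_nmem hi (Or.inl (Or.inr (mem_sh.2 (by simpa using hz))))
  have hs : sh k (H.K c) \ {H.f c.val + k, H.f (c.val + 3) + H.u c + k} ⊆ ins H.Q := by
    refine subset_ins h1 dj (x := z + k) ⟨⟨z, hz, rfl⟩, ?_⟩ hi
    rintro (h | h)
    · exact e1 (h ▸ hi)
    · exact e2 (h ▸ hi)
  have hc := h2.trans ((closure_mono hs).trans (closure_ins (jor hd).closed))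
  exact ⟨ar, (hc ar.left_mem).resolve_left e1, (hc ar.right_mem).resolve_left e2, hs⟩

theorem K_pat (hd : H.Ind) {c k} (hk : k ∈ Lam) (h : Crosscut H.Q (sh k (H.K c)) (H.f c.val + k) (H.f (c.val + 3) + H.u c + k)) :
    c ≠ 0 ∧ (k = 0 ∨ k = H.u 0 + H.w) ∧ (H.u c = -k ∨ H.u c = H.u 0 - k) := by
  obtain ⟨ar, q1, q2, hs⟩ := h
  have q1 := fQ hk q1
  rw [add_assoc] at q2
  have q2 := fQ (add_mem (H.hu c) hk) q2
  by_cases c0 : c = 0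
  · subst c0
    exfalso
    obtain ⟨-, -, x, hx⟩ := ar.diff_eq
    have hi := ins_nmem (hs hx)
    simp at q1 q2
    rcases q1 with ⟨n, e, h⟩ | ⟨n, e, h⟩
    · have h1 : (0 : ℤ) ≤ n := by exact h.1
      have h2 : n ≤ (1 : ℤ) := by exact_mod_cast h.2
      obtain rfl | rfl : n = 0 ∨ n = 1 := by omega
      · simp at e; subst e; exact hi (Or.inr (Or.inl (by simpa [sh] using hx.1)))
      · simp at e; subst e; exact hi (Or.inl (Or.inr hx.1))
    · rcases q2 with ⟨m, e', -⟩ | ⟨m, e', -⟩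
      · have := (ind hd (m - n) (-2) (by push_cast; linear_combination e - e')).2; omega
      · have := (ind hd (m - n) (-1) (by push_cast; linear_combination e - e')).2; omega
  · have hc : (1 : ℝ) ≤ c.val ∧ (c.val : ℝ) ≤ 2 := ⟨by
      have : c.val ≠ 0 := fun h => c0 (Fin.ext h)
      exact_mod_cast Nat.one_le_iff_ne_zero.2 this, by exact_mod_cast Nat.le_of_lt_succ c.isLt⟩
    refine ⟨c0, ?_, ?_⟩
    · rcases q1 with ⟨n, e, h⟩ | ⟨n, e, h⟩
      · obtain rfl : n = 0 := int_zero (by linarith [h.1]) (by linarith [h.2])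
        left; simpa using e
      · obtain h2 : n - 1 = 0 := int_zero (by push_cast; linarith [h.1]) (by push_cast; linarith [h.2])
        obtain rfl : n = 1 := by omega
        right; simpa using e
    · rcases q2 with ⟨n, e, h⟩ | ⟨n, e, h⟩
      · obtain rfl : n = 0 := int_zero (by linarith [h.1]) (by linarith [h.2])
        left; push_cast at e; linear_combination e
      · obtain rfl : n = 0 := int_zero (by linarith [h.1]) (by linarith [h.2])
        right; push_cast at e; linear_combination e

theorem tr_nins (hd : H.Ind) {x k} (hx : x ∈ H.Q) (hk : k ∈ Lam) : x + k ∉ ins H.Q := by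
  intro hi
  have kk : ∀ y k', y ∈ H.K 0 → k' ∈ Lam → y + k' ∉ ins H.Q := fun y k' hy hk' hi =>
    (K_pat hd hk' (K_ins hd hy hk' hi)).1 rfl
  rcases hx with (⟨t, ht, rfl⟩ | ⟨y, hy, rfl⟩) | (h | ⟨_, ⟨t, ht, rfl⟩, rfl⟩)
  · exact f_nins hd hk hi
  · beta_reduce at hi; rw [add_assoc] at hi; exact kk _ _ hy (add_mem H.hw hk) hi
  · exact kk _ _ h hk hi
  · beta_reduce at hi; rw [add_assoc] at hi; exact f_nins hd (add_mem (H.hu 0) hk) hi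

theorem ins_disj (hd : H.Ind) {x k} (hx : x ∈ ins H.Q) (hk : k ∈ Lam) (h0 : k ≠ 0) : x + k ∉ ins H.Q := by
  intro hi
  have sub : sh k (ins H.Q) ⊆ ins H.Q := by
    refine subset_ins (x := x + k) ((jor hd).ins_conn.image _ (by fun_prop)) ?_ ⟨x, hx, rfl⟩ hi
    rw [Set.disjoint_left]
    intro y hy hQ
    exact tr_nins hd hQ (neg_mem hk) (by rw [mem_sh] at hy; exact hy)
  have it : ∀ n : ℕ, x + n * k ∈ ins H.Q := fun n => by
    induction n with
    | zero => simpa using hx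
    | succ n ih => have := sub ⟨_, ih, rfl⟩; push_cast; convert this using 1; ring
  obtain ⟨R, hR⟩ := isBounded_iff_forall_norm_le.1 (ins_bounded (jor hd).compact)
  have hk0 : 0 < ‖k‖ := norm_pos_iff.2 h0
  obtain ⟨n, hn⟩ := exists_nat_gt ((R + ‖x‖) / ‖k‖)
  rw [div_lt_iff₀ hk0] at hn
  have h2 : ‖(n : ℂ) * k‖ ≤ R + ‖x‖ := by
    calc _ = ‖(x + n * k) - x‖ := by congr 1; ring
      _ ≤ _ := (norm_sub_le _ _).trans (by linarith [hR _ (it n)])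
  rw [norm_mul, Complex.norm_natCast] at h2
  linarith

theorem near (hd : H.Ind) {x k} (hk : k ∈ Lam) (h0 : k ≠ 0) (hx : x ∈ H.Q) (hx' : x - k ∈ H.Q) {R : Set ℂ} (hR : IsClosed R)
    (hxR : x ∉ R) (sub : ∀ y ∈ H.Q, y + k ∈ H.Q ∨ y + k ∈ R) : ∃ U ∈ 𝓝 x, ∀ z ∈ U, z ∈ disk H.Q ∨ z - k ∈ disk H.Q := by
  have hj := jor hd
  obtain ⟨ε, hε, hb⟩ := Metric.isOpen_iff.1 hR.isOpen_compl x hxR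
  obtain ⟨δ, hδ, -, hδ'⟩ := Split.ulc hj hx hε
  obtain ⟨y, hy, hyx⟩ := Metric.mem_closure_iff.1 (hj.mem_closure_both hx').1 δ hδ
  have yb : y + k ∈ Metric.ball x δ := by
    rw [Metric.mem_ball, dist_comm, show dist x (y + k) = dist (x - k) y by rw [dist_eq_norm, dist_eq_norm]; congr 1; ring]; exact hyx
  have yo : y + k ∈ out H.Q := by
    rcases trich (C := H.Q) (y + k) with h | h | h
    · exact absurd hy (by have := tr_nins hd h (neg_mem hk); rwa [add_neg_cancel_right] at this)
    · exact absurd h (ins_disj hd hy hk h0)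
    · exact h
  refine ⟨_, Metric.ball_mem_nhds x hδ, fun z hz => ?_⟩
  rcases trich (C := H.Q) z with h | h | h
  · exact Or.inl (Or.inr h)
  · exact Or.inl (Or.inl h)
  · obtain ⟨S, Sc, -, Sb, Sd, zS, yS⟩ := hδ' z hz _ yb (NS.of_out hj.compact h yo)
    refine Or.inr (Or.inl (subset_ins (S := sh (-k) S) (x := y) (Sc.image _ (by fun_prop)) ?_ ⟨_, yS, by ring⟩ hy ⟨_, zS, by ring⟩))
    rw [Set.disjoint_left]
    intro a ha haQ
    rw [mem_sh, sub_neg_eq_add] at ha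
    rcases sub a haQ with h | h
    · exact Set.disjoint_left.1 Sd ha h
    · exact hb (Sb ha) h

theorem cover (hd : H.Ind) (z : ℂ) : ∃ k ∈ Lam, z - k ∈ disk H.Q := by
  have hj := jor hd
  set W : Set ℂ := {z | ∃ k ∈ Lam, z - k ∈ disk H.Q} with hW
  have mW : ∀ z, z ∈ W ↔ ∃ k ∈ Lam, z - k ∈ disk H.Q := fun z => Iff.rfl
  have Wc : IsClosed W := by
    have : W = pj ⁻¹' (pj '' disk H.Q) := by
      ext z; rw [mW]; constructor
      · rintro ⟨k, hk, h⟩; exact ⟨_, h, pj_eq.2 (lam_of (neg_mem hk) (by ring))⟩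
      · rintro ⟨y, hy, e⟩; exact ⟨z - y, pj_eq.1 e.symm, by simpa using hy⟩
    rw [this]
    exact (hj.disk_compact.image pj_cont).isClosed.preimage pj_cont
  have inv : ∀ x k, k ∈ Lam → W ∈ 𝓝 x → W ∈ 𝓝 (x + k) := by
    intro x k hk h
    have : (fun z => z - k) ⁻¹' W ∈ 𝓝 (x + k) := (by fun_prop : ContinuousAt (fun z : ℂ => z - k) (x + k)).preimage_mem_nhds (by simpa using h)
    filter_upwards [this] with z hz
    obtain ⟨k', hk', h⟩ := (mW _).1 hz
    exact ⟨k + k', add_mem hk hk', by rwa [← sub_sub]⟩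
  have toW : ∀ {x k}, k ∈ Lam → (∃ U ∈ 𝓝 x, ∀ z ∈ U, z ∈ disk H.Q ∨ z - k ∈ disk H.Q) → W ∈ 𝓝 x := by
    rintro x k hk ⟨U, hU, h⟩
    filter_upwards [hU] with z hz
    rcases h z hz with h | h
    · exact ⟨0, zero_mem _, by simpa using h⟩
    · exact ⟨k, hk, h⟩
  have cf : ∀ a b : ℝ, ∀ k, IsClosed (sh k (H.f '' Icc a b)) := fun a b k => ((isCompact_Icc.image H.cont).image (by fun_prop : Continuous fun z : ℂ => z + k)).isClosed
  have ck : ∀ k, IsClosed (sh k (H.K 0)) := fun k => (H.arc0.sh k).closed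
  have uw : H.u 0 + H.w ∈ Lam := add_mem (H.hu 0) H.hw
  have u0 : H.u 0 ≠ 0 := fun h => nu hd 0 (by simpa using h)
  have uw0 : H.u 0 + H.w ≠ 0 := fun h => nu hd (-1) (by push_cast; linear_combination h)
  have ww := w0 hd
  have fi := finj hd
  have per' : ∀ t, H.f t - H.w = H.f (t - 6) := fun t => by have := H.per (t - 6); rw [sub_add_cancel] at this; rw [this]; ring
  have fnK : ∀ t k, k ∈ Lam → t ∈ Ioo (0 : ℝ) 6 → t ≠ 3 → H.f t ∉ sh k (H.K 0) := by
    intro t k hk ht h3 h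
    rw [mem_sh] at h
    rcases KL0 h (neg_mem hk) (by ring) with h | h
    · obtain ⟨n, -, e⟩ := H.inj 0 t k hk (by linear_combination -h)
      have h1 : (0 : ℤ) < n := by exact_mod_cast (by linarith [ht.1] : (0 : ℝ) < n)
      have h2 : n < (1 : ℤ) := by exact_mod_cast (by linarith [ht.2] : (n : ℝ) < 1)
      omega
    · obtain ⟨n, -, e⟩ := H.inj 3 t (k + H.u 0) (add_mem hk (H.hu 0)) (by linear_combination -h)
      have : n = 0 := int_zero (by linarith [ht.1]) (by linarith [ht.2])
      subst this; apply h3; simpa using e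
  have A : ∀ t ∈ Ioo (0 : ℝ) 6, t ≠ 3 → W ∈ 𝓝 (H.f t) := by
    intro t ht h3
    have hQ : H.f t ∈ H.Q := Or.inl (Or.inl ⟨t, ⟨ht.1.le, ht.2.le⟩, rfl⟩)
    rcases lt_or_gt_of_ne h3 with h3' | h3'
    · refine toW (neg_mem uw) (near hd (neg_mem uw) (neg_ne_zero.2 uw0) hQ ?_ (R := sh (-(H.u 0 + H.w)) (H.f '' Icc 0 6) ∪ sh (-H.u 0) (H.K 0) ∪ sh (-(H.u 0 + H.w)) (H.K 0) ∪ sh 0 (H.f '' Icc (-3) 0)) (((cf _ _ _).union (ck _)).union (ck _) |>.union (cf _ _ _)) ?_ ?_)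
      · exact Or.inr (Or.inr (mem_sh.2 ⟨t + 6, ⟨by linarith [ht.1], by linarith⟩, by rw [H.per]; ring⟩))
      · rintro (((h | h) | h) | h)
        · obtain ⟨s, hs, e⟩ := mem_sh.1 h
          exact ff hd (s := s) (t := t) (m := 1) (by push_cast; linear_combination e)
        · exact fnK t _ (neg_mem (H.hu 0)) ht h3 h
        · exact fnK t _ (neg_mem uw) ht h3 h
        · obtain ⟨s, hs, e⟩ := mem_sh.1 h
          rw [fi (e.trans (sub_zero _))] at hs; linarith [hs.2, ht.1]
      · rintro y ((h | h) | (h | h))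
        · exact Or.inr (Or.inl (Or.inl (Or.inl ⟨y, h, rfl⟩)))
        · rw [mem_sh] at h; exact Or.inr (Or.inl (Or.inl (Or.inr (mem_sh.2 (by convert h using 1; ring)))))
        · exact Or.inr (Or.inl (Or.inr ⟨y, h, rfl⟩))
        · obtain ⟨s, hs, e⟩ := mem_sh.1 h
          rw [show y + -(H.u 0 + H.w) = H.f (s - 6) by rw [← per', e]; ring]
          rcases le_total 0 (s - 6) with h6 | h6
          · exact Or.inl (Or.inl (Or.inl ⟨_, ⟨h6, by linarith [hs.2]⟩, rfl⟩))
          · exact Or.inr (Or.inr ⟨_, ⟨_, ⟨by linarith [hs.1], h6⟩, rfl⟩, by simp⟩)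
    · refine toW (neg_mem (H.hu 0)) (near hd (neg_mem (H.hu 0)) (neg_ne_zero.2 u0) hQ ?_ (R := sh (-H.u 0) (H.f '' Icc 0 6) ∪ sh (H.w - H.u 0) (H.K 0) ∪ sh (-H.u 0) (H.K 0) ∪ sh 0 (H.f '' Icc 6 9)) (((cf _ _ _).union (ck _)).union (ck _) |>.union (cf _ _ _)) ?_ ?_)
      · exact Or.inr (Or.inr (mem_sh.2 ⟨t, ⟨h3'.le, by linarith [ht.2]⟩, by ring⟩))
      · rintro (((h | h) | h) | h)
        · obtain ⟨s, hs, e⟩ := mem_sh.1 h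
          exact ff hd (s := s) (t := t) (m := 0) (by push_cast; linear_combination e)
        · exact fnK t _ (sub_mem H.hw (H.hu 0)) ht h3 h
        · exact fnK t _ (neg_mem (H.hu 0)) ht h3 h
        · obtain ⟨s, hs, e⟩ := mem_sh.1 h
          rw [fi (e.trans (sub_zero _))] at hs; linarith [hs.1, ht.2]
      · rintro y ((h | h) | (h | h))
        · exact Or.inr (Or.inl (Or.inl (Or.inl ⟨y, h, rfl⟩)))
        · rw [mem_sh] at h; exact Or.inr (Or.inl (Or.inl (Or.inr (mem_sh.2 (by convert h using 1; ring)))))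
        · exact Or.inr (Or.inl (Or.inr ⟨y, h, rfl⟩))
        · obtain ⟨s, hs, e⟩ := mem_sh.1 h
          rw [show y + -H.u 0 = H.f s by rw [e]; ring]
          rcases le_total s 6 with h6 | h6
          · exact Or.inl (Or.inl (Or.inl ⟨_, ⟨by linarith [hs.1], h6⟩, rfl⟩))
          · exact Or.inr (Or.inr ⟨_, ⟨_, ⟨h6, hs.2⟩, rfl⟩, by simp⟩)
  have B : ∀ x ∈ H.K 0, x ≠ H.f 0 → x ≠ H.f 3 + H.u 0 → W ∈ 𝓝 x := by
    intro x hx n0 n3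
    refine toW (neg_mem H.hw) (near hd (neg_mem H.hw) (neg_ne_zero.2 ww) (Or.inr (Or.inl hx)) ?_ (R := sh (-H.w) (H.f '' Icc 0 6) ∪ sh (-H.w) (H.K 0) ∪ sh (H.u 0 - H.w) (H.f '' Icc 3 9)) (((cf _ _ _).union (ck _)).union (cf _ _ _)) ?_ ?_)
    · exact Or.inl (Or.inr (mem_sh.2 (by simpa using hx)))
    · have nf : ∀ s k, k ∈ Lam → x ≠ H.f s + k := fun s k hk e => (KL0 hx hk e).elim n0 n3
      rintro ((h | h) | h)
      · obtain ⟨s, hs, e⟩ := mem_sh.1 h; exact nf s _ (neg_mem H.hw) (by rw [e]; ring)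
      · exact neg_ne_zero.2 ww (H.KK 0 0 x _ hx (neg_mem H.hw) (mem_sh.1 h)).2
      · obtain ⟨s, hs, e⟩ := mem_sh.1 h; exact nf s _ (sub_mem (H.hu 0) H.hw) (by rw [e]; ring)
    · rintro y ((h | h) | (h | h))
      · exact Or.inr (Or.inl (Or.inl ⟨y, h, rfl⟩))
      · rw [mem_sh] at h; exact Or.inl (Or.inr (Or.inl (by convert h using 1; ring)))
      · exact Or.inr (Or.inl (Or.inr ⟨y, h, rfl⟩))
      · rw [mem_sh] at h; exact Or.inr (Or.inr (mem_sh.2 (by convert h using 1; ring)))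
  set V : Set ℂ := {z | z - H.f 0 ∈ Lam ∨ z - H.f 3 ∈ Lam} with hV
  have C : ∀ t k, k ∈ Lam → H.f t + k ∈ Vᶜ → W ∈ 𝓝 (H.f t + k) := by
    intro t k hk hn
    obtain ⟨n, s, hs, rfl⟩ : ∃ n : ℤ, ∃ s ∈ Ico (0 : ℝ) 6, t = s + 6 * n := by
      refine ⟨⌊t / 6⌋, t - 6 * ⌊t / 6⌋, ⟨by linarith [Int.floor_le (t / 6)], by linarith [Int.lt_floor_add_one (t / 6)]⟩, by ring⟩
    rw [H.perZ, add_assoc] at hn ⊢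
    have hl := add_mem (lam_z H.hw n) hk
    refine inv _ _ hl (A s ⟨lt_of_le_of_ne hs.1 ?_, hs.2⟩ ?_)
    · rintro rfl; exact hn (Or.inl (by simpa using hl))
    · rintro rfl; exact hn (Or.inr (by simpa using hl))
  have D : ∀ y ∈ H.K 0, ∀ k ∈ Lam, y + k ∈ Vᶜ → W ∈ 𝓝 (y + k) := by
    intro y hy k hk hn
    refine inv _ _ hk (B y hy ?_ ?_)
    · rintro rfl; exact hn (Or.inl (by simpa using hk))
    · rintro rfl; exact hn (Or.inr (lam_of (add_mem (H.hu 0) hk) (by ring)))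
  have E : Vᶜ ⊆ interior W ∪ Wᶜ := by
    intro z hz
    by_cases h : z ∈ W
    · left
      rw [mem_interior_iff_mem_nhds]
      obtain ⟨k, hk, h⟩ := h
      rw [← sub_add_cancel z k] at hz ⊢
      rcases h with h | ((h | h) | (h | h))
      · exact inv _ _ hk (mem_of_superset ((ins_open hj.closed).mem_nhds h) fun y hy => ⟨0, zero_mem _, Or.inl (by simpa using hy)⟩)
      · obtain ⟨t, -, e⟩ := h; rw [← e] at hz ⊢; exact C t k hk hz
      · obtain ⟨y, hy, e⟩ := h; rw [← e] at hz ⊢; beta_reduce at hz ⊢; rw [add_assoc] at hz ⊢; exact D y hy _ (add_mem H.hw hk) hz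
      · exact D _ h k hk hz
      · obtain ⟨_, ⟨t, -, rfl⟩, e⟩ := h; rw [← e] at hz ⊢; beta_reduce at hz ⊢; rw [add_assoc] at hz ⊢; exact C t _ (add_mem (H.hu 0) hk) hz
    · exact Or.inr h
  have Vc : V.Countable := by
    have : V ⊆ range (fun p : (ℤ × ℤ) × Bool => (p.1.1 + p.1.2 * Complex.I + (if p.2 then H.f 0 else H.f 3) : ℂ)) := by
      rintro z (⟨m, n, h⟩ | ⟨m, n, h⟩)
      · exact ⟨((m, n), true), by simp only [if_true]; linear_combination -h⟩
      · exact ⟨((m, n), false), by simp only [Bool.false_eq_true, if_false]; linear_combination -h⟩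
    exact (countable_range _).mono this
  have Vconn := (Vc.isConnected_compl_of_one_lt_rank (E := ℂ) (by rw [Complex.rank_real_complex]; norm_num)).isPreconnected
  obtain ⟨p, hp⟩ := hj.ins_nonempty
  have hiW : ins H.Q ⊆ interior W := interior_maximal (fun y hy => ⟨0, zero_mem _, Or.inl (by simpa using hy)⟩) (ins_open hj.closed)
  have pV : p ∈ Vᶜ := by
    rintro (h | h)
    · exact f_nins hd h (s := 0) (by simpa using hp)
    · exact f_nins hd h (s := 3) (by simpa using hp)
  have F : Vᶜ ⊆ interior W := Vconn.subset_left_of_subset_union isOpen_interior Wc.isOpen_compl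
    (disjoint_compl_right.mono_left interior_subset) E ⟨p, pV, hiW hp⟩
  have : closure Vᶜ ⊆ W := (closure_mono (F.trans interior_subset)).trans Wc.closure_subset
  rw [(Vc.dense_compl ℝ).closure_eq] at this
  exact this (mem_univ z)
end Hex
end

section
open Set Filter Topology

namespace Hex
variable {H : Hex}

theorem chord (hd : H.Ind) {c} (c0 : c ≠ 0) : ∃ k ∈ Lam, Crosscut H.Q (sh k (H.K c)) (H.f c.val + k) (H.f (c.val + 3) + H.u c + k) ∧
    (k = 0 ∨ k = H.u 0 + H.w) ∧ (H.u c = -k ∨ H.u c = H.u 0 - k) := by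
  obtain ⟨-, -, z, hz, hn⟩ := (H.arc c).diff_eq
  obtain ⟨k, hk, h⟩ := cover hd z
  have hi : z + -k ∈ ins H.Q := h.resolve_right fun h => by
    rcases KQ hz (neg_mem hk) (by rwa [← sub_eq_add_neg]) with h | h
    · exact hn h
    · exact c0 h.1
  have := K_ins hd hz (neg_mem hk) hi
  exact ⟨-k, neg_mem hk, this, (K_pat hd (neg_mem hk) this).2⟩

theorem no00 (hd : H.Ind) (h1 : H.u 1 = 0) (h2 : H.u 2 = 0) : False := by
  have key : ∀ c : Fin 3, c ≠ 0 → H.u c = 0 → Crosscut H.Q (H.K c) (H.f c.val) (H.f (c.val + 3)) := by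
    intro c c0 hc
    obtain ⟨k, hk, h, h1, h2⟩ := chord hd c0
    have : k = 0 := by
      rw [hc] at h2
      rcases h1 with rfl | rfl
      · rfl
      · rcases h2 with h2 | h2
        · exact (nu hd (-1) (by push_cast; linear_combination h2)).elim
        · exact (w0 hd (by linear_combination h2)).elim
    subst this
    simpa [hc, sh] using h
  have k1 := key 1 (by decide) h1
  have k2 := key 2 (by decide) h2
  have fi := finj hd
  have c1 : (((1 : Fin 3).val : ℕ) : ℝ) = 1 := by simp
  have c2 : (((2 : Fin 3).val : ℕ) : ℝ) = 2 := by simp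
  rw [c1] at k1; rw [c2] at k2; norm_num at k1 k2
  have fn : ∀ {s t : ℝ}, s ≠ t → H.f s ≠ H.f t := fun h e => h (fi e)
  obtain ⟨X, Y, hs⟩ := (jor hd).split k1.2.1 k1.2.2.1 (fn (by norm_num))
  have cf : ∀ I : Set ℝ, IsPreconnected I → IsPreconnected (H.f '' I) := fun I h => h.image _ H.cont.continuousOn
  set M : Set ℂ := sh H.w (H.K 0) ∪ (H.K 0 ∪ sh (H.u 0) (H.f '' Icc 3 9))
  have K0 := H.arc0
  have Mc : IsPreconnected M := by
    refine IsPreconnected.union (H.f 9 + H.u 0) ?_ (Or.inr (mem_sh.2 ⟨9, by norm_num, by ring⟩)) (K0.sh H.w).conn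
      (IsPreconnected.union (H.f 3 + H.u 0) K0.right_mem (mem_sh.2 ⟨3, by norm_num, by ring⟩) K0.conn ((cf _ isPreconnected_Icc).image _ (by fun_prop)))
    rw [← f9]; exact ⟨_, K0.right_mem, by ring⟩
  have Tc : IsPreconnected (H.f '' Ioc 4 6 ∪ (M ∪ H.f '' Ico 0 1)) :=
    IsPreconnected.union (H.f 6) ⟨6, by norm_num, rfl⟩ (Or.inl (Or.inl ⟨_, K0.left_mem, f6⟩)) (cf _ isPreconnected_Ioc)
      (IsPreconnected.union (H.f 0) (Or.inr (Or.inl K0.left_mem)) ⟨0, by norm_num, rfl⟩ Mc (cf _ isPreconnected_Ico))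
  have nM : ∀ t ∈ Ioo (0 : ℝ) 6, H.f t ∉ M := by
    intro t ht
    have n0 : H.f t ≠ H.f 0 := fn ht.1.ne'
    rintro (h | h | h)
    · rw [mem_sh] at h
      rcases KL0 h (neg_mem H.hw) (by ring) with h | h
      · exact fn ht.2.ne (by rw [← f6]; linear_combination h)
      · exact ff hd (s := t) (t := 3) (m := 1) (by push_cast; linear_combination h)
    · rcases KL0 h (zero_mem _) (by ring) with h | h
      · exact n0 h
      · exact ff hd (s := t) (t := 3) (m := 0) (by push_cast; linear_combination h)
    · obtain ⟨s, -, e⟩ := mem_sh.1 h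
      exact ff hd (s := t) (t := s) (m := 0) (by push_cast; linear_combination -e)
  have QM : H.Q = H.f '' Icc 0 6 ∪ M := by simp only [Q, M, union_assoc]
  have Td : H.f '' Ioc 4 6 ∪ (M ∪ H.f '' Ico 0 1) ⊆ H.Q \ {H.f 1, H.f 4} := by
    rw [QM]
    rintro _ (⟨t, ht, rfl⟩ | h | ⟨t, ht, rfl⟩)
    · exact ⟨Or.inl ⟨t, ⟨by linarith [ht.1], ht.2⟩, rfl⟩, by rintro (h | h); exacts [fn (by linarith [ht.1]) h, fn (by linarith [ht.1]) h]⟩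
    · exact ⟨Or.inr h, by rintro (rfl | rfl); exacts [nM _ (by norm_num) h, nM _ (by norm_num) h]⟩
    · exact ⟨Or.inl ⟨t, ⟨ht.1, by linarith [ht.2]⟩, rfl⟩, by rintro (h | h); exacts [fn (by linarith [ht.2]) h, fn (by linarith [ht.2]) h]⟩
  have Sd : H.f '' Ioo 1 4 ⊆ H.Q \ {H.f 1, H.f 4} := by
    rintro _ ⟨t, ht, rfl⟩
    exact ⟨Or.inl (Or.inl ⟨t, ⟨by linarith [ht.1], by linarith [ht.2]⟩, rfl⟩), by rintro (h | h); exacts [fn (by linarith [ht.1]) h, fn (by linarith [ht.2]) h]⟩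
  have un : ∀ x ∈ H.Q, x ∉ ({H.f 1, H.f 4} : Set ℂ) → x ∈ H.f '' Ioo 1 4 ∨ x ∈ H.f '' Ioc 4 6 ∪ (M ∪ H.f '' Ico 0 1) := by
    intro x hx hn
    rw [QM] at hx
    rcases hx with ⟨t, ht, rfl⟩ | h
    · have n1 : t ≠ 1 := by rintro rfl; exact hn (Or.inl rfl)
      have n4 : t ≠ 4 := by rintro rfl; exact hn (Or.inr rfl)
      rcases lt_or_gt_of_ne n1 with h | h
      · exact Or.inr (Or.inr (Or.inr ⟨t, ⟨ht.1, h⟩, rfl⟩))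
      · rcases lt_or_gt_of_ne n4 with h' | h'
        · exact Or.inl ⟨t, ⟨h, h'⟩, rfl⟩
        · exact Or.inr (Or.inl ⟨t, ⟨h', ht.2⟩, rfl⟩)
    · exact Or.inr (Or.inr (Or.inl h))
  have m2 : H.f 2 ∈ H.f '' Ioo 1 4 := ⟨2, by norm_num, rfl⟩
  have m5 : H.f 5 ∈ H.f '' Ioc 4 6 ∪ (M ∪ H.f '' Ico 0 1) := Or.inl ⟨5, by norm_num, rfl⟩
  have il : ∀ X Y, Split H.Q (H.f 1) (H.f 4) X Y → H.f 2 ∈ X → H.f 5 ∈ Y → False := by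
    intro X Y hs h2 h5
    obtain ⟨z, hz, hz'⟩ := interlace hs k1 k2 h2 h5 (by
      rw [eq_empty_iff_forall_notMem]
      rintro x ⟨rfl | rfl, h | h⟩
      exacts [fn (by norm_num) h, fn (by norm_num) h, fn (by norm_num) h, fn (by norm_num) h])
    exact absurd (H.KK 1 2 z 0 hz (zero_mem _) (by simpa using hz')).1 (by decide)
  have ne : ∀ X Y, Split H.Q (H.f 1) (H.f 4) X Y → H.f '' Ioo 1 4 ⊆ X → H.f '' Ioc 4 6 ∪ (M ∪ H.f '' Ico 0 1) ⊆ X → False := by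
    intro X Y hs a b
    obtain ⟨-, -, x, hx, hn⟩ := hs.2.1.diff_eq
    have hX : x ∈ X := (un x (hs.2.2.2 ▸ Or.inr hx) hn).elim (fun h => a h) fun h => b h
    exact hn (hs.2.2.1 ▸ ⟨hX, hx⟩)
  have side : ∀ T z, IsPreconnected T → T ⊆ H.Q \ {H.f 1, H.f 4} → z ∈ T → T ⊆ X ∨ T ⊆ Y := by
    intro T z hT hd hz
    have hq : T ⊆ H.Q := hd.trans sdiff_subset
    have n1 : H.f 1 ∉ T := fun h => (hd h).2 (Or.inl rfl)
    have n4 : H.f 4 ∉ T := fun h => (hd h).2 (Or.inr rfl)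
    exact (hs.2.2.2.symm ▸ hq hz : z ∈ X ∪ Y).imp (hs.conn_side hT hq n1 n4 hz) (hs.comm.conn_side hT hq n1 n4 hz)
  rcases side _ _ (cf _ isPreconnected_Ioo) Sd m2 with a | a <;> rcases side _ _ Tc Td m5 with b | b
  · exact ne _ _ hs a b
  · exact il _ _ hs (a m2) (b m5)
  · exact il _ _ hs.comm (a m2) (b m5)
  · exact ne _ _ hs.comm a b
end Hex
end

section
open Set Filter Topology

theorem graph_homeo {Γ : Set (ℂ × ℂ)} (hc : IsCompact Γ) (hs : ∀ b x, ∃ p ∈ Γ, pj (pr b p) = x)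
    (hi : ∀ b, ∀ p ∈ Γ, ∀ q ∈ Γ, pj (pr b p) = pj (pr b q) → ∀ b', pj (pr b' p) = pj (pr b' q)) :
    ∃ h : Torus ≃ₜ Torus, ∀ p ∈ Γ, h (pj (pr true p)) = pj (pr false p) := by
  set m : ℂ × ℂ → Bool → Torus := fun p b => pj (pr b p) with hm
  have mc : Continuous m := continuous_pi fun b => pj_cont.comp (pr_cont b)
  have : CompactSpace (m '' Γ) := isCompact_iff_compactSpace.1 (hc.image mc)
  have bij : ∀ b, Function.Bijective fun x : m '' Γ => x.1 b := by
    intro b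
    constructor
    · rintro ⟨_, p, hp, rfl⟩ ⟨_, q, hq, rfl⟩ h
      exact Subtype.ext (funext fun b' => hi b p hp q hq h b')
    · intro x
      obtain ⟨p, hp, e⟩ := hs b x
      exact ⟨⟨_, p, hp, rfl⟩, e⟩
  let E : ∀ b, m '' Γ ≃ₜ Torus := fun b => Continuous.homeoOfEquivCompactToT2 (f := Equiv.ofBijective _ (bij b)) ((continuous_apply b).comp continuous_subtype_val)
  refine ⟨(E true).symm.trans (E false), fun p hp => ?_⟩
  have : (E true).symm (pj (pr true p)) = ⟨m p, p, hp, rfl⟩ := (E true).symm_apply_eq.2 rfl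
  rw [Homeomorph.trans_apply, this]; rfl

theorem pr_add (b : Bool) (x y : ℂ × ℂ) : pr b (x + y) = pr b x + pr b y := by cases b <;> rfl
def sH (k : ℂ × ℂ) (A : Set (ℂ × ℂ)) : Set (ℂ × ℂ) := (fun z => z + k) '' A
theorem pr_sH (b k A) : pr b '' sH k A = sh (pr b k) (pr b '' A) := by
  simp only [sH, sh, image_image, pr_add]

theorem Hex.X (N : Bool → Hex) (hd : ∀ b, (N b).Ind) (hp : ∀ c, ∃ m n : ℤ, ∀ b, (N b).u c = m * (N b).w + n * (N b).u 0) :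
    ∃ h : Torus ≃ₜ Torus, (∀ t, h (pj ((N true).f t)) = pj ((N false).f t)) ∧ ∀ c, h '' (pj '' (N true).K c) = pj '' (N false).K c := by
  let mk : (Bool → ℂ) → ℂ × ℂ := fun g => (g true, g false)
  have pmk : ∀ b g, pr b (mk g) = g b := by rintro (_ | _) g <;> rfl
  obtain ⟨F, hF⟩ : ∃ F : ℝ → ℂ × ℂ, ∀ b t, pr b (F t) = (N b).f t := ⟨fun t => mk fun b => (N b).f t, fun b t => pmk b (fun b => (N b).f t)⟩
  obtain ⟨D, hD⟩ : ∃ D : ℤ → ℤ → ℂ × ℂ, ∀ b m n, pr b (D m n) = m * (N b).w + n * (N b).u 0 := ⟨fun m n => mk fun b => m * (N b).w + n * (N b).u 0, fun b m n => pmk b (fun b => m * (N b).w + n * (N b).u 0)⟩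
  have Fc : Continuous F := by
    have : F = fun t => ((N true).f t, (N false).f t) := funext fun t => Prod.ext (hF true t) (hF false t)
    rw [this]; exact (N true).cont.prodMk (N false).cont
  choose m n hmn using hp
  have DL : ∀ b m n, pr b (D m n) ∈ Lam := fun b m n => by rw [hD]; exact add_mem (lam_z (N b).hw m) (lam_z ((N b).hu 0) n)
  have FD : ∀ t (j : ℤ), F (t + 6 * j) = F t + D j 0 := fun t j => pr_ext fun b => by rw [pr_add, hF, hF, hD, (N b).perZ]; simp
  have DD : ∀ a b c d, D a b + D c d = D (a + c) (b + d) := fun a b c d => pr_ext fun e => by simp only [pr_add, hD]; push_cast; ring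
  choose Kh Ka Ki using fun c : Fin 3 => double_arc (σ := fun b => (N b).K c) (s := F c.val) (t := F (c.val + 3) + D (m c) (n c)) fun b => by
    rw [pr_add, hF, hF, hD, ← hmn]; exact (N b).arc c
  have Kp : ∀ c b y, y ∈ Kh c → pr b y ∈ (N b).K c := fun c b y hy => (Ki c b).2 ▸ ⟨y, hy, rfl⟩
  let Sk : ℂ × ℂ → Prop := fun x => (∃ t a b, x = F t + D a b) ∨ ∃ c a b, ∃ y ∈ Kh c, x = y + D a b
  have L0 : ∀ c b y s k, y ∈ Kh c → k ∈ Lam → pr b y = (N b).f s + k → ∃ t a b, y = F t + D a b := by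
    intro c b y s k hy hk e
    rcases (N b).KL c _ s k (Kp c b y hy) hk e with h | h
    · refine ⟨c.val, 0, 0, (Ki c b).1 hy (by convert (Ka c).left_mem using 1; exact pr_ext fun b => by rw [pr_add, hD]; simp) ?_⟩
      rw [pr_add, hD, hF, h]; simp
    · exact ⟨c.val + 3, m c, n c, (Ki c b).1 hy (Ka c).right_mem (by rw [pr_add, hF, hD, h, hmn])⟩
  have LF : ∀ x t a b' b, Sk x → pr b x - pr b (F t + D a b') ∈ Lam → ∃ t a b, x = F t + D a b := by
    rintro x t a b' b (h | ⟨c, p, q, y, hy, rfl⟩) hl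
    · exact h
    · rw [pr_add, pr_add, hF] at hl
      obtain ⟨t, p', q', e⟩ := L0 c b y t _ hy (sub_mem (add_mem hl (DL b a b')) (DL b p q)) (by ring)
      exact ⟨t, p' + p, q' + q, by rw [e, add_assoc, DD]⟩
  have FF : ∀ b t p q s p' q', pr b (F t + D p q) - pr b (F s + D p' q') ∈ Lam → ∃ i j, F t + D p q = F s + D p' q' + D i j := by
    intro b t p q s p' q' hl
    rw [pr_add, pr_add, hF, hF] at hl
    obtain ⟨j, -, rfl⟩ := (N b).inj s t _ (sub_mem (add_mem hl (DL b p' q')) (DL b p q)) (by ring)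
    exact ⟨j + p - p', q - q', by rw [FD, add_assoc, add_assoc, DD, DD]; congr 2 <;> ring⟩
  have L1 : ∀ b x y, Sk x → Sk y → pr b x - pr b y ∈ Lam → ∃ i j, x = y + D i j := by
    intro b x y hx hy hl
    have hx' := hx; have hy' := hy
    have hl' : pr b y - pr b x ∈ Lam := lam_of (neg_mem hl) (by ring)
    rcases hx with ⟨t, p, q, rfl⟩ | ⟨c, p, q, x, hx, rfl⟩
    · obtain ⟨s, p', q', rfl⟩ := LF y _ _ _ b hy hl'
      exact FF b _ _ _ _ _ _ hl
    · rcases hy with ⟨t, p', q', rfl⟩ | ⟨c', p', q', y, hy, rfl⟩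
      · obtain ⟨s, i, j, e⟩ := LF _ _ _ _ b hx' hl
        rw [e] at hl ⊢; exact FF b _ _ _ _ _ _ hl
      · rw [pr_add, pr_add] at hl
        obtain ⟨rfl, h⟩ := (N b).KK c c' (pr b x) (pr b x - pr b y) (Kp c b x hx) (lam_of (add_mem (sub_mem hl (DL b p q)) (DL b p' q')) (by ring)) (by simpa using Kp c' b y hy)
        rw [(Ki c b).1 hx hy (sub_eq_zero.1 h)]
        exact ⟨p - p', q - q', by rw [add_assoc, DD]; congr 2 <;> ring⟩
  have L2 : ∀ b x y, Sk x → Sk y → pr b x = pr b y → x = y := by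
    intro b x y hx hy e
    obtain ⟨i, j, h⟩ := L1 b x y hx hy (by rw [e, sub_self]; exact zero_mem _)
    rw [h, pr_add, hD] at e
    obtain ⟨rfl, rfl⟩ := Hex.ind (hd b) i j (by linear_combination e)
    rw [h]; exact pr_ext fun b => by rw [pr_add, hD]; simp
  have Fm : ∀ t, Sk (F t) := fun t => Or.inl ⟨t, 0, 0, pr_ext fun b => by rw [pr_add, hD]; simp⟩
  have SkD : ∀ x i j, Sk x → Sk (x + D i j) := by
    rintro x i j (⟨t, a, b, rfl⟩ | ⟨c, a, b, y, hy, rfl⟩)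
    · exact Or.inl ⟨t, a + i, b + j, by rw [add_assoc, DD]⟩
    · exact Or.inr ⟨c, a + i, b + j, y, hy, by rw [add_assoc, DD]⟩
  have Km : ∀ c, ∀ y ∈ Kh c, Sk y := fun c y hy => Or.inr ⟨c, 0, 0, y, hy, pr_ext fun b => by rw [pr_add, hD]; simp⟩
  set Qh : Set (ℂ × ℂ) := (F '' Icc 0 6 ∪ sH (D 1 0) (Kh 0)) ∪ (Kh 0 ∪ sH (D 0 1) (F '' Icc 3 9)) with hQ
  have prF : ∀ b I, pr b '' (F '' I) = (N b).f '' I := fun b I => by rw [image_image]; simp only [hF]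
  have Qp : ∀ b, pr b '' Qh = (N b).Q := by
    intro b
    simp only [hQ, image_union, pr_sH, prF, (Ki 0 b).2, hD, Hex.Q]
    simp
  have QSk : ∀ x ∈ Qh, Sk x := by
    rintro x ((⟨t, -, rfl⟩ | ⟨y, hy, rfl⟩) | (h | ⟨_, ⟨t, -, rfl⟩, rfl⟩))
    exacts [Fm t, SkD _ _ _ (Km 0 y hy), Km 0 x h, SkD _ _ _ (Fm t)]
  have Qi : ∀ b, InjOn (pr b) Qh := fun b x hx y hy => L2 b x y (QSk x hx) (QSk y hy)
  have mQ : ∀ b x, Sk x → pr b x ∈ (N b).Q → x ∈ Qh := by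
    intro b x hx h
    rw [← Qp] at h
    obtain ⟨y, hy, e⟩ := h
    rwa [← L2 b y x (QSk y hy) hx e]
  have Qc : IsCompact Qh := by
    have a := fun k : ℂ × ℂ => (by fun_prop : Continuous fun z : ℂ × ℂ => z + k)
    exact ((isCompact_Icc.image Fc).union ((Ka 0).compact.image (a _))).union ((Ka 0).compact.union ((isCompact_Icc.image Fc).image (a _)))
  have QG : Good Qh := by
    refine ⟨?_, Qi⟩
    obtain ⟨g, gc, gl⟩ := exists_inv Qc (pr_cont true).continuousOn (Qi true)
    have e : g '' (pr true '' Qh) = Qh := gl.image_image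
    rw [← e]
    rw [Qp] at gc ⊢
    refine (Hex.jor (hd true)).image gc ?_
    rw [← Qp]
    rintro _ ⟨x, hx, rfl⟩ _ ⟨y, hy, rfl⟩ h
    rw [gl hx, gl hy] at h; rw [h]
  -- crosscuts
  set k : Fin 3 → ℂ × ℂ := fun c => D (-m c) (-m c) with hk
  set S : Fin 3 → Set (ℂ × ℂ) := fun c => sH (k c) (Kh c) with hS
  set s : Fin 3 → ℂ × ℂ := fun c => F c.val + k c with hs
  set t : Fin 3 → ℂ × ℂ := fun c => F (c.val + 3) + D (m c) (n c) + k c with ht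
  have Sa : ∀ c, IsArc (S c) (s c) (t c) := fun c => (Ka c).image (f := fun z => z + k c) (by fun_prop) (fun _ _ _ _ h => by simpa using h)
  have SS : ∀ c, ∀ x ∈ S c, Sk x := by rintro c _ ⟨y, hy, rfl⟩; exact SkD _ _ _ (Km c y hy)
  have Sp : ∀ c b, pr b '' S c = sh (pr b (k c)) ((N b).K c) := fun c b => by rw [hS]; dsimp only; rw [pr_sH, (Ki c b).2]
  have Scr : ∀ c, c ≠ 0 → ∀ b, Crosscut (pr b '' Qh) (pr b '' S c) (pr b (s c)) (pr b (t c)) := by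
    intro c c0 b
    obtain ⟨k', hk', h, h1, h2⟩ := Hex.chord (hd b) c0
    have : k' = pr b (k c) := by
      have e := hmn c b
      rw [hk]; dsimp only; rw [hD]
      rcases h1 with rfl | rfl
      · have : m c = 0 := by
          rcases h2 with h2 | h2
          · exact (Hex.ind (hd b) (m c) (n c) (by rw [← e, h2]; simp)).1
          · exact (Hex.ind (hd b) (m c) (n c - 1) (by push_cast; linear_combination h2 - e)).1
        rw [this]; simp
      · have : m c + 1 = 0 := by
          rcases h2 with h2 | h2
          · exact (Hex.ind (hd b) (m c + 1) (n c + 1) (by push_cast; linear_combination h2 - e)).1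
          · exact (Hex.ind (hd b) (m c + 1) (n c) (by push_cast; linear_combination h2 - e)).1
        rw [show m c = -1 by omega]; push_cast; ring
    rw [Qp, Sp, hs, ht]; dsimp only
    rw [pr_add, pr_add, pr_add, hF, hF, ← this, hD, ← hmn]
    exact h
  have dis : Disjoint (pr true '' S 1) (pr true '' S 2) := by
    rw [Set.disjoint_left]
    rintro x h1 h2
    rw [Sp, mem_sh] at h1 h2
    exact absurd ((N true).KK 1 2 _ (pr true (k 2) - pr true (k 1)) h1 (sub_mem (DL _ _ _) (DL _ _ _)) (by convert h2 using 1; ring)).1 (by decide)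
  have dis' : ∀ b, Disjoint (pr b '' S 1) (pr b '' S 2) := by
    intro b
    rw [Set.disjoint_left]
    rintro _ ⟨x, hx, rfl⟩ ⟨y, hy, e⟩
    rw [L2 b y x (SS 2 y hy) (SS 1 x hx) e] at hy
    exact Set.disjoint_left.1 dis ⟨x, hx, rfl⟩ ⟨x, hy, rfl⟩
  have Cc := fun c (c0 : c ≠ 0) => Scr c c0
  have mem : ∀ c, c ≠ 0 → s c ∈ Qh ∧ t c ∈ Qh := fun c c0 => ⟨mQ true _ (SS c _ (Sa c).left_mem) (Qp true ▸ (Scr c c0 true).2.1), mQ true _ (SS c _ (Sa c).right_mem) (Qp true ▸ (Scr c c0 true).2.2.1)⟩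
  have Si : ∀ c b, InjOn (pr b) (S c) := fun c b x hx y hy => L2 b x y (SS c x hx) (SS c y hy)
  have n1 : (1 : Fin 3) ≠ 0 := by decide
  have n2 : (2 : Fin 3) ≠ 0 := by decide
  obtain ⟨l, hl, C1, C2⟩ : ∃ l, Cuts Qh l ∧ (∃ G ∈ l, S 1 ⊆ G) ∧ ∃ G ∈ l, S 2 ⊆ G := by
    have main : ∀ X Y, Split Qh (s 1) (t 1) X Y → s 2 ∈ Y → t 2 ∈ Y → ∃ l, Cuts Qh l ∧ (∃ G ∈ l, S 1 ⊆ G) ∧ ∃ G ∈ l, S 2 ⊆ G := by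
      intro X Y sp h2 h2'
      have cut : Cut Qh (s 1) (t 1) X Y (S 1) := ⟨sp, Sa 1, Si 1, Scr 1 n1⟩
      have g2 := cut.comm.good QG
      obtain ⟨X2, Y2, sp2⟩ := g2.1.split (Or.inl h2) (Or.inl h2') (Sa 2).ne
      have cut2 : Cut (Y ∪ S 1) (s 2) (t 2) X2 Y2 (S 2) := by
        refine ⟨sp2, Sa 2, Si 2, fun b => ?_⟩
        have cr := Scr 2 n2 b
        have im := cut.image QG b
        obtain ⟨ic, icl, z, hz⟩ := cr.1.diff_eq
        have th := im.theta_ins (Scr 1 n1 b)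
        have nS : ∀ x ∈ pr b '' S 2, x ∉ pr b '' S 1 := fun x h h' => Set.disjoint_left.1 (dis' b) h' h
        have nQ : ∀ x ∈ pr b '' S 2 \ {pr b (s 2), pr b (t 2)}, x ∉ pr b '' Qh := fun x hx => ins_nmem (cr.2.2.2 hx)
        refine ⟨cr.1, ⟨_, Or.inl h2, rfl⟩, ⟨_, Or.inl h2', rfl⟩, ?_⟩
        rw [image_union]
        have im4 := im.2.2.2
        have dY : Disjoint (pr b '' S 2 \ {pr b (s 2), pr b (t 2)}) (pr b '' Y ∪ pr b '' S 1) := by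
          rw [Set.disjoint_left]; rintro x hx (h | h)
          · exact nQ x hx (im4 ▸ Or.inr h)
          · exact nS x hx.1 h
        have dX : Disjoint (pr b '' S 2 \ {pr b (s 2), pr b (t 2)}) (pr b '' X ∪ pr b '' S 1) := by
          rw [Set.disjoint_left]; rintro x hx (h | h)
          · exact nQ x hx (im4 ▸ Or.inl h)
          · exact nS x hx.1 h
        rcases th.2 z (cr.2.2.2 hz) with h | h | h
        · exfalso
          have cl : IsClosed (pr b '' X ∪ pr b '' S 1) := im.1.closed.union (Scr 1 n1 b).1.closed
          have hd2 := (icl.trans (closure_mono (subset_ins ic dX hz h))).trans (closure_ins cl) cr.1.left_mem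
          have : pr b (s 2) ∈ ({pr b (s 1), pr b (t 1)} : Set ℂ) := by
            rw [← (im.theta_disk (Scr 1 n1 b)).2.2]; exact ⟨hd2, ⟨_, h2, rfl⟩⟩
          refine nS _ cr.1.left_mem ?_
          rcases this with h | h
          · rw [h]; exact (Scr 1 n1 b).1.left_mem
          · rw [h]; exact (Scr 1 n1 b).1.right_mem
        · exact subset_ins ic dY hz h
        · exact absurd h (nS z hz.1)
      exact ⟨_, Cuts.node cut (Cuts.leaf _) (Cuts.node cut2 (Cuts.leaf _) (Cuts.leaf _)), ⟨X ∪ S 1, by simp, subset_union_right⟩, ⟨X2 ∪ S 2, by simp, subset_union_right⟩⟩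
    obtain ⟨X, Y, sp⟩ := QG.1.split (mem 1 n1).1 (mem 1 n1).2 (Sa 1).ne
    have il : ∀ X Y, Split Qh (s 1) (t 1) X Y → ∀ p q, Crosscut (pr true '' Qh) (pr true '' S 2) (pr true p) (pr true q) → p ∈ X → q ∈ Y → False := by
      intro X Y sp p q cr h1 h2
      obtain ⟨x, hx⟩ := interlace (sp.image (pr_cont true).continuousOn (Qi true)) (Scr 1 n1 true) cr ⟨_, h1, rfl⟩ ⟨_, h2, rfl⟩ (by
        have a := (Scr 1 n1 true).1
        rw [eq_empty_iff_forall_notMem]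
        rintro x ⟨h1, h2⟩
        refine absurd (a := x ∈ pr true '' S 2) ?_ (Set.disjoint_left.1 dis (?_ : x ∈ _))
        · rcases h2 with rfl | rfl; exacts [cr.1.left_mem, cr.1.right_mem]
        · rcases h1 with rfl | rfl; exacts [a.left_mem, a.right_mem])
      exact Set.disjoint_left.1 dis hx.1 hx.2
    have cr := Scr 2 n2 true
    have a := (mem 2 n2).1
    have b := (mem 2 n2).2
    rw [← sp.2.2.2] at a b
    rcases a with a | a <;> rcases b with b | b
    · exact main _ _ sp.comm a b
    · exact (il _ _ sp _ _ cr a b).elim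
    · exact (il _ _ sp _ _ cr.symm b a).elim
    · exact main _ _ sp a b
  obtain ⟨Γ, Γc, Γi, Γd, QΓ, lΓ⟩ := schoenflies QG hl
  have Γd' : ∀ b, pr b '' Γ = disk (N b).Q := fun b => by rw [Γd, pd, Qp]
  obtain ⟨h, hh⟩ := graph_homeo Γc (fun b x => by
      obtain ⟨z, rfl⟩ := pj_surj x
      obtain ⟨k, hk, h⟩ := Hex.cover (hd b) z
      rw [← Γd'] at h
      obtain ⟨p, hp, e⟩ := h
      exact ⟨p, hp, pj_eq.2 (lam_of (neg_mem hk) (by rw [e]; ring))⟩) (by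
    intro b p hp q hq e b'
    have pd : pr b p ∈ disk (N b).Q := Γd' b ▸ ⟨p, hp, rfl⟩
    have qd : pr b q ∈ disk (N b).Q := Γd' b ▸ ⟨q, hq, rfl⟩
    have e := pj_eq.1 e
    have back : ∀ x ∈ Γ, pr b x ∈ (N b).Q → x ∈ Qh := by
      intro x hx h
      rw [← Qp] at h
      obtain ⟨y, hy, e⟩ := h
      rwa [← Γi b (QΓ hy) hx e]
    have e' : pr b q - pr b p ∈ Lam := lam_of (neg_mem e) (by ring)
    rcases pd with pd | pd <;> rcases qd with qd | qd
    · by_cases h0 : pr b p = pr b q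
      · rw [Γi b hp hq h0]
      · exact absurd pd (by have := Hex.ins_disj (hd b) qd e (sub_ne_zero.2 h0); simpa using this)
    · exact absurd pd (by have := Hex.tr_nins (hd b) qd e; simpa using this)
    · exact absurd qd (by have := Hex.tr_nins (hd b) pd e'; simpa using this)
    · obtain ⟨i, j, h⟩ := L1 b p q (QSk p (back p hp pd)) (QSk q (back q hq qd)) e
      rw [h, pr_add, pj_add (DL _ _ _)])
  have Fh : ∀ t, h (pj ((N true).f t)) = pj ((N false).f t) := by
    intro t
    obtain ⟨j, r, hr, rfl⟩ : ∃ n : ℤ, ∃ s ∈ Icc (0 : ℝ) 6, t = s + 6 * n :=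
      ⟨⌊t / 6⌋, t - 6 * ⌊t / 6⌋, ⟨by linarith [Int.floor_le (t / 6)], by linarith [Int.lt_floor_add_one (t / 6)]⟩, by ring⟩
    have := hh (F r) (QΓ (Or.inl (Or.inl ⟨r, hr, rfl⟩)))
    rw [hF, hF] at this
    rw [Hex.perZ, Hex.perZ, pj_add (lam_z (N _).hw _), pj_add (lam_z (N _).hw _), this]
  have Kk : ∀ c (k : ℂ × ℂ), (∀ b, pr b k ∈ Lam) → sH k (Kh c) ⊆ Γ → h '' (pj '' (N true).K c) = pj '' (N false).K c := by
    intro c k hk hs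
    rw [← (Ki c true).2, ← (Ki c false).2]
    simp only [image_image]
    refine image_congr fun x hx => ?_
    have := hh _ (hs ⟨x, hx, rfl⟩)
    rwa [pr_add, pr_add, pj_add (hk _), pj_add (hk _)] at this
  refine ⟨h, Fh, fun c => ?_⟩
  by_cases c0 : c = 0
  · subst c0
    refine Kk 0 (D 0 0) (fun b => DL b _ _) (Subset.trans ?_ QΓ)
    rintro _ ⟨y, hy, rfl⟩
    refine Or.inr (Or.inl ?_)
    convert hy using 1
    exact pr_ext fun b => by rw [pr_add, hD]; simp
  · refine Kk c (k c) (fun b => DL b _ _) ?_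
    have : c = 1 ∨ c = 2 := by revert c0; revert c; decide
    rcases this with rfl | rfl
    · obtain ⟨G, hG, hs⟩ := C1; exact hs.trans (lΓ G hG)
    · obtain ⟨G, hG, hs⟩ := C2; exact hs.trans (lΓ G hG)
end

section
open Set Filter Topology

def Sc {A : Type} [AddCommGroup A] (w u : A) : Fin 4 → A := ![0, u, -(u + w), -w]
abbrev Z2 := ℤ × ℤ
def ptn (i j : Fin 4) : Fin 6 → Fin 6 → Z2 := std (1, 0) (0, 1) (Sc (1, 0) (0, 1) i) (Sc (1, 0) (0, 1) j)
def ph (w u : ℂ) : Z2 →+ ℂ where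
  toFun x := x.1 * w + x.2 * u
  map_zero' := by simp
  map_add' x y := by simp; ring
theorem Sc_map {A B : Type} [AddCommGroup A] [AddCommGroup B] (f : A →+ B) (w u : A) (i) : Sc (f w) (f u) i = f (Sc w u i) := by
  fin_cases i <;> simp [Sc]
theorem tr_map {A B : Type} [AddCommGroup A] [AddCommGroup B] (f : A →+ B) (g M i j) : tr g (fun i j => f (M i j)) i j = f (tr g M i j) := by
  have : ∀ i, nn g (fun i j => f (M i j)) i = f (nn g M i) := by
    intro i; fin_cases i <;> simp [nn]
  rw [tr, tr, this, this, map_sub, map_add]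
theorem std_map {A B : Type} [AddCommGroup A] [AddCommGroup B] (f : A →+ B) (w a b c i j) : std (f w) (f a) (f b) (f c) i j = f (std w a b c i j) := by
  fin_cases i <;> fin_cases j <;> simp [std]
def de (x y : Z2) : ℤ := x.1 * y.2 - x.2 * y.1
theorem dt_ph (w u x y) : dt (ph w u x) (ph w u y) = de x y * dt w u := by
  simp [dt, ph, de]; ring

def PE.Pat (P : PE) (i j : Fin 4) : Prop := P.Gauged ∧ dt (P.μ 5 0) (P.μ 0 3) ≠ 0 ∧ P.μ 1 4 = Sc (P.μ 5 0) (P.μ 0 3) i ∧ P.μ 2 5 = Sc (P.μ 5 0) (P.μ 0 3) j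

theorem PE.Pat.eq {P : PE} {i j} (h : P.Pat i j) : ∀ a b, ad a b → P.μ a b = ph (P.μ 5 0) (P.μ 0 3) (ptn i j a b) := by
  obtain ⟨h1, -, h3, h4⟩ := h
  intro a b hab
  have e1 : ph (P.μ 5 0) (P.μ 0 3) (1, 0) = P.μ 5 0 := by simp [ph]
  have e2 : ph (P.μ 5 0) (P.μ 0 3) (0, 1) = P.μ 0 3 := by simp [ph]
  rw [h1.std a b hab, h3, h4, ptn, ← std_map, ← Sc_map, ← Sc_map, e1, e2]

theorem PE.hexI (P : PE) (hg : P.Gauged) (hd : dt (P.μ 5 0) (P.μ 0 3) ≠ 0) : ∃ H : Hex, H.Ind ∧ H.w = P.μ 5 0 ∧ H.u 0 = P.μ 0 3 ∧ H.u 1 = P.μ 1 4 ∧ H.u 2 = P.μ 2 5 := by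
  obtain ⟨H, hw, hu, -⟩ := P.hex hg
  exact ⟨H, by rw [Hex.Ind, hw, hu]; exact hd, hw, hu 0, hu 1, hu 2⟩
theorem PE.pat (P : PE) (hg : P.Gauged) (hd : dt (P.μ 5 0) (P.μ 0 3) ≠ 0) : (∃ i j, P.Pat i j) ∧ ¬ (P.μ 1 4 = 0 ∧ P.μ 2 5 = 0) := by
  obtain ⟨H, hI, hw, h0, h1, h2⟩ := P.hexI hg hd
  have key : ∀ c : Fin 3, c ≠ 0 → ∃ i, H.u c = Sc H.w (H.u 0) i := by
    intro c hc
    obtain ⟨k, -, -, hk, h⟩ := Hex.chord hI hc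
    rcases hk with rfl | rfl <;> rcases h with h | h
    exacts [⟨0, by simp [h, Sc]⟩, ⟨1, by simp [h, Sc]⟩, ⟨2, by simp [h, Sc]⟩, ⟨3, by simp [h, Sc]⟩]
  obtain ⟨i, hi⟩ := key 1 (by decide)
  obtain ⟨j, hj⟩ := key 2 (by decide)
  rw [h1, hw, h0] at hi; rw [h2, hw, h0] at hj
  exact ⟨⟨i, j, hg, hd, hi, hj⟩, fun h => Hex.no00 hI (h1.trans h.1) (h2.trans h.2)⟩

/-- automorphisms needed -/
def tb : Fin 6 → Fin 3 → Fin 6 := ![![0, 2, 4], ![0, 4, 2], ![2, 0, 4], ![2, 4, 0], ![4, 0, 2], ![4, 2, 0]]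
def gg (a b : Fin 6) (s : Bool) (i : Fin 6) : Fin 6 :=
  (if ev i then tb a ⟨i / 2, by omega⟩ else tb b ⟨i / 2, by omega⟩ + 1) + if s then 1 else 0
theorem gg_aut : ∀ a b s, Aut (gg a b s) := by decide +kernel

theorem PE.Pat.step {P : PE} {i j} (h : P.Pat i j) (a b s) : ∃ P' : PE, P'.Gauged ∧ PRel P P' (gg a b s) ∧
    ∀ c d, ad c d → P'.μ c d = ph (P.μ 5 0) (P.μ 0 3) (tr (gg a b s) (ptn i j) c d) := by
  obtain ⟨P', h1, h2, h3⟩ := P.gauge (gg_aut a b s)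
  refine ⟨P', h1, h2, fun c d hc => ?_⟩
  rw [h3, tr_congr (gg_aut a b s) h.eq c d hc, tr_map]

theorem ph_inj {w u : ℂ} (h : dt w u ≠ 0) {x : Z2} (hx : ph w u x = 0) : x = 0 := by
  have e1 : (x.1 : ℝ) * dt w u = 0 := by
    have := congrArg (fun z => dt z u) hx
    simp [ph, dt] at this; simp only [dt]; linarith
  have e2 : (x.2 : ℝ) * dt w u = 0 := by
    have := congrArg (fun z => dt w z) hx
    simp [ph, dt] at this; simp only [dt]; linarith
  simp only [mul_eq_zero, h, or_false, Int.cast_eq_zero] at e1 e2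
  exact Prod.ext e1 e2

def isP (T : Fin 6 → Fin 6 → Z2) (i j : Fin 4) : Prop := T 1 4 = Sc (T 5 0) (T 0 3) i ∧ T 2 5 = Sc (T 5 0) (T 0 3) j
instance (T i j) : Decidable (isP T i j) := inferInstanceAs (Decidable (_ ∧ _))
def okG (T : Fin 6 → Fin 6 → Z2) : Prop := de (T 5 0) (T 0 3) ≠ 0 ∧ ((∀ k, T 1 4 ≠ Sc (T 5 0) (T 0 3) k) ∨ (∀ k, T 2 5 ≠ Sc (T 5 0) (T 0 3) k) ∨ isP T 0 0 ∨ isP T 2 1 ∨ isP T 1 1)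
instance (T) : Decidable (okG T) := inferInstanceAs (Decidable (_ ∧ _))

theorem PE.Pat.step' {P : PE} {i j} (h : P.Pat i j) (a b s) (hd : de (tr (gg a b s) (ptn i j) 5 0) (tr (gg a b s) (ptn i j) 0 3) ≠ 0) :
    ∃ P' : PE, PRel P P' (gg a b s) ∧ (∃ p q, isP (tr (gg a b s) (ptn i j)) p q) ∧ ¬ isP (tr (gg a b s) (ptn i j)) 0 0 ∧ ∀ p q, isP (tr (gg a b s) (ptn i j)) p q → P'.Pat p q := by
  obtain ⟨P', h1, h2, h3⟩ := h.step a b s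
  set T := tr (gg a b s) (ptn i j)
  set f := ph (P.μ 5 0) (P.μ 0 3) with hf
  have d' : dt (P'.μ 5 0) (P'.μ 0 3) ≠ 0 := by
    rw [h3 5 0 (by decide), h3 0 3 (by decide), dt_ph]
    exact mul_ne_zero (by exact_mod_cast hd) h.2.1
  have S' : ∀ k, Sc (P'.μ 5 0) (P'.μ 0 3) k = f (Sc (T 5 0) (T 0 3) k) := fun k => by rw [h3 5 0 (by decide), h3 0 3 (by decide), Sc_map]
  have fi : ∀ x y, f x = f y → x = y := fun x y e => sub_eq_zero.1 (ph_inj h.2.1 (by rw [map_sub]; exact sub_eq_zero.2 e))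
  have q1 := h3 1 4 (by decide)
  have q2 := h3 2 5 (by decide)
  obtain ⟨⟨p, q, -, -, e1, e2⟩, n⟩ := P'.pat h1 d'
  refine ⟨P', h2, ⟨p, q, fi _ _ ?_, fi _ _ ?_⟩, fun e => n ⟨?_, ?_⟩, fun p q e => ⟨h1, d', ?_, ?_⟩⟩
  · rw [← q1, e1, S']
  · rw [← q2, e2, S']
  · rw [q1, e.1]; simp [Sc]
  · rw [q2, e.2]; simp [Sc]
  · rw [q1, e.1, S']
  · rw [q2, e.2, S']

theorem comb1 : ∀ i j, ∃ a b s, okG (tr (gg a b s) (ptn i j)) := by decide +kernel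
def tp (k : Fin 6) : Fin 4 := if k = 0 then 2 else 1
def rp : Fin 6 → Fin 6 × Fin 6 := ![(0, 1), (0, 1), (0, 3), (0, 5), (1, 0), (1, 4)]
theorem comb2 : ∀ x, x = 2 ∨ x = 1 → ∀ c d, ad c d → ∃ k, tp k = x ∧ ∃ a b s, isP (tr (gg a b s) (ptn x 1)) x 1 ∧ de (tr (gg a b s) (ptn x 1) 5 0) (tr (gg a b s) (ptn x 1) 0 3) ≠ 0 ∧
    gg a b s (rp k).1 = c ∧ gg a b s (rp k).2 = d := by decide +kernel

def HRel (P P' : PE) (g : Fin 6 → Fin 6) (h : Torus ≃ₜ Torus) : Prop :=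
  Aut g ∧ (∀ i, h (pj (P'.v i)) = pj (P.v (g i))) ∧ ∀ i j, ad i j → h '' (pj '' P'.e i j) = pj '' P.e (g i) (g j)
theorem PRel.h {P P' P'' : PE} {g g' h} (a : PRel P P' g) (b : HRel P' P'' g' h) : HRel P P'' (g ∘ g') h :=
  ⟨⟨fun _ _ e => b.1.1 _ _ (a.1.1 _ _ e), fun _ _ e => a.1.2 _ _ (b.1.2 _ _ e)⟩, fun i => (b.2.1 i).trans (a.2.1 _),
    fun i j e => (b.2.2 i j e).trans (a.2.2 _ _ (b.1.2 _ _ e))⟩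

theorem PE.Pat.X {P P' : PE} {i j} (h : P.Pat i j) (h' : P'.Pat i j) : ∃ H, HRel P P' id H := by
  have hx : ∀ b, ∃ N : Hex, N.w = (bif b then P' else P).μ 5 0 ∧ (∀ c, N.u c = (bif b then P' else P).μ (i0 c) (i3 c)) ∧ (∀ i : Fin 6, N.f i.val = (bif b then P' else P).v i) ∧
      (∀ i : Fin 6, N.f '' Icc i.val (i.val + 1) = (bif b then P' else P).e i (i + 1)) ∧ ∀ c, N.K c = (bif b then P' else P).e (i0 c) (i3 c) := by
    intro b; cases b; exacts [P.hex h.1, P'.hex h'.1]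
  choose N hw hu hv hf hK using hx
  have hP : ∀ b, (bif b then P' else P).Pat i j := by intro b; cases b; exacts [h, h']
  have u0 : ∀ b, (N b).u 0 = (bif b then P' else P).μ 0 3 := fun b => hu b 0
  obtain ⟨H, H1, H2⟩ := Hex.X N (fun b => by rw [Hex.Ind, hw, u0]; exact (hP b).2.1) (fun c => ⟨(ptn i j (i0 c) (i3 c)).1, (ptn i j (i0 c) (i3 c)).2, fun b => by
    rw [hw, u0, hu, (hP b).eq _ _ (by revert c; decide)]; rfl⟩)
  have E1 : ∀ i : Fin 6, H '' (pj '' P'.e i (i + 1)) = pj '' P.e i (i + 1) := fun i => by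
    have a := hf true i; have b := hf false i
    rw [cond_true] at a; rw [cond_false] at b
    rw [← a, ← b]; simp only [image_image, H1]
  have E2 : ∀ c, H '' (pj '' P'.e (i0 c) (i3 c)) = pj '' P.e (i0 c) (i3 c) := fun c => by
    have := H2 c; rwa [hK, hK] at this
  have rv : ∀ (P : PE) i j, ad i j → pj '' P.e j i = pj '' P.e i j := by
    intro P i j h
    have : P.e j i = sh (-P.μ i j) (P.e i j) := by ext z; rw [mem_sh, sub_neg_eq_add, P.rev i j h]
    rw [this, pj_sh (neg_mem (P.hμ _ _))]
  refine ⟨H, by decide, fun i => ?_, fun i j hij => ?_⟩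
  · have := H1 i.val; rwa [hv, hv] at this
  · have : ∀ i j, ad i j → (j = i + 1 ∨ ∃ c, i = i0 c ∧ j = i3 c) ∨ (i = j + 1 ∨ ∃ c, j = i0 c ∧ i = i3 c) := by decide
    rcases this i j hij with (rfl | ⟨c, rfl, rfl⟩) | h
    · exact E1 i
    · exact E2 c
    · rw [rv _ j i hij.symm]; simp only [id]; rw [rv P j i hij.symm]
      rcases h with rfl | ⟨c, rfl, rfl⟩
      · exact E1 j
      · exact E2 c

theorem PE.upper (C : Fin 6 → PE) (hC : ∀ k, (C k).Pat (tp k) 1) (P : PE) {c d} (hcd : ad c d) :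
    ∃ k g h, HRel P (C k) g h ∧ g (rp k).1 = c ∧ g (rp k).2 = d := by
  have fin : ∀ x, x = 2 ∨ x = 1 → ∀ P : PE, P.Pat x 1 → ∀ c d, ad c d → ∃ k g h, HRel P (C k) g h ∧ g (rp k).1 = c ∧ g (rp k).2 = d := by
    intro x hx P hP c d hcd
    obtain ⟨k, rfl, a, b, s, h1, h2, h3, h4⟩ := comb2 x hx c d hcd
    obtain ⟨P', r, -, -, hp⟩ := hP.step' a b s h2
    obtain ⟨H, hH⟩ := (hp _ _ h1).X (hC k)
    exact ⟨k, _, H, r.h hH, h3, h4⟩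
  obtain ⟨P1, g1, a1, r1, d1⟩ := P.exists_indep
  obtain ⟨⟨i, j, h⟩, -⟩ := P1.pat a1 d1
  obtain ⟨a, b, s, hd, ho⟩ := comb1 i j
  obtain ⟨P2, r2, ⟨p, q, e1, e2⟩, n, hp⟩ := h.step' a b s hd
  obtain ⟨x, hx, h2⟩ : ∃ x, (x = 2 ∨ x = 1) ∧ P2.Pat x 1 := by
    rcases ho with h | h | h | h | h
    exacts [(h p e1).elim, (h q e2).elim, (n h).elim, ⟨2, Or.inl rfl, hp _ _ h⟩, ⟨1, Or.inr rfl, hp _ _ h⟩]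
  have r := r1.trans r2
  have sj := Finite.injective_iff_surjective.1 fun i j h => r.1.1 i j h
  obtain ⟨c', rfl⟩ := sj c
  obtain ⟨d', rfl⟩ := sj d
  have back : ∀ c' d', ad ((g1 ∘ gg a b s) c') ((g1 ∘ gg a b s) d') → ad c' d' := by
    intro c' d' h
    by_contra hn
    have q : ∀ c d : Fin 6, ¬ ad c d → ad c (c + 1) ∧ ad (c + 1) d := by decide
    have h1 := r.1.2 _ _ (q _ _ hn).1
    have h2 := r.1.2 _ _ (q _ _ hn).2
    unfold ad at h h1 h2; omega
  obtain ⟨k, g, H, hH, e1, e2⟩ := fin x hx P2 h2 c' d' (back _ _ hcd)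
  exact ⟨k, _, H, r.h hH, by rw [← e1]; rfl, by rw [← e2]; rfl⟩
end

section
open Set Filter Topology

theorem pj_lift {A : Type} [TopologicalSpace A] [SimplyConnectedSpace A] [LocallyPathConnectedSpace A] {f : A → Torus} (hf : Continuous f) :
    ∃ F : A → ℂ, Continuous F ∧ ∀ a, pj (F a) = f a := by
  have key : ∀ f : A → UnitAddCircle, Continuous f → ∃ F : A → ℝ, Continuous F ∧ ∀ a, (F a : UnitAddCircle) = f a := by
    intro f hf
    obtain ⟨a0⟩ : Nonempty A := inferInstance
    obtain ⟨x, hx⟩ := QuotientAddGroup.mk_surjective (f a0)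
    obtain ⟨F, ⟨-, h⟩, -⟩ := (AddCircle.isCoveringMap_coe (1 : ℝ)).existsUnique_continuousMap_lifts ⟨f, hf⟩ a0 x hx
    exact ⟨F, F.continuous, fun a => congrFun h a⟩
  obtain ⟨F, c, h⟩ := key _ hf.fst
  obtain ⟨G, d, k⟩ := key _ hf.snd
  exact ⟨fun a => ⟨F a, G a⟩, by
    have : (fun a => (⟨F a, G a⟩ : ℂ)) = fun a => (F a : ℂ) + G a * Complex.I := funext fun a => Complex.mk_eq_add_mul_I _ _
    rw [this]; fun_prop, fun a => Prod.ext (h a) (k a)⟩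

theorem lam_const {A : Type} [TopologicalSpace A] {S : Set A} (hS : IsPreconnected S) {f : A → ℂ} (hf : ContinuousOn f S) (h : ∀ x ∈ S, f x ∈ Lam)
    {x y : A} (hx : x ∈ S) (hy : y ∈ S) : f x = f y := by
  have d : IsDiscrete (range (Int.cast : ℤ → ℝ)) := Int.isClosedEmbedding_coe_real.isEmbedding.isDiscrete_range
  have key : ∀ g : A → ℝ, ContinuousOn g S → (∀ x ∈ S, ∃ m : ℤ, g x = m) → g x = g y := fun g hg hm =>
    hS.constant_of_mapsTo d hg (fun x hx => by obtain ⟨m, e⟩ := hm x hx; exact ⟨m, e.symm⟩) hx hy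
  exact Complex.ext (key _ (Complex.continuous_re.comp_continuousOn hf) fun x hx => (Lam_iff.1 (h x hx)).1)
    (key _ (Complex.continuous_im.comp_continuousOn hf) fun x hx => (Lam_iff.1 (h x hx)).2)

theorem PE.pinj (P : PE) {i j} (h : ad i j) : InjOn pj (P.e i j) := by
  intro x hx y hy e
  have k := pj_eq.1 e
  rcases P.disj i j i j h h x _ hx k (by simpa using hy) with ⟨-, -, h⟩ | ⟨rfl, -⟩ | ⟨l, hl⟩
  · exact sub_eq_zero.1 h
  · unfold ad at h; omega
  · have n : ∀ k ∈ Lam, P.v i ≠ P.v j + k := fun k hk e => by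
      have := P.vinj i j (by rw [e]; simpa using hk)
      subst this; unfold ad at h; omega
    have m := P.hμ i j
    rcases P.vtx i j l h x hx hl with rfl | rfl <;> rcases P.vtx i j l h y hy (lam_of (sub_mem hl k) (by ring)) with rfl | rfl
    · rfl
    · exact (n _ (add_mem m k) (by ring)).elim
    · exact (n _ (sub_mem m k) (by ring)).elim
    · rfl

theorem HRel.null {P P' : PE} {g h} (hr : HRel P P' g h) : ∃ M : ℂ → ℂ, M 0 = 0 ∧ ∃ κ : Fin 6 → ℂ, (∀ x ∈ Lam, ∀ y ∈ Lam, M (x + y) = M x + M y) ∧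
    ∀ i j, ad i j → M (P'.μ i j) + κ j = P.μ (g i) (g j) + κ i := by
  obtain ⟨H, Hc, hH⟩ := pj_lift (h.continuous.comp pj_cont)
  have Ht : ∀ z, ∀ k ∈ Lam, H (z + k) = H z + (H k - H 0) := by
    intro z k hk
    have := lam_const (f := fun z => H (z + k) - H z) isPreconnected_univ (by fun_prop) (fun x _ => pj_eq.1 (by rw [hH, hH]; simp only [Function.comp]; rw [pj_add hk])) (mem_univ z) (mem_univ 0)
    simp only [zero_add] at this
    linear_combination this
  refine ⟨fun k => H k - H 0, sub_self _, fun i => H (P'.v i) - P.v (g i), fun x hx y hy => by simp only; rw [Ht x y hy]; ring, fun i j hij => ?_⟩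
  have gij := hr.1.2 i j hij
  have A := P.arc _ _ gij
  have A' := P'.arc i j hij
  obtain ⟨s, sc, sl⟩ := exists_inv A.compact pj_cont.continuousOn (P.pinj gij)
  have im : ∀ z ∈ P'.e i j, h (pj z) ∈ pj '' P.e (g i) (g j) := fun z hz => hr.2.2 i j hij ▸ ⟨_, ⟨z, hz, rfl⟩, rfl⟩
  have := lam_const (f := fun z => H z - s (h (pj z))) A'.conn (Hc.continuousOn.sub (sc.comp (h.continuous.comp pj_cont).continuousOn im)) (fun z hz => pj_eq.1 (by
    rw [hH]; obtain ⟨y, hy, e⟩ := im z hz; simp only [Function.comp]; rw [← e, sl hy])) A'.left_mem A'.right_mem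
  rw [pj_add (P'.hμ i j), hr.2.1, hr.2.1, ← pj_add (z := P.v (g j)) (P.hμ (g i) (g j)), sl A.left_mem, sl A.right_mem, Ht _ _ (P'.hμ i j)] at this
  linear_combination -this

def sm {A : Type} [AddCommGroup A] (M : Fin 6 → Fin 6 → A) (a b c d : Fin 6) : A := M a b + M b c + M c d + M d a

theorem HRel.nul {P P' : PE} {g h} (hr : HRel P P' g h) {a b c d} (h1 : ad a b) (h2 : ad b c) (h3 : ad c d) (h4 : ad d a) (e : sm P'.μ a b c d = 0) :
    sm P.μ (g a) (g b) (g c) (g d) = 0 := by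
  obtain ⟨M, M0, κ, Ma, hM⟩ := hr.null
  have m := P'.hμ
  rw [← e, sm, Ma _ (add_mem (add_mem (m _ _) (m _ _)) (m _ _)) _ (m _ _), Ma _ (add_mem (m _ _) (m _ _)) _ (m _ _), Ma _ (m _ _) _ (m _ _)] at M0
  rw [sm] at e ⊢
  linear_combination e + M0 - hM a b h1 - hM b c h2 - hM c d h3 - hM d a h4

def ok3 (g : Fin 6 → Fin 6) : Prop := ∀ k k', k' ≠ 0 → g (rp k').1 = (rp k).1 → g (rp k').2 = (rp k).2 →
    sm (ptn (tp k) 1) (g 0) (g 1) (g 4) (g 3) = 0 → sm (ptn (tp k) 1) (g 1) (g 2) (g 5) (g 4) = 0 → k = k'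
instance (g) : Decidable (ok3 g) := by unfold ok3; infer_instance
theorem comb3 : ∀ a b, ad a b → ∀ c, a ≠ c ∧ ad b c → ∀ d, b ≠ d ∧ ad c d → ∀ e, a ≠ e ∧ c ≠ e ∧ ad d e → ∀ f, b ≠ f ∧ d ≠ f ∧ ad e f →
    ok3 ![a, b, c, d, e, f] := by decide +kernel

theorem PE.Pat.sm {P : PE} {i j} (h : P.Pat i j) {a b c d} (h1 : ad a b) (h2 : ad b c) (h3 : ad c d) (h4 : ad d a) : sm P.μ a b c d = 0 ↔ sm (ptn i j) a b c d = 0 := by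
  rw [_root_.sm, h.eq _ _ h1, h.eq _ _ h2, h.eq _ _ h3, h.eq _ _ h4, ← map_add, ← map_add, ← map_add]
  exact ⟨fun e => ph_inj h.2.1 e, fun e => by rw [_root_.sm] at e; rw [e, map_zero]⟩

theorem lower {C C' : PE} {k k'} (hC : C.Pat (tp k) 1) (hC' : C'.Pat (tp k') 1) {g h} (hr : HRel C C' g h) (k0 : k' ≠ 0)
    (h1 : g (rp k').1 = (rp k).1) (h2 : g (rp k').2 = (rp k).2) : k = k' := by
  have t : tp k' = 1 := if_neg k0
  rw [t] at hC'
  have gi := hr.1.1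
  have ga := hr.1.2
  have e1 := hr.nul (a := 0) (b := 1) (c := 4) (d := 3) (by decide) (by decide) (by decide) (by decide) ((hC'.sm (by decide) (by decide) (by decide) (by decide)).2 (by decide))
  have e2 := hr.nul (a := 1) (b := 2) (c := 5) (d := 4) (by decide) (by decide) (by decide) (by decide) ((hC'.sm (by decide) (by decide) (by decide) (by decide)).2 (by decide))
  have gv : g = ![g 0, g 1, g 2, g 3, g 4, g 5] := by ext i; fin_cases i <;> rfl
  rw [hC.sm (ga _ _ (by decide)) (ga _ _ (by decide)) (ga _ _ (by decide)) (ga _ _ (by decide))] at e1 e2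
  have n : ∀ i j, i ≠ j → g i ≠ g j := fun i j h e => h (gi _ _ e)
  have d : ∀ i j, ad i j → ad (g i) (g j) := ga
  rw [gv] at h1 h2
  exact comb3 _ _ (d 0 1 (by decide)) _ ⟨n 0 2 (by decide), d 1 2 (by decide)⟩ _ ⟨n 1 3 (by decide), d 2 3 (by decide)⟩ _ ⟨n 0 4 (by decide), n 2 4 (by decide), d 3 4 (by decide)⟩ _
    ⟨n 1 5 (by decide), n 3 5 (by decide), d 4 5 (by decide)⟩ k k' k0 h1 h2 e1 e2
end

section
open Set Filter Topology

structure TG where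
  V : Fin 6 → Torus
  E : Fin 6 → Fin 6 → Set Torus
  arc : ∀ i j, ad i j → IsArc (E i j) (V i) (V j)
  rv : ∀ i j, ad i j → E j i = E i j
  vi : ∀ i j, V i = V j → i = j
  vE : ∀ i j l, ad i j → V l ∈ E i j → l = i ∨ l = j
  EE : ∀ i j i' j', ad i j → ad i' j' → ∀ x, x ∈ E i j → x ∈ E i' j' → (i = i' ∧ j = j') ∨ (i = j' ∧ j = i') ∨ ∃ l, x = V l

def TG.im (T : TG) : Set Torus := {x | ∃ i j, ad i j ∧ x ∈ T.E i j}
def TG.F (T : TG) (i j : Fin 6) : Set Torus := {x | ∃ k l, (ad k l ∧ ¬ (i = k ∧ j = l) ∧ ¬ (i = l ∧ j = k)) ∧ x ∈ T.E k l}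
variable {T T' : TG}

theorem TG.F_closed (i j : Fin 6) : IsClosed (T.F i j) := by
  have : T.F i j = ⋃ k, ⋃ l, ⋃ (_ : ad k l ∧ ¬ (i = k ∧ j = l) ∧ ¬ (i = l ∧ j = k)), T.E k l := by
    ext x; simp only [mem_iUnion, exists_prop]; exact Iff.rfl
  rw [this]
  exact isClosed_iUnion_of_finite fun k => isClosed_iUnion_of_finite fun l => isClosed_iUnion_of_finite fun h => (T.arc k l h.1).closed
theorem TG.im_sub {i j : Fin 6} (_ : ad i j) : T.im ⊆ T.E i j ∪ T.F i j := by
  rintro x ⟨k, l, hk, hx⟩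
  by_cases h1 : i = k ∧ j = l
  · left; rwa [h1.1, h1.2]
  · by_cases h2 : i = l ∧ j = k
    · left; rwa [h2.1, h2.2, T.rv _ _ hk]
    · exact Or.inr ⟨k, l, ⟨hk, h1, h2⟩, hx⟩
theorem TG.EF {i j : Fin 6} (h : ad i j) {x} (h1 : x ∈ T.E i j) (h2 : x ∈ T.F i j) : ∃ l, x = T.V l := by
  obtain ⟨k, l, ⟨h3, h4, h5⟩, h6⟩ := h2
  rcases T.EE _ _ _ _ h h3 x h1 h6 with h | h | h
  exacts [(h4 h).elim, (h5 h).elim, h]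

def Tri (S : Set Torus) (x : Torus) : Prop := ∃ (α : Fin 3 → Set Torus) (y : Fin 3 → Torus), (∀ c, IsArc (α c) x (y c) ∧ α c ⊆ S) ∧ ∀ c c', c ≠ c' → α c ∩ α c' ⊆ {x}
theorem Tri.im {S x} (h : Tri S x) (f : Torus ≃ₜ Torus) : Tri (f '' S) (f x) := by
  obtain ⟨α, y, h1, h2⟩ := h
  refine ⟨fun c => f '' α c, fun c => f (y c), fun c => ⟨(h1 c).1.image f.continuous.continuousOn f.injective.injOn, image_mono (h1 c).2⟩, fun c c' h => ?_⟩
  simp only [← image_inter f.injective]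
  exact (image_mono (h2 c c' h)).trans (by simp)

theorem TG.tri_v (i : Fin 6) : Tri T.im (T.V i) := by
  set J : Fin 3 → Fin 6 := fun c => i + ![1, 3, 5] c with hJ
  have a : ∀ c, ad i (J c) := by revert i; decide
  refine ⟨fun c => T.E i (J c), fun c => T.V (J c), fun c => ⟨T.arc _ _ (a c), fun x hx => ⟨_, _, a c, hx⟩⟩, ?_⟩
  rintro c c' hc x ⟨h1, h2⟩
  have n : J c ≠ J c' := (by decide : ∀ (i : Fin 6) (c c' : Fin 3), c ≠ c' → i + ![1, 3, 5] c ≠ i + ![1, 3, 5] c') i c c' hc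
  rcases T.EE _ _ _ _ (a c) (a c') x h1 h2 with h | h | ⟨l, rfl⟩
  · exact (n h.2).elim
  · exact (n (h.2.trans h.1)).elim
  · rcases T.vE _ _ l (a c) h1 with rfl | rfl
    · rfl
    · rcases T.vE _ _ _ (a c') h2 with h | h
      · rw [h]; rfl
      · exact (n h).elim

theorem TG.tri {x} (hx : x ∈ T.im) (ht : Tri T.im x) : ∃ l, x = T.V l := by
  by_contra hn
  obtain ⟨i, j, hij, hx⟩ := hx
  have xF : x ∉ T.F i j := fun h => hn (TG.EF hij hx h)
  obtain ⟨γ, γc, γi, -, -, γe⟩ := T.arc i j hij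
  obtain ⟨σ, σc, σl⟩ := exists_inv isCompact_Icc γc γi
  rw [γe] at σc
  have σi : InjOn σ (T.E i j) := by
    rw [← γe]; rintro _ ⟨s, hs, rfl⟩ _ ⟨t, ht, rfl⟩ e; rw [σl hs, σl ht] at e; rw [e]
  obtain ⟨α, y, h1, h2⟩ := ht
  have key : ∀ c, ∃ a : ℝ → Torus, ∃ δ, 0 < δ ∧ a 0 = x ∧ a δ ≠ x ∧ ContinuousOn a (Icc 0 δ) ∧ ∀ s ∈ Icc 0 δ, a s ∈ α c ∧ a s ∈ T.E i j := by
    intro c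
    obtain ⟨⟨a, ac, ai, a0, -, ae⟩, aS⟩ := h1 c
    have : ∀ᶠ s in 𝓝[Icc 0 1] (0 : ℝ), a s ∈ (T.F i j)ᶜ := (ac 0 (by simp)).eventually ((TG.F_closed i j).isOpen_compl.mem_nhds (by rw [a0]; exact xF))
    obtain ⟨ε, ε0, hε⟩ := Metric.mem_nhdsWithin_iff.1 this
    set δ := min (ε / 2) 1
    have d0 : 0 < δ := by positivity
    have d1 : δ ≤ ε / 2 := min_le_left _ _
    have d2 : δ ≤ 1 := min_le_right _ _
    refine ⟨a, δ, d0, a0, fun e => d0.ne' (ai ⟨d0.le, d2⟩ (by simp) (e.trans a0.symm)), ac.mono (Icc_subset_Icc le_rfl d2), fun s hs => ?_⟩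
    have hs' : s ∈ Icc (0 : ℝ) 1 := ⟨hs.1, hs.2.trans d2⟩
    have m : a s ∈ α c := ae ▸ ⟨s, hs', rfl⟩
    refine ⟨m, (TG.im_sub hij (aS m)).resolve_right (hε ⟨?_, hs'⟩)⟩
    rw [Metric.mem_ball, Real.dist_eq, sub_zero, abs_of_nonneg hs.1]; linarith [hs.2]
  choose a δ d0 a0 ad' ac am using key
  have no : ∀ c c', c ≠ c' → σ (a c (δ c)) ∉ uIcc (σ x) (σ (a c' (δ c'))) := by
    intro c c' hc h
    have cc : ContinuousOn (fun s => σ (a c' s)) (uIcc 0 (δ c')) := by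
      rw [uIcc_of_le (d0 _).le]; exact σc.comp (ac c') fun s hs => (am c' s hs).2
    have := intermediate_value_uIcc cc
    simp only [a0] at this
    obtain ⟨s, hs, e⟩ := this h
    rw [uIcc_of_le (d0 _).le] at hs
    have m := am c (δ c) ⟨(d0 c).le, le_rfl⟩
    have e := σi (am c' s hs).2 m.2 e
    exact ad' c (h2 c c' hc ⟨m.1, e ▸ (am c' s hs).1⟩)
  have ne : ∀ c, σ (a c (δ c)) ≠ σ x := fun c e => ad' c (σi (am c _ ⟨(d0 c).le, le_rfl⟩).2 hx e)
  have lo : ∀ c c', c ≠ c' → σ (a c (δ c)) < σ x → σ x < σ (a c' (δ c')) := by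
    intro c c' hc h
    by_contra h'
    push Not at h'
    rcases le_total (σ (a c (δ c))) (σ (a c' (δ c'))) with hh | hh
    · exact no c' c hc.symm (mem_uIcc.2 (Or.inr ⟨hh, h'⟩))
    · exact no c c' hc (mem_uIcc.2 (Or.inr ⟨hh, h.le⟩))
  have hi : ∀ c c', c ≠ c' → σ x < σ (a c (δ c)) → σ (a c' (δ c')) < σ x := by
    intro c c' hc h
    by_contra h'
    push Not at h'
    rcases le_total (σ (a c (δ c))) (σ (a c' (δ c'))) with hh | hh
    · exact no c c' hc (mem_uIcc.2 (Or.inl ⟨h.le, hh⟩))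
    · exact no c' c hc.symm (mem_uIcc.2 (Or.inl ⟨h', hh⟩))
  rcases lt_or_gt_of_ne (ne 0) with h | h
  · exact lt_asymm (hi 1 2 (by decide) (lo 0 1 (by decide) h)) (lo 0 2 (by decide) h)
  · exact lt_asymm (lo 1 2 (by decide) (hi 0 1 (by decide) h)) (hi 0 2 (by decide) h)

theorem TG.clopen {K : Set Torus} (hK : IsPreconnected K) (h : K ⊆ T.im) (hv : ∀ l, T.V l ∉ K) {i j} (hij : ad i j) {x} (hx : x ∈ K) (hx' : x ∈ T.E i j) : K ⊆ T.E i j := by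
  intro y hy
  by_contra hn
  obtain ⟨z, hz, h1, h2⟩ := isPreconnected_closed_iff.1 hK _ _ (T.arc i j hij).closed (TG.F_closed i j) (h.trans (TG.im_sub hij)) ⟨x, hx, hx'⟩ ⟨y, hy, (TG.im_sub hij (h hy)).resolve_left hn⟩
  obtain ⟨l, rfl⟩ := TG.EF hij h1 h2
  exact hv l hz

theorem TG.aut {h : Torus ≃ₜ Torus} (hS : h '' T'.im = T.im) : ∃ g, Aut g ∧ (∀ i, h (T'.V i) = T.V (g i)) ∧ ∀ i j, ad i j → h '' T'.E i j = T.E (g i) (g j) := by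
  have vm : ∀ (T : TG) i, T.V i ∈ T.im := fun T i => ⟨i, i + 1, by revert i; decide, (T.arc _ _ (by revert i; decide)).left_mem⟩
  choose g hg using fun i => TG.tri (hS ▸ mem_image_of_mem h (vm T' i)) (hS ▸ (TG.tri_v (T := T') i).im h)
  have gi : ∀ i j, g i = g j → i = j := fun i j e => T'.vi i j (h.injective (by rw [hg, hg, e]))
  have gs := Finite.injective_iff_surjective.1 fun i j h => gi i j h
  have main : ∀ i j, ad i j → ∃ k l, ad k l ∧ h '' T'.E i j = T.E k l := by
    intro i j hij
    have A' := T'.arc i j hij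
    obtain ⟨ic, icl, z, hz⟩ := A'.diff_eq
    have sub : T'.E i j ⊆ T'.im := fun x hx => ⟨i, j, hij, hx⟩
    have nv : ∀ l, T'.V l ∉ T'.E i j \ {T'.V i, T'.V j} := fun l h => h.2 (by rcases T'.vE i j l hij h.1 with rfl | rfl <;> simp)
    have nv' : ∀ l, T.V l ∉ h '' (T'.E i j \ {T'.V i, T'.V j}) := by
      rintro l ⟨y, hy, e⟩
      obtain ⟨m, rfl⟩ := gs l
      rw [← hg] at e; rw [h.injective e] at hy; exact nv m hy
    obtain ⟨k, l, hkl, hx⟩ : h z ∈ T.im := hS ▸ mem_image_of_mem h (sub hz.1)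
    have A := T.arc k l hkl
    refine ⟨k, l, hkl, Subset.antisymm ?_ ?_⟩
    · have s1 := TG.clopen (ic.image h h.continuous.continuousOn) ((image_mono (sdiff_subset.trans sub)).trans hS.subset) nv' hkl (mem_image_of_mem h hz) hx
      refine (image_mono icl).trans ((image_closure_subset_closure_image h.continuous).trans (closure_minimal s1 A.closed))
    · obtain ⟨jc, jcl, -⟩ := A.diff_eq
      have zk : h z ∈ T.E k l \ {T.V k, T.V l} := ⟨hx, fun e => by
        rcases e with e | e
        exacts [nv' k ⟨z, hz, e⟩, nv' l ⟨z, hz, e⟩]⟩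
      have s2 : h.symm '' (T.E k l \ {T.V k, T.V l}) ⊆ T'.E i j := by
        refine TG.clopen (jc.image h.symm h.symm.continuous.continuousOn) ?_ ?_ hij ⟨_, zk, by simp⟩ hz.1
        · rintro _ ⟨x, hx, rfl⟩
          have : x ∈ h '' T'.im := hS ▸ ⟨k, l, hkl, hx.1⟩
          obtain ⟨y, hy, rfl⟩ := this; simpa using hy
        · rintro m ⟨x, hx, e⟩
          rw [h.symm_apply_eq, hg] at e
          subst e
          rcases T.vE _ _ _ hkl hx.1 with e | e <;> exact hx.2 (by simp [e])
      have cl : IsClosed (h '' T'.E i j) := h.isClosedMap _ A'.closed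
      refine jcl.trans (closure_minimal (fun x hx => ⟨h.symm x, s2 ⟨x, hx, rfl⟩, by simp⟩) cl)
  have both : ∀ i j, ad i j → ad (g i) (g j) ∧ h '' T'.E i j = T.E (g i) (g j) := by
    intro i j hij
    obtain ⟨k, l, hkl, e⟩ := main i j hij
    have A' := T'.arc i j hij
    have m1 := T.vE k l (g i) hkl (by rw [← hg, ← e]; exact mem_image_of_mem h A'.left_mem)
    have m2 := T.vE k l (g j) hkl (by rw [← hg, ← e]; exact mem_image_of_mem h A'.right_mem)
    have n : g i ≠ g j := fun e => by rw [gi i j e] at hij; unfold ad at hij; omega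
    rcases m1 with m1 | m1 <;> rcases m2 with m2 | m2
    · exact (n (m1.trans m2.symm)).elim
    · rw [m1, m2]; exact ⟨hkl, e⟩
    · rw [m1, m2]; exact ⟨hkl.symm, e.trans (T.rv _ _ hkl).symm⟩
    · exact (n (m1.trans m2.symm)).elim
  exact ⟨g, ⟨gi, fun i j h => (both i j h).1⟩, hg, fun i j h => (both i j h).2⟩
end

section
open Set Filter Topology

def PE.tg (P : PE) : TG where
  V i := pj (P.v i)
  E i j := pj '' P.e i j
  arc i j h := by
    have := (P.arc i j h).image pj_cont.continuousOn (P.pinj h)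
    rwa [pj_add (P.hμ i j)] at this
  rv i j h := by
    ext x; constructor
    · rintro ⟨z, hz, rfl⟩; exact ⟨_, (P.rev i j h z).1 hz, pj_add (P.hμ i j)⟩
    · rintro ⟨z, hz, rfl⟩
      exact ⟨z + P.μ j i, (P.rev j i h.symm z).1 hz, pj_add (P.hμ j i)⟩
  vi i j h := P.vinj i j (pj_eq.1 h)
  vE i j l h := by
    rintro ⟨z, hz, e⟩
    rcases P.vtx i j l h z hz (pj_eq.1 e) with rfl | rfl
    · exact Or.inl (P.vinj _ _ (pj_eq.1 e.symm))
    · exact Or.inr (P.vinj _ _ (pj_eq.1 (e.symm.trans (pj_add (P.hμ i j)))))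
  EE i j i' j' h h' x := by
    rintro ⟨z, hz, rfl⟩ ⟨z', hz', e⟩
    rcases P.disj i j i' j' h h' z (z - z') hz (pj_eq.1 e.symm) (by rwa [sub_sub_cancel]) with h | h | ⟨l, hl⟩
    · exact Or.inl ⟨h.1, h.2.1⟩
    · exact Or.inr (Or.inl ⟨h.1, h.2.1⟩)
    · exact Or.inr (Or.inr ⟨l, pj_eq.2 hl⟩)

theorem arc_lift {A : Set Torus} {a b : Torus} (h : IsArc A a b) {z : ℂ} (hz : pj z = a) :
    ∃ B w, IsArc B z w ∧ pj w = b ∧ pj '' B = A ∧ InjOn pj B := by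
  obtain ⟨γ, c, i, rfl, rfl, rfl⟩ := h
  have hc : Continuous (fun t : ℝ => γ (projIcc 0 1 zero_le_one t)) :=
    c.comp_continuous (by fun_prop) fun t => (projIcc 0 1 zero_le_one t).2
  obtain ⟨F, Fc, hF⟩ := pj_lift hc
  have hF' : ∀ t ∈ Icc (0:ℝ) 1, pj (F t - F 0 + z) = γ t := fun t ht => by
    have e : ∀ t ∈ Icc (0:ℝ) 1, pj (F t) = γ t := fun t ht => by
      have := hF t; simpa [projIcc_of_mem _ ht] using this
    rw [← e t ht]; apply pj_eq.2
    have := pj_eq.1 (hz.trans (e 0 (by simp)).symm)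
    exact lam_of this (by ring)
  have ij : InjOn pj ((fun t => F t - F 0 + z) '' Icc 0 1) := by
    rintro _ ⟨s, hs, rfl⟩ _ ⟨t, ht, rfl⟩ e
    simp only [hF' s hs, hF' t ht] at e; rw [i hs ht e]
  refine ⟨_, F 1 - F 0 + z, ⟨fun t => F t - F 0 + z, by fun_prop, fun s hs t ht e => i hs ht ?_, by simp, rfl, rfl⟩, hF' 1 (by simp), ?_, ij⟩
  · rw [← hF' s hs, ← hF' t ht, show F s - F 0 + z = F t - F 0 + z from e]
  · rw [image_image]; exact image_congr hF'

theorem TG.pe (T : TG) : ∃ P : PE, (∀ i, pj (P.v i) = T.V i) ∧ ∀ i j, ad i j → pj '' P.e i j = T.E i j := by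
  choose v hv using fun i => pj_surj (T.V i)
  have ae : ∀ {i j : Fin 6}, ev i → ¬ ev j → ad i j := fun {i j} h h' => by simp only [ev] at h h'; unfold ad; omega
  have L : ∀ i j, ∃ B w, ad i j → IsArc B (v i) w ∧ pj w = T.V j ∧ pj '' B = T.E i j ∧ InjOn pj B := fun i j => by
    by_cases h : ad i j
    · obtain ⟨B, w, h⟩ := arc_lift (T.arc i j h) (hv i); exact ⟨B, w, fun _ => h⟩
    · exact ⟨∅, 0, fun h' => (h h').elim⟩
  choose B w hB using L
  have mem : ∀ {i j z}, ad i j → z ∈ B i j → pj z ∈ T.E i j := fun h hz => (hB _ _ h).2.2.1 ▸ mem_image_of_mem _ hz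
  obtain ⟨P, h1, h2⟩ := PE.ofHalf v (fun i j => if ad i j then w i j - v j else 0) B
    (fun i j => by
      split_ifs with h
      · exact pj_eq.1 ((hB i j h).2.1.trans (hv j).symm)
      · exact zero_mem _)
    (fun i j h h' => by simpa [ae h h'] using (hB i j (ae h h')).1)
    (fun i j h => T.vi _ _ (by rw [← hv, ← hv]; exact pj_eq.2 h))
    (fun i j l h h' z hz hl => by
      have a := ae h h'
      simp only [a, if_true, add_sub_cancel]
      have e : pj z = T.V l := (pj_eq.2 hl).trans (hv l)
      rcases T.vE i j l a (e ▸ mem a hz) with rfl | rfl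
      · exact Or.inl ((hB _ _ a).2.2.2 hz (hB _ _ a).1.left_mem (e.trans (hv _).symm))
      · exact Or.inr ((hB _ _ a).2.2.2 hz (hB _ _ a).1.right_mem (e.trans (hB _ _ a).2.1.symm)))
    (fun i j i' j' h h' g g' z k hz hk hz' => by
      have e : pj (z - k) = pj z := by rw [sub_eq_add_neg]; exact pj_add (neg_mem hk)
      rcases T.EE i j i' j' (ae h h') (ae g g') _ (mem (ae h h') hz) (e ▸ mem (ae g g') hz') with ⟨rfl, rfl⟩ | ⟨rfl, rfl⟩ | ⟨l, hl⟩
      · have := (hB _ _ (ae h h')).2.2.2 hz' hz e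
        exact Or.inl ⟨rfl, rfl, by linear_combination -this⟩
      · exact (g' h).elim
      · exact Or.inr ⟨l, pj_eq.1 (hl.trans (hv l).symm)⟩)
  refine ⟨P, fun i => by rw [h1, hv], fun i j h => ?_⟩
  rcases h.ev with h' | h'
  · rw [(h2 i j h'.1 h'.2).1]; exact (hB _ _ h).2.2.1
  · rw [T.rv _ _ h.symm, ← (hB _ _ h.symm).2.2.1, ← (h2 j i h'.1 h'.2).1]
    exact P.tg.rv j i h.symm
end

section
open Set Filter Topology

def Lb : Fin 6 ≃ Fin 3 ⊕ Fin 3 where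
  toFun := ![.inl 0, .inr 0, .inl 1, .inr 1, .inl 2, .inr 2]
  invFun := Sum.elim ![0, 2, 4] ![1, 3, 5]
  left_inv := by intro i; revert i; decide
  right_inv := by intro i; revert i; decide
theorem ad_adj {i j : Fin 6} : ad i j ↔ K33.Adj (Lb i) (Lb j) := by
  revert i j; simp only [completeBipartiteGraph_adj]; decide
def ed {i j : Fin 6} (h : ad i j) : K33.edgeSet := ⟨s(Lb i, Lb j), (SimpleGraph.mem_edgeSet K33).2 (ad_adj.1 h)⟩
theorem ed_surj (e : K33.edgeSet) : ∃ i j, ∃ h : ad i j, e = ed h := by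
  obtain ⟨e, he⟩ := e
  induction e using Sym2.ind with | _ x y =>
  exact ⟨Lb.symm x, Lb.symm y, by rw [ad_adj]; simpa using he, Subtype.ext (by simp [ed])⟩
theorem ed_eq {i j i' j'} {h : ad i j} {h' : ad i' j'} : ed h = ed h' ↔ (i = i' ∧ j = j') ∨ (i = j' ∧ j = i') := by
  simp [ed, Subtype.ext_iff]

structure Mt (X : TorusEmbedding K33) (T : TG) : Prop where
  v : ∀ i, X.vert (Lb i) = T.V i
  e : ∀ i j (h : ad i j), range (X.edge (ed h)) = T.E i j
theorem Mt.im {X T} (m : Mt X T) : X.image = T.im := by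
  ext x
  rw [TorusEmbedding.image, mem_iUnion]
  constructor
  · rintro ⟨e, hx⟩
    obtain ⟨i, j, h, rfl⟩ := ed_surj e
    exact ⟨i, j, h, m.e i j h ▸ hx⟩
  · rintro ⟨i, j, h, hx⟩
    exact ⟨ed h, m.e i j h ▸ hx⟩

theorem path_arc {a b : Torus} (f : C(unitInterval, Torus)) (hi : Function.Injective f) (h0 : f 0 = a) (h1 : f 1 = b) : IsArc (range f) a b := by
  refine ⟨fun t => f (projIcc 0 1 zero_le_one t), by fun_prop, fun s hs t ht e => ?_, ?_, ?_, ?_⟩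
  · simpa [projIcc_of_mem _ hs, projIcc_of_mem _ ht] using hi e
  · simpa using h0
  · simpa using h1
  · ext x; constructor
    · rintro ⟨t, -, rfl⟩; exact ⟨_, rfl⟩
    · rintro ⟨t, rfl⟩; exact ⟨t, t.2, by simp⟩
theorem arc_path {A : Set Torus} {a b : Torus} (h : IsArc A a b) : ∃ f : C(unitInterval, Torus), Function.Injective f ∧ f 0 = a ∧ f 1 = b ∧ range f = A := by
  obtain ⟨γ, c, i, rfl, rfl, rfl⟩ := h
  exact ⟨⟨fun t => γ t, c.comp_continuous (by fun_prop) fun t => t.2⟩, fun s t e => Subtype.ext (i s.2 t.2 e), by simp, by simp, by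
    rw [image_eq_range]; rfl⟩

theorem tg_of (X : TorusEmbedding K33) : ∃ T, Mt X T := by
  have sy : ∀ {i j} (h : ad i j), ed h.symm = ed h := fun h => ed_eq.2 (Or.inr ⟨rfl, rfl⟩)
  have A : ∀ i j (h : ad i j), IsArc (range (X.edge (ed h))) (X.vert (Lb i)) (X.vert (Lb j)) := fun i j h => by
    obtain ⟨u, v, e, h0, h1⟩ := X.edge_ends (ed h)
    have := path_arc _ (X.edge_inj _) h0 h1
    simp only [ed, Sym2.eq_iff] at e
    rcases e with ⟨rfl, rfl⟩ | ⟨rfl, rfl⟩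
    exacts [this, this.symm]
  have En : ∀ i j (h : ad i j) x, x ∈ range (X.edge (ed h)) → x ∈ range X.vert → x = X.vert (Lb i) ∨ x = X.vert (Lb j) := by
    rintro i j h _ ⟨t, rfl⟩ hv
    obtain ⟨u, v, e, h0, h1⟩ := X.edge_ends (ed h)
    simp only [ed, Sym2.eq_iff] at e
    rcases X.edge_meets_verts _ t hv with rfl | rfl <;> rcases e with ⟨rfl, rfl⟩ | ⟨rfl, rfl⟩ <;> tauto
  refine ⟨⟨fun i => X.vert (Lb i), fun i j => {x | ∃ h : ad i j, x ∈ range (X.edge (ed h))}, fun i j h => ?_, fun i j h => ?_, fun i j h => Lb.injective (X.vert_inj h), ?_, ?_⟩, ⟨fun i => rfl, fun i j h => ?_⟩⟩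
  · convert A i j h using 1; ext x; exact ⟨fun h => h.2, fun k => ⟨h, k⟩⟩
  · ext x
    constructor
    · rintro ⟨h', k⟩; exact ⟨h, by rw [← sy]; exact k⟩
    · rintro ⟨h', k⟩; exact ⟨h.symm, by rw [sy h]; exact k⟩
  · rintro i j l h ⟨_, k⟩
    exact (En i j h _ k ⟨_, rfl⟩).imp (fun e => Lb.injective (X.vert_inj e)) (fun e => Lb.injective (X.vert_inj e))
  · rintro i j i' j' h h' x ⟨_, t, ht⟩ ⟨_, t', ht'⟩
    rw [← or_assoc]
    by_cases n : ed h = ed h'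
    · exact Or.inl (ed_eq.1 n)
    · obtain ⟨w, -, -, hw⟩ := X.edge_disjoint _ _ n t t' (ht.trans ht'.symm)
      exact Or.inr ⟨Lb.symm w, by simp [← hw, ht]⟩
  · ext x; exact ⟨fun k => ⟨h, k⟩, fun h => h.2⟩

theorem emb_of (T : TG) : ∃ X, Mt X T := by
  choose a b hab he using ed_surj
  choose f fi f0 f1 fr using fun e => arc_path (T.arc _ _ (hab e))
  have inr : ∀ e t, f e t ∈ T.E (a e) (b e) := fun e t => fr e ▸ mem_range_self t
  have En : ∀ e t l, f e t = T.V l → (l = a e ∨ l = b e) ∧ (t = 0 ∨ t = 1) := fun e t l h => by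
    have := T.vE _ _ l (hab e) (h ▸ inr e t)
    refine ⟨this, ?_⟩
    rcases this with rfl | rfl
    · exact Or.inl (fi e (h.trans (f0 e).symm))
    · exact Or.inr (fi e (h.trans (f1 e).symm))
  have im : ∀ e l, (l = a e ∨ l = b e) → Lb l ∈ (e : Sym2 (Fin 3 ⊕ Fin 3)) := fun e l h => by
    rw [he e]; rcases h with rfl | rfl <;> simp [ed]
  refine ⟨⟨fun x => T.V (Lb.symm x), fun x y h => Lb.symm.injective (T.vi _ _ h), f, fun e => ⟨Lb (a e), Lb (b e), congrArg Subtype.val (he e), by simp [f0], by simp [f1]⟩, fi, ?_, ?_⟩, ⟨fun i => by simp, fun i j h => ?_⟩⟩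
  · rintro e t ⟨x, hx⟩; exact (En e t _ hx.symm).2
  · intro e e' n t t' h
    rcases T.EE _ _ _ _ (hab e) (hab e') _ (inr e t) (h ▸ inr e' t') with k | k | ⟨l, hl⟩
    · exact (n (by rw [he e, he e', ed_eq]; exact Or.inl k)).elim
    · exact (n (by rw [he e, he e', ed_eq]; exact Or.inr k)).elim
    · exact ⟨Lb l, im _ _ (En e t l hl).1, im _ _ (En e' t' l (h ▸ hl)).1, by simp [hl]⟩
  · have := ed_eq.1 (he (ed h))
    show range (f (ed h)) = _
    rw [fr]
    rcases this with ⟨h1, h2⟩ | ⟨h1, h2⟩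
    · rw [← h1, ← h2]
    · rw [← h1, ← h2, T.rv _ _ h]
end

section
open Set Filter Topology

def sg (s : Bool) (i j : Fin 6) : ℤ := if j = i + 3 then (if i = 4 then cond s 1 (-1) else 1) else if j = i + 1 then 1 else -1
def cx (i j : Fin 6) : ℤ := if j = i + 3 then 3 else 1
def cy (i j : Fin 6) : ℤ := if j = i + 3 then 1 else 0
def mx (s : Bool) (i j : Fin 6) : ℤ := (i.val - j.val + sg s i j * cx i j) / 6

theorem canon (s : Bool) : ∃ P : PE, ∀ i j, ev i → ¬ ev j → P.μ i j = mx s i j + ((sg s i j * cy i j : ℤ) : ℂ) * Complex.I := by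
  let v : Fin 6 → ℂ := fun i => ⟨(i.val : ℤ) / 6, 0⟩
  let M : Fin 6 → Fin 6 → ℂ := fun i j => mx s i j + ((sg s i j * cy i j : ℤ) : ℂ) * Complex.I
  let f : Fin 6 → Fin 6 → ℝ → ℂ := fun i j t => ⟨((i.val : ℤ) + t * cx i j) / 6, t * cy i j⟩
  have f0 : ∀ i j, f i j 0 = v i := fun i j => by simp [f, v]
  have hM : ∀ i j, M i j ∈ Lam := fun i j => ⟨_, _, rfl⟩
  have sq : ∀ i j, sg s i j = 1 ∨ sg s i j = -1 := (by decide : ∀ s i j, sg s i j = 1 ∨ sg s i j = -1) s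
  have f1 : ∀ i j, ev i → ¬ ev j → f i j (sg s i j) = v j + M i j := fun i j h h' => by
    have := (by decide : ∀ s i j, ev i → ¬ ev j → 6 * mx s i j = i.val - j.val + sg s i j * cx i j) s i j h h'
    have : (6 : ℝ) * mx s i j = (i.val : ℤ) - (j.val : ℤ) + sg s i j * cx i j := by exact_mod_cast this
    apply Complex.ext
    · simp [f, v, M]; simp at this; linarith
    · simp [f, v, M]
  have vl : ∀ i j (n : ℤ) (t : ℝ), ev i → ¬ ev j → t = n → t ∈ segment ℝ (0 : ℝ) (sg s i j) → f i j t = v i ∨ f i j t = v j + M i j := by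
    intro i j n t h h' e ht
    have : n = 0 ∨ n = sg s i j := by
      rcases sq i j with k | k <;> rw [k] at ht ⊢ <;> rw [e] at ht <;> simp [segment_eq_uIcc, uIcc] at ht
      · have h1 : 0 ≤ n := by exact_mod_cast ht.1
        have h2 : n ≤ 1 := by exact_mod_cast ht.2
        omega
      · have h1 : -1 ≤ n := by exact_mod_cast ht.1
        have h2 : n ≤ 0 := by exact_mod_cast ht.2
        omega
    rcases this with rfl | rfl
    · left; rw [e, ← f0 i j]; simp
    · right; rw [e, f1 i j h h']
  have vl' : ∀ i j (n : ℤ) (t : ℝ), ev i → ¬ ev j → t = n → t ∈ segment ℝ (0 : ℝ) (sg s i j) → ∃ l, f i j t - v l ∈ Lam := by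
    intro i j n t h h' e ht
    rcases vl i j n t h h' e ht with k | k
    · exact ⟨i, by rw [k, sub_self]; exact zero_mem _⟩
    · exact ⟨j, by rw [k, add_sub_cancel_left]; exact hM _ _⟩
  have ab : ∀ i j t, t ∈ segment ℝ (0 : ℝ) (sg s i j) → |t| ≤ 1 ∧ 0 ≤ t * sg s i j := by
    intro i j t ht
    rcases sq i j with k | k <;> rw [k] at ht ⊢ <;> simp [segment_eq_uIcc, uIcc] at ht ⊢ <;> rw [abs_le] <;> constructor <;> (try constructor) <;> linarith
  refine (PE.ofHalf v M (fun i j => f i j '' segment ℝ 0 (sg s i j)) hM ?_ ?_ ?_ ?_).imp fun P hP i j h h' => (hP.2 i j h h').2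
  · intro i j h h'
    rw [← f1 i j h h', ← f0 i j]
    have c0 : (cx i j : ℝ) ≠ 0 := by unfold cx; split_ifs <;> norm_num
    have n0 : (0 : ℝ) ≠ sg s i j := by rcases sq i j with k | k <;> rw [k] <;> norm_num
    refine (isArc_segment n0).image ?_ ?_
    · have : f i j = fun t : ℝ => ((((i.val : ℤ) + t * cx i j) / 6 : ℝ) : ℂ) + ((t * cy i j : ℝ) : ℂ) * Complex.I := by
        ext t; apply Complex.ext <;> simp [f]
      rw [this]; fun_prop
    · intro t _ t' _ e
      have := congrArg Complex.re e
      simp only [f] at this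
      exact mul_right_cancel₀ c0 (by linarith)
  · intro i j h
    obtain ⟨⟨m, hm⟩, -⟩ := Lam_iff.1 h
    simp only [v, Complex.sub_re] at hm
    have : (i.val : ℤ) - (j.val : ℤ) = 6 * m := by
      have : ((i.val : ℤ) : ℝ) - (j.val : ℤ) = 6 * m := by linarith
      exact_mod_cast this
    omega
  · rintro i j l h h' _ ⟨t, ht, rfl⟩ hl
    obtain ⟨⟨m, hm⟩, n, hn⟩ := Lam_iff.1 hl
    simp only [v, f, Complex.sub_re, Complex.sub_im] at hm hn
    by_cases k : j = i + 3
    · simp only [cy, if_pos k] at hn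
      exact vl i j n t h h' (by push_cast at hn; linarith) ht
    · simp only [cx, if_neg k] at hm
      exact vl i j (6 * m + l.val - i.val) t h h' (by push_cast at hm ⊢; linarith) ht
  · rintro i j i' j' h h' g g' _ k ⟨t, ht, rfl⟩ hk ⟨t', ht', e⟩
    by_cases ti : ∃ n : ℤ, t = n
    · obtain ⟨n, hn⟩ := ti; exact Or.inr (vl' i j n t h h' hn ht)
    by_cases ti' : ∃ n : ℤ, t' = n
    · obtain ⟨n, hn⟩ := ti'
      obtain ⟨l, hl⟩ := vl' i' j' n t' g g' hn ht'
      rw [e] at hl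
      exact Or.inr ⟨l, lam_of (add_mem hl hk) (by ring)⟩
    obtain ⟨⟨m, hm⟩, n, hn⟩ := Lam_iff.1 hk
    have e1 := congrArg Complex.re e; have e2 := congrArg Complex.im e
    simp only [f, Complex.sub_re, Complex.sub_im, hm, hn] at e1 e2
    have a := ab i j t ht; have a' := ab i' j' t' ht'
    have lt : |t| < 1 := lt_of_le_of_ne a.1 fun k => ti (by
      rcases (abs_eq zero_le_one).1 k with k | k
      · exact ⟨1, by simpa using k⟩
      · exact ⟨-1, by simpa using k⟩)
    rw [abs_lt] at lt; rw [abs_le] at a'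
    have key : ∀ q : ℤ, t - t' = q → q % 2 = 0 → t = t' ∧ q = 0 := by
      intro q hq h2
      have l1 : (-2 : ℝ) < q := by linarith [a'.1.2]
      have l2 : (q : ℝ) < 2 := by linarith [a'.1.1]
      have l1 : -2 < q := by exact_mod_cast l1
      have l2 : q < 2 := by exact_mod_cast l2
      have : q = 0 := by omega
      subst this
      exact ⟨by simpa [sub_eq_zero] using hq, rfl⟩
    simp only [ev] at h g
    left
    by_cases c : j = i + 3 <;> by_cases c' : j' = i' + 3
    · simp only [cx, cy, if_pos c, if_pos c'] at e1 e2
      push_cast at e1 e2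
      have r : ((i.val : ℤ) : ℝ) - (i'.val : ℤ) - 6 * m + 3 * n = 0 := by push_cast; linarith
      have r : (i.val : ℤ) - (i'.val : ℤ) - 6 * m + 3 * n = 0 := by exact_mod_cast r
      obtain ⟨-, rfl⟩ := key n (by linarith) (by omega)
      obtain rfl : i = i' := by omega
      obtain rfl : m = 0 := by omega
      exact ⟨rfl, by rw [c, c'], Complex.ext (by simpa using hm) (by simpa using hn)⟩
    · simp only [cy, if_pos c, if_neg c'] at e2
      exact (ti ⟨n, by push_cast at e2; linarith⟩).elim
    · simp only [cy, if_neg c, if_pos c'] at e2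
      exact (ti' ⟨-n, by push_cast at e2 ⊢; linarith⟩).elim
    · simp only [cx, cy, if_neg c, if_neg c'] at e1 e2
      push_cast at e1 e2
      obtain ⟨tt, r⟩ := key (i'.val - i.val + 6 * m) (by push_cast; linarith) (by omega)
      have n0 : (n : ℝ) = 0 := by linarith
      obtain rfl : i = i' := by omega
      obtain rfl : m = 0 := by omega
      refine ⟨rfl, ?_, Complex.ext (by simpa using hm) (by simpa [n0] using hn)⟩
      subst tt
      have t0 : t ≠ 0 := fun k => ti ⟨0, by simpa using k⟩
      have : sg s i j = sg s i j' := by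
        have a := a.2; have a' := a'.2
        rcases lt_or_gt_of_ne t0 with q | q <;> rcases sq i j with u | u <;> rcases sq i j' with u' | u' <;> rw [u] at a ⊢ <;> rw [u'] at a' ⊢ <;> push_cast at a a' <;> exfalso <;> linarith
      simp only [sg, if_neg c, if_neg c'] at this
      exact (by decide : ∀ i j j' : Fin 6, (ev i ∧ ¬ ev j ∧ ¬ ev j' ∧ ¬ j = i + 3 ∧ ¬ j' = i + 3 ∧ (if j = i + 1 then (1:ℤ) else -1) = if j' = i + 1 then 1 else -1) → j = j') i j j' ⟨h, h', g', c, c', this⟩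

theorem canon_pat (s : Bool) : ∃ P : PE, P.Pat (cond s 2 1) 1 := by
  obtain ⟨P, h⟩ := canon s
  have n : ∀ i j, ev i → ¬ ev j → P.μ j i = -(mx s i j + ((sg s i j * cy i j : ℤ) : ℂ) * Complex.I) := fun i j a b => by rw [P.anti, h i j a b]
  have h05 := n 0 5 (by decide) (by decide)
  have h41 := n 4 1 (by decide) (by decide)
  have h03 := h 0 3 (by decide) (by decide)
  have h25 := h 2 5 (by decide) (by decide)
  refine ⟨P, fun i hi => ?_, ?_, ?_, ?_⟩
  · by_cases e : ev i
    · rw [h i _ e (by revert i; decide)]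
      have := (by decide : ∀ s, ∀ i : Fin 6, i ≠ 5 → ev i → mx s i (i + 1) = 0 ∧ sg s i (i + 1) * cy i (i + 1) = 0) s i hi e
      rw [this.1, this.2]; simp
    · rw [n (i + 1) i (by revert i; decide) e]
      have := (by decide : ∀ s, ∀ i : Fin 6, i ≠ 5 → ¬ ev i → mx s (i + 1) i = 0 ∧ sg s (i + 1) i * cy (i + 1) i = 0) s i hi e
      rw [this.1, this.2]; simp
  all_goals
    obtain ⟨a1, a2, a3, a4, a5, a6, a7, a8⟩ := (by decide : ∀ s, mx s 0 5 = -1 ∧ sg s 0 5 * cy 0 5 = 0 ∧ mx s 0 3 = 0 ∧ sg s 0 3 * cy 0 3 = 1 ∧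
      mx s 2 5 = 0 ∧ sg s 2 5 * cy 2 5 = 1 ∧ mx s 4 1 = cond s 1 0 ∧ sg s 4 1 * cy 4 1 = cond s 1 (-1)) s
    rw [a1, a2] at h05; rw [a3, a4] at h03; rw [a5, a6] at h25; rw [a7, a8] at h41
    try rw [h05]
    rw [h03]
  · simp [dt]
  · rw [h41]; cases s <;> simp [Sc, add_comm]
  · rw [h25]; simp [Sc]
end

section
open Set Filter Topology

theorem im_of {T T' : TG} {g : Fin 6 → Fin 6} {h : Torus ≃ₜ Torus} (hg : Aut g) (hE : ∀ i j, ad i j → h '' T'.E i j = T.E (g i) (g j)) :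
    h '' T'.im = T.im := by
  have gs : Function.Surjective g := Finite.injective_iff_surjective.1 fun i j => hg.1 i j
  ext x; constructor
  · rintro ⟨y, ⟨i, j, hij, hy⟩, rfl⟩
    exact ⟨_, _, hg.2 i j hij, hE i j hij ▸ mem_image_of_mem _ hy⟩
  · rintro ⟨i, j, hij, hx⟩
    obtain ⟨i, rfl⟩ := gs i; obtain ⟨j, rfl⟩ := gs j
    have a : ad i j := by
      by_contra n
      obtain ⟨l, h1, h2⟩ := (by decide : ∀ i j, ¬ ad i j → ∃ l, ad i l ∧ ad l j) i j n
      have := hg.2 _ _ h1; have := hg.2 _ _ h2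
      unfold ad at *; omega
    rw [← hE i j a] at hx
    obtain ⟨y, hy, rfl⟩ := hx
    exact ⟨y, ⟨i, j, a, hy⟩, rfl⟩

theorem six (C : Fin 6 → PE) (hC : ∀ k, (C k).Pat (tp k) 1) : Nat.card (Quot DirEdgedEquiv) = 6 := by
  have eqv : Equivalence DirEdgedEquiv := by
    refine ⟨fun D => ⟨Homeomorph.refl _, by simp, by simp, rfl, rfl⟩, ?_, ?_⟩
    · rintro D D' ⟨h, h1, h2, h3, h4⟩
      exact ⟨h.symm, by rw [← h1, image_image]; simp, by rw [← h2, image_image]; simp, by rw [← h3]; simp, by rw [← h4]; simp⟩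
    · rintro D D' D'' ⟨h, h1, h2, h3, h4⟩ ⟨k, k1, k2, k3, k4⟩
      refine ⟨k.trans h, ?_, ?_, by simp [k3, h3], by simp [k4, h4]⟩
      · rw [← h1, ← k1, image_image]; rfl
      · rw [← h2, ← k2, image_image]; rfl
  choose X hX using fun k => emb_of (C k).tg
  have ar : ∀ k, ad (rp k).1 (rp k).2 := by decide
  let D : Fin 6 → DirEdgedEmbedding := fun k => ⟨X k, Lb (rp k).1, Lb (rp k).2, ad_adj.1 (ar k)⟩
  have low : ∀ k k', k' ≠ 0 → DirEdgedEquiv (D k) (D k') → k = k' := by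
    rintro k k' k0 ⟨h, h1, -, h3, h4⟩
    simp only [D, (hX k).im, (hX k').im, (hX k).v, (hX k').v] at h1 h3 h4
    obtain ⟨g, a, b, c⟩ := TG.aut h1
    exact lower (hC k) (hC k') ⟨a, b, c⟩ k0 ((C k).tg.vi _ _ ((b _).symm.trans h3)) ((C k).tg.vi _ _ ((b _).symm.trans h4))
  have bij : Function.Bijective (fun k => Quot.mk DirEdgedEquiv (D k)) := by
    constructor
    · intro k k' h
      have h := (Equivalence.quot_mk_eq_iff eqv _ _).1 h
      by_cases k0 : k' = 0
      · by_cases k1 : k = 0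
        · rw [k0, k1]
        · exact (low k' k k1 (eqv.symm h)).symm
      · exact low k k' k0 h
    · intro q
      induction q using Quot.ind with | _ Y =>
      obtain ⟨T, m⟩ := tg_of Y.emb
      obtain ⟨P, hv, hE⟩ := T.pe
      obtain ⟨Y, u, v, uv⟩ := Y
      obtain ⟨c, rfl⟩ := Lb.surjective u; obtain ⟨d, rfl⟩ := Lb.surjective v
      obtain ⟨k, g, h, r, h1, h2⟩ := PE.upper C hC P (ad_adj.2 uv)
      have r3 : ∀ i j, ad i j → h '' (C k).tg.E i j = T.E (g i) (g j) := fun i j a =>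
        (r.2.2 i j a).trans (hE _ _ (r.1.2 i j a))
      have r2 : ∀ i, h ((C k).tg.V i) = T.V (g i) := fun i => (r.2.1 i).trans (hv _)
      refine ⟨k, (Quot.sound ⟨h, ?_, ?_, ?_, ?_⟩).symm⟩
      · rw [m.im, (hX k).im, im_of r.1 r3]
      · subst h1 h2
        exact (congrArg (h '' ·) ((hX k).e _ _ (ar k))).trans ((r3 _ _ (ar k)).trans (m.e _ _ (ad_adj.2 uv)).symm)
      · simp only [D, (hX k).v, r2, h1]; exact (m.v _).symm
      · simp only [D, (hX k).v, r2, h2]; exact (m.v _).symm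
  rw [← Nat.card_congr (Equiv.ofBijective _ bij), Nat.card_fin]
end

/-- There are exactly six directed edged embeddings of `K_{3,3}` into the torus up to
equivalence. -/
theorem six_directed_edged_embeddings_of_K33_in_torus :
    Nat.card (Quot DirEdgedEquiv) = 6 := by
  obtain ⟨A, hA⟩ := canon_pat true
  obtain ⟨B, hB⟩ := canon_pat false
  refine six (fun k => if k = 0 then A else B) fun k => ?_
  by_cases h : k = 0
  · rw [if_pos h, tp, if_pos h]; exact hA
  · rw [if_neg h, tp, if_neg h]; exact hB
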